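/- Let T be an o-minimal complete theory in a countable language. Then either T has 2^{ℵ₀} pairwise non-isomorphic countable models, or T has exactly 3^k · 6^s pairwise non-isomorphic countable models for some natural numbers k and s. -/

import Mathlib

open FirstOrder FirstOrder.Language Cardinal

universe u v w w'

namespace QOM

variable {L : FirstOrder.Language.{u, v}}

/-- Bundled countable models of `T` (carrier in `Type 0`). -/
def CtbleModel (T : L.Theory) : Type _ :=
  { M : Theory.ModelType.{u, v, 0} T // Countable M.Carrier }

/-- Isomorphism is an equivalence relation on countable models. -/
def isoSetoid (T : L.Theory) : Setoid (CtbleModel T) where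
  r M N := Nonempty (M.1.Carrier ≃[L] N.1.Carrier)
  iseqv := ⟨fun M => ⟨Language.Equiv.refl L M.1.Carrier⟩,
    fun ⟨e⟩ => ⟨e.symm⟩, fun ⟨e⟩ ⟨f⟩ => ⟨f.comp e⟩⟩

/-- `I(T,ω)`: the number of pairwise non-isomorphic countable models of `T`. -/
noncomputable def IOmega (T : L.Theory) : Cardinal :=
  #(Quotient (isoSetoid T))

/-- The binary relation interpreting the symbol `lt` in `M`. -/
def ltInterp (lt : L.Relations 2) {M : Type*} [L.Structure M] : M → M → Prop :=
  fun a b => Structure.RelMap lt ![a, b]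

/-- `r` is a strict linear order. -/
def IsStrictLinearOrderRel {M : Type*} (r : M → M → Prop) : Prop :=
  (∀ a, ¬ r a a) ∧ (∀ a b c, r a b → r b c → r a c) ∧ (∀ a b, r a b ∨ a = b ∨ r b a)

/-- A subset of `M` definable with parameters. -/
def DefinableWithParams (L : FirstOrder.Language.{u, v}) (M : Type w) [L.Structure M]
    (s : Set M) : Prop :=
  ∃ (k : ℕ) (φ : L.Formula (Fin k ⊕ Fin 1)) (c : Fin k → M),
    s = {x | φ.Realize (Sum.elim c (fun _ => x))}

/-- The open interval of `r` with endpoints in `M ∪ {-∞}` and `M ∪ {+∞}`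
(`none` codes `-∞`/`+∞`). -/
def OIntv {M : Type*} (r : M → M → Prop) (a b : Option M) : Set M :=
  {x | (∀ y ∈ a, r y x) ∧ (∀ y ∈ b, r x y)}

/-- `M` is an o-minimal structure (with respect to the order symbol `lt`): every definable
subset of `M` is a finite union of singletons and open intervals. -/
def OMinimalStructure (lt : L.Relations 2) (M : Type w) [L.Structure M] : Prop :=
  IsStrictLinearOrderRel (ltInterp lt (M := M)) ∧
  ∀ s : Set M, DefinableWithParams L M s →
    ∃ (N : ℕ) (f : Fin N → Set M), s = ⋃ i, f i ∧
      ∀ i, (∃ x, f i = {x}) ∨ ∃ a b : Option M, f i = OIntv (ltInterp lt) a b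

/-- `T` is an o-minimal theory: every model of `T` is o-minimal. -/
def OMinimalTheory (lt : L.Relations 2) (T : L.Theory) : Prop :=
  ∀ (M : Type w) [L.Structure M], M ⊨ T → OMinimalStructure lt M

end QOM

set_option linter.unusedVariables false
set_option linter.unusedSectionVars false

namespace QOM

/-- prepend -/
def cons {M : Type} (a : M) (v : ℕ → M) : ℕ → M
  | 0 => a
  | i + 1 => v i

/-- Abstract saturated o-minimal structure with its definable predicates. -/
class OM (M : Type) extends LinearOrder M where
  dp : Set M → ((ℕ → M) → Prop) → Prop
  mono : ∀ {A B : Set M} {P : (ℕ → M) → Prop}, A ⊆ B → dp A P → dp B P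
  and : ∀ {A : Set M} {P Q : (ℕ → M) → Prop}, dp A P → dp A Q → dp A (fun v => P v ∧ Q v)
  not : ∀ {A : Set M} {P : (ℕ → M) → Prop}, dp A P → dp A (fun v => ¬ P v)
  ex' : ∀ {A : Set M} {P : (ℕ → M) → Prop}, dp A P → dp A (fun v => ∃ y, P (cons y v))
  ren : ∀ {A : Set M} {P : (ℕ → M) → Prop} (s : ℕ → ℕ), dp A P → dp A (fun v => P (fun i => v (s i)))
  eq0 : dp ∅ (fun v => v 0 = v 1)
  lt0 : dp ∅ (fun v => v 0 < v 1)
  cst : ∀ a : M, dp {a} (fun v => v 0 = a)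
  extr : ∀ {A : Set M} {P : (ℕ → M) → Prop} {a : M}, dp (insert a A) P →
    ∃ P', dp A P' ∧ ∀ v, P v ↔ P' (cons a v)
  fin : ∀ {A : Set M} {P : (ℕ → M) → Prop}, dp A P → ∃ F : Finset M, ↑F ⊆ A ∧ dp (↑F : Set M) P
  fv : ∀ {A : Set M} {P : (ℕ → M) → Prop}, dp A P → ∃ n : ℕ, ∀ v w : ℕ → M,
    (∀ i < n, v i = w i) → P v → P w
  ctb : ∀ {A : Set M}, A.Countable → {P | dp A P}.Countable
  conv : ∀ {S : M → Prop}, dp Set.univ (fun v => S (v 0)) →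
    ∃ (N : ℕ) (f : Fin N → Set M), (∀ x, S x ↔ ∃ i, x ∈ f i) ∧ ∀ i x y z, x ∈ f i → y ∈ f i → x ≤ z → z ≤ y → z ∈ f i
  cut : ∀ {S : M → Prop}, dp Set.univ (fun v => S (v 0)) → (∀ x y, x ≤ y → S y → S x) →
    (∀ x, ¬ S x) ∨ (∀ x, S x) ∨ (∃ e, ∀ x, S x ↔ x < e) ∨ (∃ e, ∀ x, S x ↔ x ≤ e)
  sat : ∀ S : ℕ → M → Prop, (∀ n, dp Set.univ (fun v => S n (v 0))) →
    (∀ n, ∃ x, ∀ i ≤ n, S i x) → ∃ x, ∀ n, S n x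

open OM

variable {M : Type} [OM M] {A B : Set M} {P Q : (ℕ → M) → Prop}

def DP (A : Set M) (P : (ℕ → M) → Prop) : Prop := OM.dp A P

theorem DP.iff (h : DP A P) (h' : ∀ v, P v ↔ Q v) : DP A Q := by
  have : P = Q := funext fun v => propext (h' v)
  exact this ▸ h

theorem DP.mono (h : DP A P) (hB : A ⊆ B) : DP B P := OM.mono hB h
theorem DP.ren (s : ℕ → ℕ) (h : DP A P) : DP A (fun v => P (fun i => v (s i))) := OM.ren s h
theorem DP.eq0 : DP A (fun v => v 0 = v 1) := OM.mono (Set.empty_subset A) OM.eq0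
theorem DP.lt0 : DP A (fun v => v 0 < v 1) := OM.mono (Set.empty_subset A) OM.lt0
theorem DP.extr {a : M} (h : DP (insert a A) P) :
    ∃ P', DP A P' ∧ ∀ v, P v ↔ P' (cons a v) := OM.extr h
theorem DP.fin (h : DP A P) : ∃ F : Finset M, ↑F ⊆ A ∧ DP (↑F : Set M) P := OM.fin h

/-- definable functions -/
def DF (A : Set M) (f : (ℕ → M) → M) : Prop := DP A (fun v => f (fun i => v (i+1)) = v 0)

theorem DP.and (h : DP A P) (h' : DP A Q) : DP A (fun v => P v ∧ Q v) := OM.and h h'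
theorem DP.not (h : DP A P) : DP A (fun v => ¬ P v) := OM.not h
theorem DP.or (h : DP A P) (h' : DP A Q) : DP A (fun v => P v ∨ Q v) :=
  DP.iff (h.not.and h'.not).not fun v => by tauto
theorem DP.imp (h : DP A P) (h' : DP A Q) : DP A (fun v => P v → Q v) :=
  DP.iff (h.and h'.not).not fun v => by tauto
theorem DP.iff' (h : DP A P) (h' : DP A Q) : DP A (fun v => P v ↔ Q v) :=
  DP.iff ((h.imp h').and (h'.imp h)) fun v => by tauto
theorem DP.ex {Q : (ℕ → M) → M → Prop} (h : DP A (fun v => Q (fun i => v (i+1)) (v 0))) :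
    DP A (fun v => ∃ y, Q v y) := OM.ex' h
theorem DP.all {Q : (ℕ → M) → M → Prop} (h : DP A (fun v => Q (fun i => v (i+1)) (v 0))) :
    DP A (fun v => ∀ y, Q v y) :=
  DP.iff (DP.ex (Q := fun v y => ¬ Q v y) h.not).not fun v => by simp

theorem DF.var (n : ℕ) : DF A (fun v => v n) :=
  DP.ren (fun i => if i = 0 then n+1 else 0) DP.eq0

theorem DP.bind1 {θ : M → Prop} (h : DP A (fun v => θ (v 0))) {f : (ℕ → M) → M} (hf : DF A f) :
    DP A (fun v => θ (f v)) :=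
  DP.iff (DP.ex (Q := fun v y => f v = y ∧ θ y) (hf.and h)) fun v => by simp

theorem DF.tail {f : (ℕ → M) → M} (hf : DF A f) : DF A (fun v => f (fun i => v (i+1))) :=
  DP.ren (fun i => if i = 0 then 0 else i + 1) hf

theorem DP.bind2 {θ : M → M → Prop} (h : DP A (fun v => θ (v 0) (v 1))) {f g : (ℕ → M) → M}
    (hf : DF A f) (hg : DF A g) : DP A (fun v => θ (f v) (g v)) :=
  DP.iff (DP.ex (Q := fun v y => f v = y ∧ ∃ z, g v = z ∧ θ y z) (hf.and (DP.ex
    (Q := fun v z => g (fun i => v (i+1)) = z ∧ θ (v 0) z) (hg.tail.and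
     (DP.ren (fun i => if i = 0 then 1 else 0) h))))) fun v => by simp

theorem DP.bind3 {θ : M → M → M → Prop} (h : DP A (fun v => θ (v 0) (v 1) (v 2)))
    {f g k : (ℕ → M) → M}
    (hf : DF A f) (hg : DF A g) (hk : DF A k) : DP A (fun v => θ (f v) (g v) (k v)) :=
  DP.iff (DP.ex (Q := fun v y => f v = y ∧ ∃ z, g v = z ∧ ∃ t, k v = t ∧ θ y z t) (hf.and (DP.ex
    (Q := fun v z => g (fun i => v (i+1)) = z ∧ ∃ t, k (fun i => v (i+1)) = t ∧ θ (v 0) z t)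
     (hg.tail.and (DP.ex (Q := fun v t => k (fun i => v (i+2)) = t ∧ θ (v 1) (v 0) t)
     (hk.tail.tail.and (DP.ren (fun i => if i = 0 then 2 else if i = 1 then 1 else 0) h))))))) fun v => by simp

theorem DP.lt {f g : (ℕ → M) → M} (hf : DF A f) (hg : DF A g) : DP A (fun v => f v < g v) :=
  DP.bind2 (θ := (· < ·)) DP.lt0 hf hg
theorem DP.eq {f g : (ℕ → M) → M} (hf : DF A f) (hg : DF A g) : DP A (fun v => f v = g v) :=
  DP.bind2 (θ := (· = ·)) DP.eq0 hf hg
theorem DP.le {f g : (ℕ → M) → M} (hf : DF A f) (hg : DF A g) : DP A (fun v => f v ≤ g v) :=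
  DP.iff (DP.lt hg hf).not fun v => by simp
theorem DP.ne {f g : (ℕ → M) → M} (hf : DF A f) (hg : DF A g) : DP A (fun v => f v ≠ g v) :=
  (DP.eq hf hg).not
theorem DP.triv (p : Prop) : DP A (fun _ => p) := by
  by_cases hp : p
  · exact DP.iff (DP.eq (DF.var 0) (DF.var 0)) (by simp [hp])
  · exact DP.iff (DP.ne (DF.var 0) (DF.var 0)) (by simp [hp])
theorem DP.lift1 {S : M → Prop} (h : DP A (fun v => S (v 0))) (n : ℕ) : DP A (fun v => S (v n)) :=
  h.bind1 (DF.var n)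

def dcl (A : Set M) : Set M := {b | DP A (fun v => v 0 = b)}

theorem DF.cst {b : M} (h : b ∈ dcl A) : DF A (fun _ => b) :=
  DP.iff (Q := fun v => b = v 0) h fun v => eq_comm
theorem sub_dcl : A ⊆ dcl A := fun a ha => OM.mono (by simpa using ha) (OM.cst a)
theorem DF.par {b : M} (h : b ∈ A) : DF A (fun _ => b) := DF.cst (sub_dcl h)
theorem DF.par0 {b : M} : DF (insert b A) (fun _ => b) := DF.par (by simp)
theorem DF.par1 {a b : M} : DF (insert a (insert b A)) (fun _ => b) := DF.par (by simp)
theorem DF.parU {b : M} : DF Set.univ (fun _ => b) := DF.par (by simp)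

theorem dcl_mono (h : A ⊆ B) : dcl A ⊆ dcl B := fun _ hb => DP.mono hb h

/-- extraction, unary -/
theorem extr1 {S : M → Prop} {a : M} (h : DP (insert a A) (fun v => S (v 0))) :
    ∃ θ : M → M → Prop, DP A (fun v => θ (v 0) (v 1)) ∧ ∀ x, S x ↔ θ a x := by
  obtain ⟨P', h1, h2⟩ := h.extr
  refine ⟨fun a x => P' (cons a (fun _ => x)), ?_, fun x => h2 (fun _ => x)⟩
  refine DP.iff (DP.ren (fun i => if i = 0 then 0 else 1) h1) fun v => ?_
  have : (fun i => v (if i = 0 then 0 else 1)) = cons (v 0) (fun _ => v 1) := by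
    funext i; cases i <;> simp [cons]
  rw [this]

theorem extr2 {S : M → M → Prop} {a : M} (h : DP (insert a A) (fun v => S (v 0) (v 1))) :
    ∃ θ : M → M → M → Prop, DP A (fun v => θ (v 0) (v 1) (v 2)) ∧ ∀ x y, S x y ↔ θ a x y := by
  obtain ⟨P', h1, h2⟩ := h.extr
  refine ⟨fun a x y => P' (cons a (cons x (fun _ => y))), ?_, fun x y => h2 (cons x (fun _ => y))⟩
  refine DP.iff (DP.ren (fun i => if i = 0 then 0 else if i = 1 then 1 else 2) h1) fun v => ?_
  have : (fun i => v (if i = 0 then 0 else if i = 1 then 1 else 2)) =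
      cons (v 0) (cons (v 1) (fun _ => v 2)) := by
    funext i
    rcases i with _ | _ | i <;> simp [cons]
  rw [this]

/-- elements of `dcl (insert a A)` as values of partial functions -/
theorem mem_dcl_insert {a b : M} (h : b ∈ dcl (insert a A)) :
    ∃ θ : M → M → Prop, DP A (fun v => θ (v 0) (v 1)) ∧ θ a b ∧ ∀ x y z, θ x y → θ x z → y = z := by
  obtain ⟨θ, h1, h2⟩ := extr1 (S := fun x => x = b) h
  refine ⟨fun x y => θ x y ∧ ∀ z, θ x z → z = y, ?_, ⟨by simp [← h2], fun z hz => (h2 z).2 hz⟩, ?_⟩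
  · exact h1.and (DP.all ((h1.bind2 (DF.var 1) (DF.var 0)).imp (DP.eq (DF.var 0) (DF.var 2))))
  · rintro x y z ⟨-, h⟩ ⟨h', -⟩
    exact (h z h').symm

theorem dcl_of {a b : M} {θ : M → M → Prop} (h : DP A (fun v => θ (v 0) (v 1)))
    (hf : ∀ x y z, θ x y → θ x z → y = z) (hb : θ a b) : b ∈ dcl (insert a A) :=
  DP.iff (Q := fun v => v 0 = b) ((h.mono (Set.subset_insert a A)).bind2 DF.par0 (DF.var 0))
    fun v => ⟨fun h => hf a _ _ h hb, fun h => h ▸ hb⟩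

theorem dcl_of1 {b : M} {S : M → Prop} (h : DP A (fun v => S (v 0)))
    (hf : ∀ x, S x ↔ x = b) : b ∈ dcl A := DP.iff (Q := fun v => v 0 = b) h fun v => hf _

theorem DP.of_dcl_aux {F : Finset M} : (∀ b ∈ F, b ∈ dcl A) → ∀ {P}, DP (↑F ∪ A : Set M) P → DP A P := by
  classical
  induction F using Finset.induction_on with
  | empty => intro _ P h; simpa using h
  | insert a F _ ih =>
    intro hb P h
    refine ih (fun b hbF => hb b (by simp [hbF])) ?_
    rw [Finset.coe_insert, Set.insert_union] at h
    obtain ⟨P', h1, h2⟩ := h.extr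
    have ha : DF (↑F ∪ A) (fun _ => a) :=
      DF.cst (dcl_mono Set.subset_union_right (hb a (by simp)))
    exact DP.iff (DP.ex (Q := fun v y => a = y ∧ P' (cons y v)) (DP.and ha (DP.iff h1 fun v => by
      have : v = cons (v 0) (fun i => v (i+1)) := by funext i; cases i <;> rfl
      rw [← this]))) fun v => by simp [h2]

theorem DP.of_dcl (h : DP B P) (hB : B ⊆ dcl A) : DP A P := by
  obtain ⟨F, hF, h⟩ := h.fin
  exact DP.of_dcl_aux (F := F) (fun b hb => hB (hF hb)) (h.mono Set.subset_union_left)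

theorem dcl_sub (h : B ⊆ dcl A) : dcl B ⊆ dcl A := fun _ hb => DP.of_dcl hb h
theorem dcl_dcl : dcl (dcl A) = dcl A := (dcl_sub subset_rfl).antisymm sub_dcl
theorem dcl_ins_sub {a : M} (h : a ∈ dcl A) : dcl (insert a A) ⊆ dcl A :=
  dcl_sub (Set.insert_subset h sub_dcl)
theorem dcl_fin {b : M} (h : b ∈ dcl A) : ∃ F : Finset M, ↑F ⊆ A ∧ b ∈ dcl (↑F : Set M) := OM.fin h

theorem dcl_ctb (h : A.Countable) : (dcl A).Countable := by
  have := OM.ctb h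
  refine Set.MapsTo.countable_of_injOn (f := fun b => (fun v : ℕ → M => v 0 = b)) (fun b hb => hb) ?_ this
  intro a _ b _ hab
  have := congrFun hab (fun _ => a)
  simpa using this

/-! ### Order dual -/
@[reducible] def OM.dual (M : Type) [i : OM M] : OM M :=
  { (OrderDual.instLinearOrder M : LinearOrder M) with
    dp := i.dp
    mono := i.mono
    and := i.and
    not := i.not
    ex' := i.ex'
    ren := i.ren
    eq0 := i.eq0
    lt0 := DP.lt (M := M) (A := ∅) (DF.var 1) (DF.var 0)
    cst := i.cst
    extr := i.extr
    fin := i.fin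
    fv := i.fv
    ctb := i.ctb
    conv := fun h => by
      obtain ⟨N, f, h1, h2⟩ := i.conv h
      exact ⟨N, f, h1, fun j x y z hx hy hz hz' => h2 j y x z hy hx hz' hz⟩
    cut := fun {S} h hd => by
      rcases i.cut (S := fun x => ¬ S x) (DP.not h) (fun x y hxy hy hx => hy (hd y x hxy hx)) with h | h | ⟨e, h⟩ | ⟨e, h⟩
      · right; left; intro x; simpa using h x
      · left; exact h
      · right; right; right; exact ⟨e, fun x => by
          have := h x
          change S x ↔ e ≤ x
          rw [← not_lt, ← this, not_not]⟩
      · right; right; left; exact ⟨e, fun x => by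
          have := h x
          change S x ↔ e < x
          rw [← not_le, ← this, not_not]⟩
    sat := i.sat }

/-! ### Basic o-minimality -/

theorem fin_dcl {S : M → Prop} (h : DP A (fun v => S (v 0))) (hf : {x | S x}.Finite) :
    ∀ x, S x → x ∈ dcl A := by
  obtain ⟨n, hn⟩ : ∃ n, {x | S x}.ncard = n := ⟨_, rfl⟩
  induction n using Nat.strong_induction_on generalizing S with
  | _ n ih =>
    intro x hx
    obtain ⟨m, hm, hmin⟩ := Set.exists_min_image {x | S x} id hf ⟨x, hx⟩
    have hmd : m ∈ dcl A := by
      refine dcl_of1 (S := fun z => S z ∧ ∀ y, S y → z ≤ y)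
        (h.and (DP.all ((h.lift1 0).imp (DP.le (DF.var 1) (DF.var 0))))) fun z => ⟨?_, ?_⟩
      · rintro ⟨hz, hz'⟩
        exact le_antisymm (hz' _ hm) (hmin z hz)
      · rintro rfl
        exact ⟨hm, fun y hy => hmin y hy⟩
    by_cases hxm : x = m
    · exact hxm ▸ hmd
    · have hsub : {x | S x ∧ x ≠ m} ⊂ {x | S x} := ⟨fun z hz => hz.1, fun hh => (hh hm).2 rfl⟩
      exact ih _ (hn ▸ Set.ncard_lt_ncard hsub hf) (S := fun z => S z ∧ z ≠ m)
        (h.and (DP.ne (DF.var 0) (DF.cst hmd))) (hf.subset hsub.1) rfl x ⟨hx, hxm⟩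

theorem conv_fin {S R : M → Prop} (h : DP Set.univ (fun v => S (v 0)))
    (hR : ∀ e, R e → S e) (hc : ∀ e e', R e → R e' → e < e' → ∃ w, e ≤ w ∧ w ≤ e' ∧ ¬ S w) :
    {x | R x}.Finite := by
  obtain ⟨N, f, h1, h2⟩ := conv h
  by_cases hne : ∃ x, R x
  swap
  · exact Set.Finite.subset Set.finite_empty fun x hx => (hne ⟨x, hx⟩).elim
  have : Nonempty (Fin N) := by
    obtain ⟨x, hx⟩ := hne
    obtain ⟨i, -⟩ := (h1 x).1 (hR x hx)
    exact ⟨i⟩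
  choose! g hg using fun x hx => (h1 x).1 (hR x hx)
  refine Set.Finite.of_injOn (t := Set.univ) (f := g) (fun _ _ => trivial) ?_ Set.finite_univ
  have key : ∀ e e', R e → R e' → e < e' → g e ≠ g e' := by
    intro e e' he he' hlt heq
    obtain ⟨w, h3, h4, h5⟩ := hc e e' he he' hlt
    exact h5 ((h1 w).2 ⟨g e, h2 (g e) e e' w (hg e he) (heq ▸ hg e' he') h3 h4⟩)
  intro a ha b hb hab
  rcases lt_trichotomy a b with h | h | h
  · exact (key a b ha hb h hab).elim
  · exact h
  · exact (key b a hb ha h hab.symm).elim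

/-- left half of (O1) -/
theorem O1L {S : M → Prop} (h : DP A (fun v => S (v 0))) {x : M} (hx : S x) (hxA : x ∉ dcl A) :
    (∃ p ∈ dcl A, p < x ∧ ∀ z, p < z → z ≤ x → S z) ∨ ∀ z, z ≤ x → S z := by
  have hU := h.mono (Set.subset_univ A)
  have e1 : ∀ e, S e → (∀ z, z < e → ∃ w, z ≤ w ∧ w < e ∧ ¬ S w) → e ∈ dcl A := by
    intro e he1 he2
    refine fin_dcl (S := fun e => S e ∧ (∀ z, z < e → ∃ w, z ≤ w ∧ w < e ∧ ¬ S w)) ?_ ?_ e ⟨he1, he2⟩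
    · exact h.and (DP.all ((DP.lt (DF.var 0) (DF.var 1)).imp (DP.ex ((DP.le (DF.var 1) (DF.var 0)).and
        ((DP.lt (DF.var 0) (DF.var 2)).and (h.lift1 0).not)))))
    · refine conv_fin hU (fun e he => he.1) ?_
      rintro e e' he he' hlt
      obtain ⟨w, h1, h2, h3⟩ := he'.2 e hlt
      exact ⟨w, h1, h2.le, h3⟩
  have e2 : ∀ e, ¬ S e → (∃ y, e < y ∧ ∀ z, e < z → z ≤ y → S z) → e ∈ dcl A := by
    intro e he1 he2
    refine fin_dcl (S := fun e => ¬ S e ∧ (∃ y, e < y ∧ ∀ z, e < z → z ≤ y → S z)) ?_ ?_ e ⟨he1, he2⟩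
    · exact h.not.and (DP.ex ((DP.lt (DF.var 1) (DF.var 0)).and (DP.all
        ((DP.lt (DF.var 2) (DF.var 0)).imp ((DP.le (DF.var 0) (DF.var 1)).imp (h.lift1 0))))))
    · refine conv_fin hU.not (fun e he => he.1) ?_
      rintro e e' ⟨-, y, hy, hy'⟩ ⟨he', -⟩ hlt
      refine ⟨min y e', (lt_min hy hlt).le, min_le_right _ _, ?_⟩
      have := hy' _ (lt_min hy hlt) (min_le_left _ _)
      simpa using this
  have hI : DP Set.univ (fun v : ℕ → M => ∃ w, v 0 ≤ w ∧ w ≤ x ∧ ¬ S w) :=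
    DP.ex ((DP.le (DF.var 1) (DF.var 0)).and ((DP.le (DF.var 0) DF.parU).and (hU.lift1 0).not))
  rcases OM.cut (S := fun z => ∃ w, z ≤ w ∧ w ≤ x ∧ ¬ S w) hI
    (fun a b hab ⟨w, h1, h2⟩ => ⟨w, hab.trans h1, h2⟩) with h1 | h1 | ⟨e, h1⟩ | ⟨e, h1⟩
  · right
    intro z hz
    by_contra hS
    exact h1 z ⟨z, le_rfl, hz, hS⟩
  · obtain ⟨w, h2, h3, h4⟩ := h1 x
    exact (h4 (le_antisymm h2 h3 ▸ hx)).elim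
  · left
    have hS : ∀ z, e ≤ z → z ≤ x → S z := fun z hz hzx => by
      by_contra hS
      exact absurd ((h1 z).1 ⟨z, le_rfl, hzx, hS⟩) (not_lt.2 hz)
    have hex : e ≤ x := by
      by_contra hh
      obtain ⟨w, h2, h3, h4⟩ := (h1 x).2 (not_le.1 hh)
      exact (h4 (le_antisymm h2 h3 ▸ hx)).elim
    have hed : e ∈ dcl A := e1 e (hS e le_rfl hex) fun z hz => by
      obtain ⟨w, h2, h3, h4⟩ := (h1 z).2 hz
      exact ⟨w, h2, (h1 w).1 ⟨w, le_rfl, h3, h4⟩, h4⟩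
    refine ⟨e, hed, lt_of_le_of_ne hex (fun hh => hxA (hh ▸ hed)), fun z hz => hS z hz.le⟩
  · left
    have hS : ∀ z, e < z → z ≤ x → S z := fun z hz hzx => by
      by_contra hS
      exact absurd ((h1 z).1 ⟨z, le_rfl, hzx, hS⟩) (not_le.2 hz)
    obtain ⟨w, h2, h3, h4⟩ := (h1 e).2 le_rfl
    have hwe : w = e := le_antisymm ((h1 w).1 ⟨w, le_rfl, h3, h4⟩) h2
    subst hwe
    have hlt : w < x := lt_of_le_of_ne h3 (fun hh => h4 (hh ▸ hx))
    exact ⟨w, e2 w h4 ⟨x, hlt, hS⟩, hlt, hS⟩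

theorem O1R {S : M → Prop} (h : DP A (fun v => S (v 0))) {x : M} (hx : S x) (hxA : x ∉ dcl A) :
    (∃ p ∈ dcl A, x < p ∧ ∀ z, z < p → x ≤ z → S z) ∨ ∀ z, x ≤ z → S z :=
  @O1L M (OM.dual M) A S h x hx hxA

end QOM

namespace QOM
open OM
variable {M : Type} [OM M] {A B : Set M} {P Q : (ℕ → M) → Prop}

theorem nbL {S : M → Prop} (h : DP A (fun v => S (v 0))) {x : M} (hx : S x) (hxA : x ∉ dcl A) :
    ∃ d, d < x ∧ ∀ z, d ≤ z → z ≤ x → S z := by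
  by_contra hcon
  push Not at hcon
  rcases O1L h hx hxA with ⟨p, hp, hpx, hS⟩ | hS
  · refine hxA (dcl_of1 (S := fun z => p < z ∧ ∀ y, p < y → z ≤ y) ((DP.lt (DF.cst hp) (DF.var 0)).and
      (DP.all ((DP.lt (DF.cst hp) (DF.var 0)).imp (DP.le (DF.var 1) (DF.var 0))))) fun z => ?_)
    have hx1 : ∀ y, p < y → x ≤ y := fun y hy => by
      by_contra hh
      obtain ⟨z, h1, h2, h3⟩ := hcon y (not_le.1 hh)
      exact h3 (hS z (hy.trans_le h1) h2)
    exact ⟨fun h => le_antisymm (h.2 x hpx) (hx1 z h.1), fun h => h ▸ ⟨hpx, hx1⟩⟩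
  · refine hxA (dcl_of1 (S := fun z => ∀ y, z ≤ y) (DP.all (DP.le (DF.var 1) (DF.var 0))) fun z => ?_)
    have hx1 : ∀ y, x ≤ y := fun y => by
      by_contra hh
      obtain ⟨z, h1, h2, h3⟩ := hcon y (not_le.1 hh)
      exact h3 (hS z h2)
    exact ⟨fun h => le_antisymm (h x) (hx1 z), fun h => h ▸ hx1⟩

theorem nbR {S : M → Prop} (h : DP A (fun v => S (v 0))) {x : M} (hx : S x) (hxA : x ∉ dcl A) :
    ∃ d, x < d ∧ ∀ z, z ≤ d → x ≤ z → S z := @nbL M (OM.dual M) A S h x hx hxA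

theorem exch {a b : M} (h : b ∈ dcl (insert a A)) (hb : b ∉ dcl A) : a ∈ dcl (insert b A) := by
  by_contra ha
  obtain ⟨θ, h1, h2, h3⟩ := mem_dcl_insert h
  have haA : a ∉ dcl A := fun h => ha (dcl_mono (Set.subset_insert _ _) h)
  have h4 : DP (insert b A) (fun v => θ (v 0) b) :=
    (h1.mono (Set.subset_insert _ _)).bind2 (DF.var 0) DF.par0
  obtain ⟨d, hd, hd'⟩ := nbL (S := fun x => θ x b) h4 h2 ha
  obtain ⟨e, he, he'⟩ := nbR (S := fun x => θ x b) h4 h2 ha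
  have h5 : DP A (fun v => ∃ y, θ (v 0) y ∧ ∃ d, d < v 0 ∧ ∃ e, v 0 < e ∧ ∀ z, d ≤ z → z ≤ e → θ z y) :=
    DP.ex ((h1.bind2 (DF.var 1) (DF.var 0)).and (DP.ex ((DP.lt (DF.var 0) (DF.var 2)).and
      (DP.ex ((DP.lt (DF.var 3) (DF.var 0)).and (DP.all ((DP.le (DF.var 2) (DF.var 0)).imp
      ((DP.le (DF.var 0) (DF.var 1)).imp (h1.bind2 (DF.var 0) (DF.var 3))))))))))
  have h6 : ∃ y, θ a y ∧ ∃ d, d < a ∧ ∃ e, a < e ∧ ∀ z, d ≤ z → z ≤ e → θ z y :=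
    ⟨b, h2, d, hd, e, he, fun z hz hz' => (le_total z a).elim (hd' z hz) (he' z hz')⟩
  have h1U := h1.mono (Set.subset_univ A)
  have key : ∀ p0 : M → Prop, (∀ x y, x ≤ y → p0 x → p0 y) → (∀ z, p0 z → z ≤ a →
      ∃ y, θ z y ∧ ∃ d, d < z ∧ ∃ e, z < e ∧ ∀ w, d ≤ w → w ≤ e → θ w y) →
      ∀ z, p0 z → z ≤ a → θ z b := by
    intro p0 hp0 hS
    have hI : DP Set.univ (fun v : ℕ → M => ∃ w, v 0 ≤ w ∧ w ≤ a ∧ ¬ θ w b) :=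
      DP.ex ((DP.le (DF.var 1) (DF.var 0)).and ((DP.le (DF.var 0) DF.parU).and
        (h1U.bind2 (DF.var 0) DF.parU).not))
    rcases OM.cut (S := fun z => ∃ w, z ≤ w ∧ w ≤ a ∧ ¬ θ w b) hI
      (fun a b hab ⟨w, h1, h2⟩ => ⟨w, hab.trans h1, h2⟩) with g | g | ⟨e, g⟩ | ⟨e, g⟩
    · intro z _ hz
      by_contra hh
      exact g z ⟨z, le_rfl, hz, hh⟩
    · obtain ⟨w, k1, k2, k3⟩ := g a
      exact (k3 (le_antisymm k1 k2 ▸ h2)).elim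
    · have hT : ∀ z, e ≤ z → z ≤ a → θ z b := fun z hz hzx => by
        by_contra hS
        exact absurd ((g z).1 ⟨z, le_rfl, hzx, hS⟩) (not_lt.2 hz)
      have hex : e ≤ a := by
        by_contra hh
        obtain ⟨w, k1, k2, k3⟩ := (g a).2 (not_le.1 hh)
        exact (k3 (le_antisymm k1 k2 ▸ h2)).elim
      by_cases hpe : p0 e
      · obtain ⟨y, k1, d, k2, e', k3, k4⟩ := hS e hpe hex
        obtain rfl := h3 _ _ _ k1 (hT e le_rfl hex)
        obtain ⟨w, k5, k6, k7⟩ := (g d).2 k2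
        have := (g w).1 ⟨w, le_rfl, k6, k7⟩
        exact (k7 (k4 w k5 (this.trans k3).le)).elim
      · intro z hz
        refine hT z ?_
        by_contra hh
        exact hpe (hp0 _ _ (not_le.1 hh).le hz)
    · have hT : ∀ z, e < z → z ≤ a → θ z b := fun z hz hzx => by
        by_contra hS
        exact absurd ((g z).1 ⟨z, le_rfl, hzx, hS⟩) (not_le.2 hz)
      obtain ⟨w, k2, k3, k4⟩ := (g e).2 le_rfl
      have hwe : w = e := le_antisymm ((g w).1 ⟨w, le_rfl, k3, k4⟩) k2
      subst hwe
      have hlt : w < a := lt_of_le_of_ne k3 (fun hh => k4 (hh ▸ h2))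
      by_cases hpe : p0 w
      · obtain ⟨y, k1, d, k2, e', k3', k5⟩ := hS w hpe k3
        have k6 := k5 (min e' a) (k2.trans (lt_min k3' hlt)).le (min_le_left _ _)
        obtain rfl := h3 _ _ _ k6 (hT _ (lt_min k3' hlt) (min_le_right _ _))
        exact (k4 k1).elim
      · intro z hz
        refine hT z ?_
        by_contra hh
        exact hpe (hp0 _ _ (not_lt.1 hh) hz)
  rcases O1L (S := fun x => ∃ y, θ x y ∧ ∃ d, d < x ∧ ∃ e, x < e ∧ ∀ z, d ≤ z → z ≤ e → θ z y) h5 h6 haA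
    with ⟨p, hp, hpa, hS⟩ | hS
  · have hk := key (fun z => p < z) (fun x y hxy hx => hx.trans_le hxy) hS
    refine hb (dcl_of1 (S := fun y => ∃ z0, p < z0 ∧ ∀ z, p < z → z ≤ z0 → θ z y) (DP.ex
      ((DP.lt (DF.cst hp) (DF.var 0)).and (DP.all ((DP.lt (DF.cst hp) (DF.var 0)).imp
       ((DP.le (DF.var 0) (DF.var 1)).imp (h1.bind2 (DF.var 0) (DF.var 2))))))) fun y => ⟨?_, ?_⟩)
    · rintro ⟨z0, k1, k2⟩
      exact h3 _ _ _ (k2 (min z0 a) (lt_min k1 hpa) (min_le_left _ _))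
        (hk _ (lt_min k1 hpa) (min_le_right _ _))
    · rintro rfl
      exact ⟨a, hpa, hk⟩
  · have hk := key (fun z => True) (fun x y hxy hx => trivial) (fun z _ => hS z)
    refine hb (dcl_of1 (S := fun y => ∃ z0, ∀ z, z ≤ z0 → θ z y) (DP.ex
      (DP.all (
       ((DP.le (DF.var 0) (DF.var 1)).imp (h1.bind2 (DF.var 0) (DF.var 2)))))) fun y => ⟨?_, ?_⟩)
    · rintro ⟨z0, k2⟩
      exact h3 _ _ _ (k2 (min z0 a) (min_le_left _ _)) (hk _ trivial (min_le_right _ _))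
    · rintro rfl
      exact ⟨a, fun z => hk z trivial⟩

/-! ### types -/
def T1 (A : Set M) (x y : M) : Prop := ∀ S : M → Prop, DP A (fun v => S (v 0)) → S x → S y
def T2 (A : Set M) (x z y w : M) : Prop :=
  ∀ S : M → M → Prop, DP A (fun v => S (v 0) (v 1)) → S x z → S y w

theorem T1.refl (x : M) : T1 A x x := fun S _ h => h
theorem T1.symm {x y : M} (h : T1 A x y) : T1 A y x := fun S hS hy => by
  by_contra hx
  exact h (fun z => ¬ S z) hS.not hx hy
theorem T1.trans {x y z : M} (h : T1 A x y) (h' : T1 A y z) : T1 A x z := fun S hS hy =>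
  h' S hS (h S hS hy)
theorem T1.mono {x y : M} (h : T1 B x y) (hA : A ⊆ B) : T1 A x y := fun S hS => h S (hS.mono hA)
theorem T2.symm {x y z w : M} (h : T2 A x z y w) : T2 A y w x z := fun S hS hy => by
  by_contra hx
  exact h (fun a b => ¬ S a b) hS.not hx hy
theorem T2.mono {x y z w : M} (h : T2 B x z y w) (hA : A ⊆ B) : T2 A x z y w :=
  fun S hS => h S (hS.mono hA)
theorem T2.swap {x y z w : M} (h : T2 A x z y w) : T2 A z x w y := fun S hS hy =>
  h (fun a b => S b a) (hS.bind2 (DF.var 1) (DF.var 0)) hy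
theorem T2.fst {x y z w : M} (h : T2 A x z y w) : T1 A x y := fun S hS hy =>
  h (fun a b => S a) hS hy
theorem T2.snd {x y z w : M} (h : T2 A x z y w) : T1 A z w := h.swap.fst

theorem T1.dcl {x y : M} (h : T1 A x y) (hx : x ∈ dcl A) : x = y :=
  (h (fun z => z = x) hx rfl).symm
theorem T1.ndcl {x y : M} (h : T1 A x y) (hx : x ∉ QOM.dcl A) : y ∉ QOM.dcl A := fun hy =>
  hx (h.symm.dcl hy ▸ hy)
theorem T2.dcl {x y z w : M} (h : T2 A x z y w) (hz : z ∈ dcl (insert x A)) : w ∈ dcl (insert y A) := by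
  obtain ⟨θ, h1, h2, h3⟩ := mem_dcl_insert hz
  exact dcl_of h1 h3 (h θ h1 h2)
theorem T2.ndcl {x y z w : M} (h : T2 A x z y w) (hz : z ∉ QOM.dcl (insert x A)) :
    w ∉ QOM.dcl (insert y A) := fun hw => hz (h.symm.dcl hw)

theorem cut_T1 {x y : M} (hx : x ∉ dcl A) (hy : y ∉ dcl A) (h : ∀ e ∈ dcl A, e < x ↔ e < y) :
    T1 A x y := by
  intro S hS hSx
  rcases le_total y x with hyx | hyx
  · rcases O1L hS hSx hx with ⟨p, hp, h1, h2⟩ | h2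
    · exact h2 y ((h p hp).1 h1) hyx
    · exact h2 y hyx
  · rcases O1R hS hSx hx with ⟨p, hp, h1, h2⟩ | h2
    · refine h2 y (lt_of_not_ge fun hh => ?_) hyx
      rcases hh.eq_or_lt with rfl | hh
      · exact hy hp
      · exact lt_asymm h1 ((h p hp).2 hh)
    · exact h2 y hyx

theorem T1.lt {x y e : M} (h : T1 A x y) (he : e ∈ QOM.dcl A) : e < x ↔ e < y :=
  ⟨h (fun z => e < z) (DP.lt (DF.cst he) (DF.var 0)), h.symm (fun z => e < z) (DP.lt (DF.cst he) (DF.var 0))⟩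

/-- saturation over a countable set of formulas -/
theorem sat_ctb {ι : Type} [Countable ι] (S : ι → M → Prop) (hS : ∀ i, DP Set.univ (fun v => S i (v 0)))
    (h : ∀ F : Finset ι, ∃ x, ∀ i ∈ F, S i x) : ∃ x, ∀ i, S i x := by
  classical
  cases isEmpty_or_nonempty ι
  · obtain ⟨x, -⟩ := h ∅
    exact ⟨x, fun i => isEmptyElim i⟩
  obtain ⟨f, hf⟩ := exists_surjective_nat ι
  obtain ⟨x, hx⟩ := OM.sat (fun n => S (f n)) (fun n => hS (f n)) fun n => by
    obtain ⟨x, hx⟩ := h ((Finset.range (n+1)).image f)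
    exact ⟨x, fun i hi => hx _ (Finset.mem_image_of_mem f (by simp; omega))⟩
  exact ⟨x, fun i => by obtain ⟨n, rfl⟩ := hf i; exact hx n⟩

theorem hom (hA : A.Countable) {x y : M} (h : T1 A x y) (z : M) : ∃ w, T2 A x z y w := by
  classical
  let ι := {S : M → M → Prop // DP A (fun v => S (v 0) (v 1)) ∧ S x z}
  have : Countable ι := by
    have hc : Countable {P : (ℕ → M) → Prop // OM.dp A P} := (OM.ctb hA).to_subtype
    refine Function.Injective.countable (β := {P : (ℕ → M) → Prop // OM.dp A P})
      (f := fun i : ι => ⟨fun v => i.1 (v 0) (v 1), i.2.1⟩) fun i j hij => ?_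
    apply Subtype.ext
    funext a b
    have := congrFun (congrArg Subtype.val hij) (cons a fun _ => b)
    exact this
  have hfin : ∀ F : Finset ι, DP A (fun v => ∀ i ∈ F, i.1 (v 0) (v 1)) := by
    intro F
    induction F using Finset.induction_on with
    | empty => simpa using DP.triv True
    | insert i F _ ih => simpa using i.2.1.and ih
  obtain ⟨w, hw⟩ := sat_ctb (fun (i : ι) w => i.1 y w) (fun i =>
      (i.2.1.mono (Set.subset_univ A)).bind2 DF.parU (DF.var 0)) fun F =>
    h (fun x => ∃ w, ∀ i ∈ F, i.1 x w) (DP.ex (DP.bind2 (θ := fun a b => ∀ i ∈ F, i.1 a b) (hfin F)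
      (DF.var 1) (DF.var 0))) ⟨z, fun i hi => i.2.2⟩
  exact ⟨w, fun S hS hSx => hw ⟨S, hS, hSx⟩⟩

/-! ### elementary subsets -/
def Elem (N : Set M) : Prop := ∀ S : M → Prop, DP N (fun v => S (v 0)) → (∃ x, S x) → ∃ x ∈ N, S x

def IsL (N : Set M) (l : M → Prop) : Prop := (∀ z, l z) ∨ ∃ p ∈ N, ∀ z, l z ↔ p < z
def IsR (N : Set M) (l : M → Prop) : Prop := (∀ z, l z) ∨ ∃ p ∈ N, ∀ z, l z ↔ z < p

theorem IsL.dp {l : M → Prop} (h : IsL A l) : DP A (fun v => l (v 0)) := by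
  rcases h with h | ⟨p, hp, h⟩
  · exact (DP.triv True).iff (by simp [h])
  · exact DP.iff (DP.lt (DF.par hp) (DF.var 0)) (by simp [h])
theorem IsR.dp {l : M → Prop} (h : IsR A l) : DP A (fun v => l (v 0)) := by
  rcases h with h | ⟨p, hp, h⟩
  · exact (DP.triv True).iff (by simp [h])
  · exact DP.iff (DP.lt (DF.var 0) (DF.par hp)) (by simp [h])

theorem O1 {S : M → Prop} (h : DP A (fun v => S (v 0))) {x : M} (hx : S x) (hxA : x ∉ dcl A) :
    ∃ l r, IsL (dcl A) l ∧ IsR (dcl A) r ∧ l x ∧ r x ∧ ∀ z, l z → r z → S z := by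
  have hL : ∃ l, IsL (dcl A) l ∧ l x ∧ ∀ z ≤ x, l z → S z := by
    rcases O1L h hx hxA with ⟨p, hp, h1, h2⟩ | h1
    · exact ⟨fun z => p < z, Or.inr ⟨p, hp, fun z => Iff.rfl⟩, h1, fun z hz hl => h2 z hl hz⟩
    · exact ⟨fun _ => True, Or.inl fun _ => trivial, trivial, fun z hz _ => h1 z hz⟩
  have hR : ∃ l, IsR (dcl A) l ∧ l x ∧ ∀ z, x ≤ z → l z → S z := by
    rcases O1R h hx hxA with ⟨p, hp, h1, h2⟩ | h1
    · exact ⟨fun z => z < p, Or.inr ⟨p, hp, fun z => Iff.rfl⟩, h1, fun z hz hl => h2 z hl hz⟩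
    · exact ⟨fun _ => True, Or.inl fun _ => trivial, trivial, fun z hz _ => h1 z hz⟩
  obtain ⟨l, h1, h2, h3⟩ := hL
  obtain ⟨r, k1, k2, k3⟩ := hR
  exact ⟨l, r, h1, k1, h2, k2, fun z hl hr => (le_total z x).elim (fun h => h3 z h hl) fun h => k3 z h hr⟩

theorem tv {N : Set M} (hN : dcl N ⊆ N) (h : ∀ l r, IsL N l → IsR N r → (∃ x, l x ∧ r x) →
    ∃ x ∈ N, l x ∧ r x) : Elem N := by
  intro S hS ⟨x, hx⟩
  by_cases hxN : x ∈ N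
  · exact ⟨x, hxN, hx⟩
  have hd : dcl N = N := hN.antisymm sub_dcl
  obtain ⟨l, r, h1, h2, h3, h4, h5⟩ := O1 hS hx (fun hh => hxN (hN hh))
  rw [hd] at h1 h2
  obtain ⟨y, hy, hl, hr⟩ := h l r h1 h2 ⟨x, h3, h4⟩
  exact ⟨y, hy, h5 y hl hr⟩

theorem Elem.dcl {N : Set M} (h : Elem N) : dcl N = N := by
  refine Set.Subset.antisymm (fun b hb => ?_) sub_dcl
  obtain ⟨x, hx, rfl⟩ := h (fun x => x = b) hb ⟨b, rfl⟩
  exact hx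

end QOM

namespace QOM
open OM
variable {M : Type} [OM M] {A B V C : Set M}

structure VOK (V C : Set M) : Prop where
  ne : V.Nonempty
  sub : V ⊆ dcl C
  ctb : C.Countable
  top : ∀ v ∈ V, ∃ z, v < z
  dense : ∀ v ∈ V, ∀ e, (∀ u ∈ V, u < e) → ∃ z, v < z ∧ z < e

def QQ (V A : Set M) (z : M) : Prop := (∀ v ∈ V, v < z) ∧ ∀ e ∈ dcl A, (∀ v ∈ V, v < e) → z < e

theorem QQ.mono {z : M} (h : QQ V B z) (hA : A ⊆ B) : QQ V A z :=
  ⟨h.1, fun e he => h.2 e (dcl_mono hA he)⟩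
theorem QQ.mono' {z : M} (h : QQ V B z) (hA : A ⊆ dcl B) : QQ V A z :=
  ⟨h.1, fun e he => h.2 e (dcl_sub hA he)⟩
theorem QQ.not {z : M} (h : QQ V A z) : z ∉ dcl A := fun hz => lt_irrefl _ (h.2 z hz h.1)
theorem QQ.down {z y : M} (h : QQ V A z) (hy : ∀ v ∈ V, v < y) (hyz : y ≤ z) : QQ V A y :=
  ⟨hy, fun e he h' => hyz.trans_lt (h.2 e he h')⟩
theorem QQ.lt {z y : M} (h : QQ V (insert y A) z) (hy : ∀ v ∈ V, v < y) : z < y :=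
  h.2 y (sub_dcl (by simp)) hy
theorem QQ.of_ins {z y : M} (h : QQ V (insert y A) z) : QQ V A z := h.mono (Set.subset_insert _ _)
theorem QQ.nex {z : M} (h : QQ V A z) {y : M} (hy : ¬ QQ V (insert z A) y) (h' : ∀ v ∈ V, v < y) :
    ∃ e ∈ dcl (insert z A), (∀ v ∈ V, v < e) ∧ e ≤ y := by
  by_contra hh
  push Not at hh
  exact hy ⟨h', hh⟩

theorem QQ.T1 {z z' : M} (h : QQ V A z) (h' : QQ V A z') : T1 A z z' := by
  have key : ∀ z, QQ V A z → ∀ e ∈ dcl A, e < z ↔ ¬ ∀ v ∈ V, v < e := by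
    intro z hz e he
    refine ⟨fun h1 h2 => lt_asymm h1 (hz.2 e he h2), fun h1 => ?_⟩
    push Not at h1
    obtain ⟨v, hv, h1⟩ := h1
    exact h1.trans_lt (hz.1 v hv)
  exact cut_T1 h.not h'.not fun e he => (key z h e he).trans (key z' h' e he).symm

theorem QQ.of_T1 (hV : V ⊆ dcl A) {z z' : M} (h : QQ V A z) (h' : QOM.T1 A z z') : QQ V A z' :=
  ⟨fun v hv => h' (fun z => v < z) (DP.lt (DF.cst (hV hv)) (DF.var 0)) (h.1 v hv),
   fun e he hve => h' (fun z => z < e) (DP.lt (DF.var 0) (DF.cst he)) (h.2 e he hve)⟩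

theorem QQ.tr (hV : V.Nonempty) {S : M → Prop} (hS : DP A (fun v => S (v 0))) {z : M} (hz : QQ V A z)
    (hSz : S z) : ∃ v ∈ V, ∀ y, v < y → y ≤ z → S y := by
  rcases O1L hS hSz hz.not with ⟨p, hp, h1, h2⟩ | h2
  · by_cases h : ∀ v ∈ V, v < p
    · exact absurd (hz.2 p hp h) h1.not_gt
    · push Not at h
      obtain ⟨v, hv, h⟩ := h
      exact ⟨v, hv, fun y hy => h2 y (h.trans_lt hy)⟩
  · obtain ⟨v, hv⟩ := hV
    exact ⟨v, hv, fun y _ => h2 y⟩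

theorem VOK.ex (h : VOK V C) (hA : A.Countable) : ∃ z, QQ V A z := by
  classical
  have hd := (dcl_ctb hA).to_subtype
  have hv := ((dcl_ctb h.ctb).mono h.sub).to_subtype
  let E := {e : dcl A // ∀ v ∈ V, v < e.1}
  obtain ⟨z, hz⟩ := sat_ctb (ι := V ⊕ E) (fun i z => match i with
    | Sum.inl v => v.1 < z
    | Sum.inr e => z < e.1.1) (fun i => by
      rcases i with v | e
      · exact DP.lt DF.parU (DF.var 0)
      · exact DP.lt (DF.var 0) DF.parU) fun F => by
    obtain ⟨v0, hv0⟩ := h.ne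
    have h1 : ∃ v ∈ V, ∀ u : V, Sum.inl u ∈ F → u.1 ≤ v := by
      obtain ⟨v, hv, hm⟩ := Finset.exists_max_image (insert ⟨v0, hv0⟩ F.toLeft) (fun u : V => u.1)
        ⟨_, Finset.mem_insert_self _ _⟩
      exact ⟨v.1, v.2, fun u hu => hm u (by simp [hu])⟩
    obtain ⟨v, hv, hvm⟩ := h1
    have h2 : ∃ z, v < z ∧ ∀ e : E, Sum.inr e ∈ F → z < e.1.1 := by
      by_cases hne : F.toRight.Nonempty
      · obtain ⟨e, he, hm⟩ := Finset.exists_min_image F.toRight (fun e : E => e.1.1) hne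
        obtain ⟨z, h3, h4⟩ := h.dense v hv e.1.1 e.2
        exact ⟨z, h3, fun e' he' => h4.trans_le (hm e' (by simpa using he'))⟩
      · obtain ⟨z, hz⟩ := h.top v hv
        exact ⟨z, hz, fun e he => (hne ⟨e, by simpa using he⟩).elim⟩
    obtain ⟨z, h3, h4⟩ := h2
    refine ⟨z, fun i hi => ?_⟩
    rcases i with u | e
    · exact (hvm u hi).trans_lt h3
    · exact h4 e hi
  exact ⟨z, fun v hv => hz (Sum.inl ⟨v, hv⟩), fun e he h' => hz (Sum.inr ⟨⟨e, he⟩, h'⟩)⟩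

/-- LEMMA 1 -/
theorem VOK.lem1 (hV : VOK V C) (hCA : C ⊆ A) (hA : A.Countable) {b x h : M} (hx : QQ V A x)
    (hb : QQ V (insert x A) b) (hh : h ∈ dcl (insert b A)) (hhQ : QQ V A h) : h < x := by
  by_contra hcon
  have hxh : x ≤ h := not_lt.1 hcon
  obtain ⟨θ, h1, h2, h3⟩ := mem_dcl_insert hh
  have hbx : b < x := hb.lt hx.1
  obtain ⟨v, hv, hS⟩ := hb.tr hV.ne (S := fun y => ∃ w, x ≤ w ∧ θ y w)
    (DP.ex ((DP.le DF.par0 (DF.var 0)).and ((h1.mono (Set.subset_insert _ _)).bind2 (DF.var 1) (DF.var 0))))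
    ⟨h, hxh, h2⟩
  have hvA : v ∈ dcl A := dcl_mono hCA (hV.sub hv)
  obtain ⟨v', hv', hS'⟩ := hhQ.tr hV.ne (S := fun w => ∃ y, v < y ∧ y < w ∧ θ y w)
    (DP.ex ((DP.lt (DF.cst hvA) (DF.var 0)).and ((DP.lt (DF.var 0) (DF.var 1)).and
      (h1.bind2 (DF.var 0) (DF.var 1))))) ⟨b, hb.1 v hv, hbx.trans_le hxh, h2⟩
  obtain ⟨w, hw⟩ := hV.ex (A := insert b A) (hA.insert b)
  have hwb : w < b := hw.lt hb.1
  obtain ⟨y, k1, k2, k3⟩ := hS' w (hw.1 v' hv') (hwb.trans (hbx.trans_le hxh)).le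
  obtain ⟨w', k4, k5⟩ := hS y k1 (k2.trans hwb).le
  have := h3 _ _ _ k3 k5
  exact absurd (hwb.trans hbx) (not_lt.2 (this ▸ k4))

theorem QQ.trans {a b x : M} (hb : QQ V (insert x A) b) (ha : QQ V (insert b A) a) :
    QQ V (insert x A) a := ⟨ha.1, fun e he h => (ha.lt hb.1).trans (hb.2 e he h)⟩

theorem dcl_exch_eq {a b : M} (h : b ∈ dcl (insert a A)) (hb : b ∉ dcl A) :
    dcl (insert b A) = dcl (insert a A) :=
  (dcl_sub (Set.insert_subset h ((Set.subset_insert _ _).trans sub_dcl))).antisymm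
    (dcl_sub (Set.insert_subset (exch h hb) ((Set.subset_insert _ _).trans sub_dcl)))
theorem QQ.congr {a b z : M} (h : b ∈ dcl (insert a A)) (hb : b ∉ dcl A) :
    QQ V (insert b A) z ↔ QQ V (insert a A) z := by
  unfold QQ; rw [dcl_exch_eq h hb]

theorem VOK.ntr (hV : VOK V C) (hCA : C ⊆ A) (hA : A.Countable) {a x y : M} (hx : QQ V A x)
    (hy : QQ V A y) (ha : QQ V (insert x A) a) : QQ V (insert y A) a ∨ QQ V (insert x A) y := by
  by_contra hcon
  push Not at hcon
  obtain ⟨e, he, he1, he2⟩ := hx.nex hcon.2 hy.1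
  obtain ⟨e', he', he1', he2'⟩ := hy.nex hcon.1 ha.1
  have heQ : QQ V A e := hy.down he1 he2
  have heQ' : QQ V A e' := ha.of_ins.down he1' he2'
  have h1 : QQ V (insert e A) e' := (QQ.congr he heQ.not).2 (ha.down he1' he2')
  exact absurd (hV.lem1 hCA hA heQ h1 (exch he' heQ'.not) hy) (not_lt.2 he2)

/-- incomparability -/
def EE (V A : Set M) (x y : M) : Prop := ¬ QQ V (insert y A) x ∧ ¬ QQ V (insert x A) y

theorem EE.symm {x y : M} (h : EE V A x y) : EE V A y x := ⟨h.2, h.1⟩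

theorem EE.dcl {x y : M} (hx : QQ V A x) (hy : QQ V A y) (h : y ∈ dcl (insert x A)) : EE V A x y :=
  ⟨fun h' => h'.not (exch h hy.not), fun h' => h'.not h⟩

theorem VOK.EE_trans (hV : VOK V C) (hCA : C ⊆ A) (hA : A.Countable) {x y z : M} (hx : QQ V A x)
    (hy : QQ V A y) (hz : QQ V A z) (h : EE V A x y) (h' : EE V A y z) : EE V A x z :=
  ⟨fun hh => (hV.ntr hCA hA hz hy hh).elim h.1 h'.1, fun hh => (hV.ntr hCA hA hx hy hh).elim h'.2 h.2⟩

theorem VOK.lt_congr (hV : VOK V C) (hCA : C ⊆ A) (hA : A.Countable) {x y z : M} (hx : QQ V A x)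
    (hy : QQ V A y) (hz : QQ V A z) (h : EE V A x y) (h' : QQ V (insert z A) x) :
    QQ V (insert z A) y := (hV.ntr hCA hA hz hy h').resolve_left h.1
theorem VOK.lt_congr' (hV : VOK V C) (hCA : C ⊆ A) (hA : A.Countable) {x y z : M} (hx : QQ V A x)
    (hy : QQ V A y) (hz : QQ V A z) (h : EE V A x y) (h' : QQ V (insert x A) z) :
    QQ V (insert y A) z := (hV.ntr hCA hA hx hy h').resolve_right h.2

theorem VOK.dclosed (hV : VOK V C) (hCA : C ⊆ A) (hAB : A ⊆ B) (hA : A.Countable) {z z' : M}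
    (hz : QQ V B z) (h' : z' ∈ dcl (insert z A)) (hz' : QQ V A z') : QQ V B z' := by
  refine ⟨hz'.1, fun e he hVe => ?_⟩
  by_contra hcon
  have heQ : QQ V A e := hz'.down hVe (not_lt.1 hcon)
  exact hcon (hV.lem1 hCA hA heQ (hz.mono' (Set.insert_subset he (hAB.trans sub_dcl))) h' hz')

def Cl (V C : Set M) : Prop := ∀ (A : Set M) (x b c : M), C ⊆ A → A.Finite → QQ V A x →
  QQ V (insert x A) b → QQ V (insert x A) c → c ∈ dcl (insert b (insert x A)) →
  ¬ QQ V (insert c A) b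

theorem VOK.pl (hV : VOK V C) (hCl : Cl V C) (hCA : C ⊆ A) (hA : A.Finite) {x u w : M} (hx : QQ V A x)
    (hu : QQ V (insert x A) u) (hw : QQ V (insert x A) w) (h : QQ V (insert w A) u) :
    QQ V (insert w (insert x A)) u := by
  by_contra hcon
  obtain ⟨e, he, he1, he2⟩ := hw.nex hcon hu.1
  have heQ : QQ V (insert x A) e := hu.down he1 he2
  exact hCl A x e w hCA hA hx heQ hw (exch he heQ.not) (h.down he1 he2)

theorem VOK.ind (hV : VOK V C) (hCl : Cl V C) (l : List M) : ∀ (A : Set M), C ⊆ A → A.Finite →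
    (∀ b ∈ l, QQ V A b) → l.Pairwise (fun x b => QQ V (insert x A) b) →
    ∀ z, QQ V A z → z ∈ dcl ({y | y ∈ l} ∪ A) → ∃ b ∈ l, EE V A z b := by
  induction l with
  | nil => intro A _ _ _ _ z hz h; simp at h; exact (hz.not h).elim
  | cons x l ih =>
    intro A hCA hA hl hp z hz h
    rw [List.pairwise_cons] at hp
    have hx : QQ V A x := hl x (by simp)
    have e1 : ∀ y A, {w | w ∈ l} ∪ insert y A = insert y ({w : M | w ∈ l} ∪ A) := fun y A => by
      ext; simp
    have e2 : {w | w ∈ x :: l} ∪ A = insert x ({w : M | w ∈ l} ∪ A) := by ext; simp; tauto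
    rw [e2] at h
    have hpl : ∀ y, QQ V A y → (∀ b ∈ l, QQ V (insert y A) b) →
        l.Pairwise (fun x b => QQ V (insert x (insert y A)) b) := fun y hy hb =>
      List.Pairwise.imp_of_mem (fun {a b} ha hb' h => hV.pl hCl hCA hA hy (hb b hb') (hb a ha) h) hp.2
    by_cases hzx : QQ V (insert x A) z
    · obtain ⟨b, hb, h1, h2⟩ := ih (insert x A) (hCA.trans (Set.subset_insert _ _)) (hA.insert x) hp.1
        (hpl x hx hp.1) z hzx (by rwa [e1])
      exact ⟨b, by simp [hb], fun hh => h1 (hV.pl hCl hCA hA hx hzx (hp.1 b hb) hh),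
        fun hh => h2 (hV.pl hCl hCA hA hx (hp.1 b hb) hzx hh)⟩
    · by_cases hxz : QQ V (insert z A) x
      · by_cases hzl : z ∈ dcl ({y | y ∈ l} ∪ A)
        · obtain ⟨b, hb, h⟩ := ih A hCA hA (fun b hb => hl b (by simp [hb])) hp.2 z hz hzl
          exact ⟨b, by simp [hb], h⟩
        · have hb' : ∀ b ∈ l, QQ V (insert z A) b := fun b hb => QQ.trans hxz (hp.1 b hb)
          obtain ⟨b, hb, h1, h2⟩ := ih (insert z A) (hCA.trans (Set.subset_insert _ _)) (hA.insert z) hb'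
            (hpl z hz hb') x hxz (by rw [e1]; exact exch h hzl)
          exact (h2 (hV.pl hCl hCA hA hz (hb' b hb) hxz (hp.1 b hb))).elim
      · exact ⟨x, by simp, hzx, hxz⟩

end QOM

namespace QOM
open OM Cardinal

/-! ### a family of linear orders -/
abbrev XS (c : ℚ → ℕ) : Type := {p : ℚ ×ₗ ℕ // (ofLex p).2 ≤ c (ofLex p).1}

def Top {X : Type} [LinearOrder X] : ℕ → X → Prop
  | 0, x => ∀ y, ¬ x ⋖ y
  | n+1, x => ∃ y, x ⋖ y ∧ Top n y

theorem Top.iso {X Y : Type} [LinearOrder X] [LinearOrder Y] (f : X ≃o Y) (n : ℕ) :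
    ∀ x, Top n x → Top n (f x) := by
  induction n with
  | zero =>
    intro x h y hy
    exact h (f.symm y) (by rw [← apply_covBy_apply_iff f]; simpa using hy)
  | succ n ih =>
    rintro x ⟨y, h1, h2⟩
    exact ⟨f y, (apply_covBy_apply_iff f).2 h1, ih y h2⟩

theorem XS.lt {c : ℚ → ℕ} (a b : XS c) : a < b ↔ (ofLex a.1).1 < (ofLex b.1).1 ∨
    ((ofLex a.1).1 = (ofLex b.1).1 ∧ (ofLex a.1).2 < (ofLex b.1).2) := by
  rw [← Subtype.coe_lt_coe, Prod.Lex.lt_iff]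

theorem XS.cov {c : ℚ → ℕ} (a b : XS c) : a ⋖ b ↔
    (ofLex a.1).1 = (ofLex b.1).1 ∧ (ofLex b.1).2 = (ofLex a.1).2 + 1 := by
  constructor
  · rintro ⟨h1, h2⟩
    rcases (XS.lt a b).1 h1 with h | ⟨h, h'⟩
    · obtain ⟨q, hq, hq'⟩ := exists_between h
      exact (h2 (c := ⟨toLex (q, 0), Nat.zero_le _⟩) ((XS.lt _ _).2 (Or.inl hq)) ((XS.lt _ _).2 (Or.inl hq'))).elim
    · refine ⟨h, ?_⟩
      by_contra hne
      have hlt : (ofLex a.1).2 + 1 < (ofLex b.1).2 := by omega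
      exact (h2 (c := ⟨toLex ((ofLex a.1).1, (ofLex a.1).2 + 1), by
        have := b.2; rw [← h] at this; exact hlt.le.trans this⟩) ((XS.lt _ _).2 (Or.inr ⟨rfl, by simp⟩))
        ((XS.lt _ _).2 (Or.inr ⟨h, hlt⟩))).elim
  · rintro ⟨h1, h2⟩
    refine ⟨(XS.lt _ _).2 (Or.inr ⟨h1, by omega⟩), fun z hz hz' => ?_⟩
    rcases (XS.lt _ _).1 hz with h | ⟨h, h'⟩ <;> rcases (XS.lt _ _).1 hz' with k | ⟨k, k'⟩
    · exact absurd (h.trans k) (by simp [h1])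
    · rw [h1, k] at h; exact lt_irrefl _ h
    · rw [← h, h1] at k; exact lt_irrefl _ k
    · omega

theorem XS.top {c : ℚ → ℕ} (n : ℕ) : ∀ a : XS c, Top n a ↔ c (ofLex a.1).1 = (ofLex a.1).2 + n := by
  induction n with
  | zero =>
    intro a
    refine ⟨fun h => ?_, fun h y hy => ?_⟩
    · by_contra hne
      have := a.2
      exact h ⟨toLex ((ofLex a.1).1, (ofLex a.1).2 + 1), by simp; omega⟩ ((XS.cov _ _).2 ⟨rfl, rfl⟩)
    · have := (XS.cov _ _).1 hy
      have h2 := y.2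
      rw [← this.1] at h2
      omega
  | succ n ih =>
    intro a
    refine ⟨?_, fun h => ?_⟩
    · rintro ⟨y, h1, h2⟩
      rw [ih, ← ((XS.cov _ _).1 h1).1, ((XS.cov _ _).1 h1).2] at h2
      omega
    · refine ⟨⟨toLex ((ofLex a.1).1, (ofLex a.1).2 + 1), by simp; omega⟩, (XS.cov _ _).2 ⟨rfl, rfl⟩, ?_⟩
      rw [ih]
      simp; omega

theorem XS.mem {c : ℚ → ℕ} (n : ℕ) : n ∈ Set.range c ↔ ∃ x : XS c, (∀ y, ¬ y ⋖ x) ∧ Top n x := by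
  constructor
  · rintro ⟨q, rfl⟩
    refine ⟨⟨toLex (q, 0), Nat.zero_le _⟩, fun y hy => ?_, ?_⟩
    · have := ((XS.cov _ _).1 hy).2
      simp at this
    · rw [XS.top]; simp
  · rintro ⟨x, h1, h2⟩
    rw [XS.top] at h2
    refine ⟨(ofLex x.1).1, ?_⟩
    have : (ofLex x.1).2 = 0 := by
      by_contra hne
      refine h1 ⟨toLex ((ofLex x.1).1, (ofLex x.1).2 - 1), ?_⟩ ((XS.cov _ _).2 ⟨rfl, ?_⟩)
      · simp; omega
      · simp; omega
    omega

theorem XS.inj {c c' : ℚ → ℕ} (f : XS c ≃o XS c') : Set.range c = Set.range c' := by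
  have key : ∀ {c c' : ℚ → ℕ} (f : XS c ≃o XS c'), Set.range c ⊆ Set.range c' := by
    intro c c' f n hn
    obtain ⟨x, h1, h2⟩ := (XS.mem n).1 hn
    exact (XS.mem n).2 ⟨f x, fun y hy => h1 (f.symm y) (by
      rw [← apply_covBy_apply_iff f]; simpa using hy), h2.iso f⟩
  exact (key f).antisymm (key f.symm)

instance (c : ℚ → ℕ) : Countable (XS c) := by
  have : Countable (ℚ ×ₗ ℕ) := inferInstanceAs (Countable (ℚ × ℕ))
  infer_instance

/-! ### counting framework -/
variable {M : Type} [OM M] {A B V C : Set M}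

def CM (M : Type) [OM M] : Type := {N : Set M // Elem N ∧ N.Countable}

def IsIso (σ : M → M) (N N' : Set M) : Prop :=
  Set.BijOn σ N N' ∧ ∀ P, DP ∅ P → ∀ v : ℕ → M, (∀ i, v i ∈ N) → (P v ↔ P (fun i => σ (v i)))

theorem IsIso.trans {σ τ : M → M} {N N' N'' : Set M} (h : IsIso σ N N') (h' : IsIso τ N' N'') :
    IsIso (τ ∘ σ) N N'' :=
  ⟨h'.1.comp h.1, fun P hP v hv => (h.2 P hP v hv).trans (h'.2 P hP _ fun i => h.1.1 (hv i))⟩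

theorem IsIso.symm {σ : M → M} {N N' : Set M} (h : IsIso σ N N') : ∃ τ, IsIso τ N' N ∧ Set.InvOn τ σ N N' := by
  classical
  rcases N.eq_empty_or_nonempty with rfl | ⟨x, hx⟩
  · have := h.1.image_eq
    simp at this
    subst this
    exact ⟨id, ⟨Set.bijOn_id _, fun P _ v hv => (hv 0).elim⟩, by simp [Set.LeftInvOn], by simp [Set.RightInvOn, Set.LeftInvOn]⟩
  have : Nonempty M := ⟨x⟩
  have hi := h.1.invOn_invFunOn
  have hb : Set.BijOn (Function.invFunOn σ N) N' N := (Set.bijOn_comm hi).2 h.1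
  refine ⟨_, ⟨hb, fun P hP v hv => ?_⟩, hi⟩
  rw [h.2 P hP _ fun i => hb.1 (hv i)]
  have : (fun i => σ (Function.invFunOn σ N (v i))) = v := funext fun i => hi.2 (hv i)
  rw [this]

def isoS (M : Type) [OM M] : Setoid (CM M) where
  r N N' := ∃ σ, IsIso σ N.1 N'.1
  iseqv := ⟨fun N => ⟨id, Set.bijOn_id _, fun P _ v _ => Iff.rfl⟩,
    fun ⟨σ, h⟩ => let ⟨τ, h', _⟩ := h.symm; ⟨τ, h'⟩, fun ⟨σ, h⟩ ⟨τ, h'⟩ => ⟨_, h.trans h'⟩⟩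

/-- preservation with parameters fixed -/
theorem IsIso.fix {σ : M → M} {N N' : Set M} (h : IsIso σ N N') {C : Set M} (hC : C ⊆ N)
    (hσ : ∀ c ∈ C, σ c = c) {P : (ℕ → M) → Prop} (hP : DP C P) {v : ℕ → M} (hv : ∀ i, v i ∈ N) :
    P v ↔ P (fun i => σ (v i)) := by
  classical
  obtain ⟨F, hF, hP'⟩ := hP.fin
  clear hP
  rename' hP' => hP
  have hF' : (↑F : Set M) ⊆ N ∧ ∀ c ∈ F, σ c = c := ⟨hF.trans hC, fun c hc => hσ c (hF hc)⟩
  clear hF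
  induction F using Finset.induction_on generalizing P v with
  | empty => exact h.2 P (by simpa using hP) v hv
  | insert a F ha ih =>
    rw [Finset.coe_insert] at hP
    obtain ⟨P', h1, h2⟩ := hP.extr
    have haN : a ∈ N := hF'.1 (by simp)
    have := @ih P' (cons a v) (fun i => by cases i; exacts [haN, hv _]) h1
      ⟨fun x hx => hF'.1 (by simp [Finset.mem_coe.1 hx]), fun c hc => hF'.2 c (by simp [hc])⟩
    have e : (fun i => σ (cons a v i)) = cons a (fun i => σ (v i)) := by
      funext i
      cases i
      · exact hF'.2 a (by simp)
      · rfl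
    rw [e] at this
    exact (h2 _).trans (this.trans (h2 _).symm)

theorem IsIso.T1 {σ : M → M} {N N' : Set M} (h : IsIso σ N N') {C : Set M} (hC : C ⊆ N)
    (hσ : ∀ c ∈ C, σ c = c) {x : M} (hx : x ∈ N) : T1 C x (σ x) := fun S hS hSx =>
  (h.fix hC hσ hS (v := fun _ => x) (fun _ => hx)).1 hSx
theorem IsIso.T2 {σ : M → M} {N N' : Set M} (h : IsIso σ N N') {C : Set M} (hC : C ⊆ N)
    (hσ : ∀ c ∈ C, σ c = c) {x y : M} (hx : x ∈ N) (hy : y ∈ N) : T2 C x y (σ x) (σ y) := fun S hS hSx =>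
  (h.fix hC hσ hS (v := cons x fun _ => y) (fun i => by cases i; exacts [hx, hy])).1 hSx

/-- upper bound -/
theorem upper : #(Quotient (isoS M)) ≤ 2 ^ aleph0.{0} := by
  classical
  let K := {P : (ℕ → M) → Prop // OM.dp (∅ : Set M) P}
  have hK : Countable K := (OM.ctb (M := M) Set.countable_empty).to_subtype
  have hen : ∀ N : CM M, N.1.Nonempty → ∃ e : ℕ → M, N.1 = Set.range e := fun N hN =>
    N.2.2.exists_eq_range hN
  let f : CM M → Option (Set K) := fun N => if h : N.1.Nonempty then
    some {k : K | k.1 (hen N h).choose} else none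
  have hf : ∀ N N', f N = f N' → (isoS M).r N N' := by
    intro N N' h
    by_cases h1 : N.1.Nonempty <;> by_cases h2 : N'.1.Nonempty
    · simp only [f, h1, h2, dif_pos] at h
      have he := (hen N h1).choose_spec
      have he' := (hen N' h2).choose_spec
      set e := (hen N h1).choose
      set e' := (hen N' h2).choose
      have hk : ∀ P, DP ∅ P → (P e ↔ P e') := fun P hP =>
        Set.ext_iff.1 (Option.some.inj h) ⟨P, hP⟩
      have heq : ∀ i j, e i = e j ↔ e' i = e' j := fun i j =>
        hk (fun v => v i = v j) (DP.eq (DF.var i) (DF.var j))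
      obtain ⟨σ, hσ⟩ : ∃ σ : M → M, ∀ i, σ (e i) = e' i := by
        refine ⟨fun x => if hx : ∃ i, e i = x then e' hx.choose else x, fun i => ?_⟩
        have hx : ∃ j, e j = e i := ⟨i, rfl⟩
        simp only [dif_pos hx]
        exact (heq _ _).1 hx.choose_spec
      refine ⟨σ, ⟨?_, ?_, ?_⟩, ?_⟩
      · rw [he, he']; rintro _ ⟨i, rfl⟩; exact ⟨i, (hσ i).symm⟩
      · rw [he]; rintro _ ⟨i, rfl⟩ _ ⟨j, rfl⟩ hij
        rw [hσ, hσ] at hij; exact (heq _ _).2 hij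
      · rw [he, he']; rintro _ ⟨i, rfl⟩; exact ⟨e i, ⟨i, rfl⟩, hσ i⟩
      · intro P hP v hv
        rw [he] at hv
        choose s hs using hv
        have := hk (fun w => P (fun i => w (s i))) (hP.ren s)
        simp only [hs] at this
        rw [this]
        simp only [← hs, hσ]
    · simp [f, h1, h2] at h
    · simp [f, h1, h2] at h
    · rw [Set.not_nonempty_iff_eq_empty] at h1 h2
      refine ⟨id, ?_, fun P _ v _ => Iff.rfl⟩
      rw [h1, h2]; exact Set.bijOn_id _
  have h1 : #(Quotient (isoS M)) ≤ #(Option (Set K)) := by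
    refine mk_le_of_injective (f := fun q => f q.out) fun q q' h => ?_
    have := Quotient.sound (s := isoS M) (hf _ _ h)
    simpa using this
  refine h1.trans ?_
  rw [mk_option, mk_set]
  have h2 : (2 : Cardinal.{0}) ^ #K ≤ 2 ^ aleph0 := power_le_power_left (by simp) (mk_le_aleph0_iff.2 hK)
  exact add_le_of_le (cantor _).le h2 (one_le_aleph0.trans (cantor _).le)

/-- downward Löwenheim–Skolem -/
theorem dls {N B : Set M} (hN : Elem N) (hB : B ⊆ N) (hBc : B.Countable) :
    ∃ N0 ⊆ N, B ⊆ N0 ∧ N0.Countable ∧ Elem N0 := by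
  classical
  rcases isEmpty_or_nonempty M with hM | hM
  · exact ⟨B, hB, subset_rfl, hBc, fun S _ ⟨x, _⟩ => hM.elim x⟩
  have step : ∀ B : {B : Set M // B ⊆ N ∧ B.Countable}, ∃ B' : {B : Set M // B ⊆ N ∧ B.Countable},
      B.1 ⊆ B'.1 ∧ ∀ S : M → Prop, DP B.1 (fun v => S (v 0)) → (∃ x, S x) → ∃ x ∈ B'.1, S x := by
    rintro ⟨B, h1, h2⟩
    have hc := OM.ctb h2
    choose! g hg hg' using fun (P : (ℕ → M) → Prop) (h : OM.dp B P ∧ (∃ S : M → Prop, P = fun v => S (v 0)) ∧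
      ∃ x : M, P (fun _ => x)) => show ∃ x ∈ N, P (fun _ => x) by
        obtain ⟨k1, ⟨S, rfl⟩, k2⟩ := h
        exact hN S (DP.mono k1 h1) k2
    refine ⟨⟨B ∪ g '' {P | OM.dp B P ∧ (∃ S : M → Prop, P = fun v => S (v 0)) ∧ ∃ x : M, P (fun _ => x)}, ?_, ?_⟩, ?_, ?_⟩
    · rintro x (hx | ⟨P, hP, rfl⟩)
      exacts [h1 hx, hg P hP]
    · exact h2.union ((hc.mono fun P hP => hP.1).image g)
    · exact Set.subset_union_left
    · intro S hS hx
      exact ⟨g (fun v => S (v 0)), Or.inr ⟨_, ⟨hS, ⟨S, rfl⟩, hx⟩, rfl⟩, hg' _ ⟨hS, ⟨S, rfl⟩, hx⟩⟩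
  choose f hf1 hf2 using step
  let s : ℕ → {B : Set M // B ⊆ N ∧ B.Countable} := fun n => Nat.rec ⟨B, hB, hBc⟩ (fun _ B => f B) n
  have hs : ∀ n, (s n).1 ⊆ (s (n+1)).1 := fun n => hf1 _
  have hm : Monotone fun n => (s n).1 := monotone_nat_of_le_succ hs
  refine ⟨⋃ n, (s n).1, Set.iUnion_subset fun n => (s n).2.1, Set.subset_iUnion (fun n => (s n).1) 0,
    Set.countable_iUnion fun n => (s n).2.2, fun S hS hx => ?_⟩
  obtain ⟨F, hF, hS⟩ := hS.fin
  obtain ⟨n, hn⟩ : ∃ n, (↑F : Set M) ⊆ (s n).1 :=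
    hm.directed_le.exists_mem_subset_of_finset_subset_biUnion (by simpa using hF)
  obtain ⟨x, h1, h2⟩ := hf2 (s n) S (hS.mono hn) hx
  exact ⟨x, Set.mem_iUnion.2 ⟨n+1, h1⟩, h2⟩

end QOM

namespace QOM
open OM Cardinal
variable {M : Type} [OM M] {A B V C : Set M}

theorem QQ.of_T2 (hV : V ⊆ dcl A) {x z y w : M} (h : T2 A x z y w) (hz : QQ V (insert x A) z) :
    QQ V (insert y A) w := by
  have hVw : ∀ v ∈ V, v < w := fun v hv => (h.snd.lt (hV hv)).1 (hz.1 v hv)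
  refine ⟨hVw, fun e he hVe => ?_⟩
  by_contra hcon
  obtain ⟨θ, h1, h2, h3⟩ := mem_dcl_insert he
  have key : ∀ v ∈ V, ∃ e, θ x e ∧ v < e ∧ e ≤ z := fun v hv => by
    refine h.symm (fun x z => ∃ e, θ x e ∧ v < e ∧ e ≤ z) ?_ ⟨e, h2, hVe v hv, not_lt.1 hcon⟩
    exact DP.ex ((h1.bind2 (DF.var 1) (DF.var 0)).and ((DP.lt (DF.cst (hV hv)) (DF.var 0)).and
      (DP.le (DF.var 0) (DF.var 2))))
  by_cases hne : V.Nonempty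
  · obtain ⟨v, hv⟩ := hne
    obtain ⟨e', k1, k2, k3⟩ := key v hv
    refine absurd (hz.2 e' (dcl_of h1 h3 k1) fun u hu => ?_) (not_lt.2 k3)
    obtain ⟨e2, k4, k5, k6⟩ := key u hu
    exact h3 _ _ _ k4 k1 ▸ k5
  · have := h.symm (fun x z => ∃ e, θ x e ∧ e ≤ z) (DP.ex ((h1.bind2 (DF.var 1) (DF.var 0)).and
      (DP.le (DF.var 0) (DF.var 2)))) ⟨e, h2, not_lt.1 hcon⟩
    obtain ⟨e', k1, k3⟩ := this
    exact absurd (hz.2 e' (dcl_of h1 h3 k1) fun u hu => (hne ⟨u, hu⟩).elim) (not_lt.2 k3)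

theorem VOK.dens (hV : VOK V C) {l r : M} (hr : QQ V C r) (hl : QQ V (insert r C) l) :
    ∃ m, QQ V (insert r C) m ∧ QQ V (insert m C) l := by
  obtain ⟨y, hy⟩ := hV.ex (A := insert r C) (hV.ctb.insert r)
  obtain ⟨l', hl'⟩ := hV.ex (A := insert y (insert r C)) ((hV.ctb.insert r).insert y)
  have hsub : V ⊆ dcl (insert r C) := hV.sub.trans (dcl_mono (Set.subset_insert _ _))
  obtain ⟨m, hm⟩ := hom (hV.ctb.insert r) (hl'.of_ins.T1 hl) y
  exact ⟨m, hy.of_T1 hsub hm.snd, QQ.of_T2 hV.sub (hm.swap.mono (Set.subset_insert _ _))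
    (hl'.mono (Set.insert_subset_insert (Set.subset_insert _ _)))⟩

structure WQ (V C : Set M) where
  val : M
  pr : QQ V C val

theorem VOK.embed (hV : VOK V C) (X : Type) [LinearOrder X] [Countable X] :
    ∃ b : X → M, (∀ i, QQ V C (b i)) ∧ ∀ i j, i < j → QQ V (insert (b j) C) (b i) := by
  classical
  let W := WQ V C
  let _ : Preorder W :=
    { le := fun a b => ¬ QQ V (insert a.val C) b.val
      lt := fun a b => QQ V (insert b.val C) a.val
      le_refl := fun a h => h.not (sub_dcl (by simp))
      le_trans := fun a b c h1 h2 h3 => (hV.ntr subset_rfl hV.ctb a.pr b.pr h3).elim h2 h1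
      lt_iff_le_not_ge := fun a b => ⟨fun h => ⟨fun h' => lt_asymm (h.lt b.pr.1) (h'.lt a.pr.1), fun h' => h' h⟩,
        fun h => not_not.1 h.2⟩ }
  have htot : Std.Total (α := W) (· ≤ ·) := ⟨fun a b => by
    by_contra hcon
    have h1 : QQ V (insert a.val C) b.val := by
      by_contra h
      exact hcon (Or.inl h)
    have h2 : QQ V (insert b.val C) a.val := by
      by_contra h
      exact hcon (Or.inr h)
    exact lt_asymm (h1.lt a.pr.1) (h2.lt b.pr.1)⟩
  let _ : LinearOrder (Antisymmetrization W (· ≤ ·)) := inferInstance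
  have hd : DenselyOrdered (Antisymmetrization W (· ≤ ·)) := ⟨fun a b h => by
    rw [← toAntisymmetrization_ofAntisymmetrization (· ≤ ·) a, ← toAntisymmetrization_ofAntisymmetrization (· ≤ ·) b] at h ⊢
    rw [toAntisymmetrization_lt_toAntisymmetrization_iff] at h
    obtain ⟨m, h1, h2⟩ := hV.dens (ofAntisymmetrization (· ≤ ·) b).pr h
    refine ⟨toAntisymmetrization (· ≤ ·) ⟨m, h1.of_ins⟩, ?_, ?_⟩ <;>
    rw [toAntisymmetrization_lt_toAntisymmetrization_iff]
    exacts [h2, h1]⟩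
  obtain ⟨x, hx⟩ := hV.ex hV.ctb
  obtain ⟨y, hy⟩ := hV.ex (A := insert x C) (hV.ctb.insert x)
  have hn : Nontrivial (Antisymmetrization W (· ≤ ·)) := ⟨toAntisymmetrization (· ≤ ·) ⟨y, hy.of_ins⟩,
    toAntisymmetrization (· ≤ ·) ⟨x, hx⟩, ne_of_lt (by
      rw [toAntisymmetrization_lt_toAntisymmetrization_iff]; exact hy)⟩
  obtain ⟨f⟩ := Order.embedding_from_countable_to_dense X (Antisymmetrization W (· ≤ ·))
  refine ⟨fun i => (ofAntisymmetrization (· ≤ ·) (f i)).val, fun i => (ofAntisymmetrization (· ≤ ·) (f i)).pr, fun i j h => ?_⟩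
  have := f.lt_iff_lt.2 h
  rw [← ofAntisymmetrization_lt_ofAntisymmetrization_iff] at this
  exact this

theorem VOK.model (hV : VOK V C) (hC : C.Finite) (hCl : Cl V C)
    (hmax : ∀ z, QQ V C z → ∃ z' ∈ dcl (insert z C), QQ V C z' ∧ z < z')
    (hmin : ∀ z, QQ V C z → ∃ z' ∈ dcl (insert z C), QQ V C z' ∧ z' < z)
    (X : Type) [LinearOrder X] [Countable X] [Nonempty X] :
    ∃ (b : X → M) (N : CM M), C ⊆ N.1 ∧ (∀ i, b i ∈ N.1 ∧ QQ V C (b i)) ∧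
      (∀ i j, i < j → QQ V (insert (b j) C) (b i)) ∧ ∀ z ∈ N.1, QQ V C z → ∃ i, EE V C z (b i) := by
  classical
  obtain ⟨b, hb, hlt⟩ := hV.embed X
  let Good : Set M → Prop := fun N => C ⊆ N ∧ (∀ i, b i ∈ N) ∧ dcl N ⊆ N ∧
    ∀ z ∈ N, QQ V C z → ∃ i, EE V C z (b i)
  have hstart : Good (dcl (C ∪ Set.range b)) := by
    refine ⟨Set.subset_union_left.trans sub_dcl, fun i => sub_dcl (Or.inr ⟨i, rfl⟩), dcl_dcl.le, ?_⟩
    intro z hz hQ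
    obtain ⟨F, hF, hz⟩ := dcl_fin hz
    obtain ⟨s, hs⟩ : ∃ s : Finset X, ↑F ⊆ C ∪ b '' ↑s := by
      choose! g hg using fun x (hx : x ∈ Set.range b) => hx
      refine ⟨F.image g, fun x hx => ?_⟩
      rcases hF hx with h | h
      · exact Or.inl h
      · exact Or.inr ⟨g x, by simpa using ⟨x, hx, rfl⟩, hg x h⟩
    obtain ⟨z', hz', h⟩ := hV.ind hCl ((s.sort (· ≥ ·)).map b) C subset_rfl hC (by simp [hb]) (by
      rw [List.pairwise_map]
      exact s.sortedGT_sort.pairwise.imp fun {i j} h => hlt j i h) z hQ (dcl_mono (fun x hx => by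
        rcases hs hx with h | ⟨i, hi, rfl⟩
        · exact Or.inr h
        · exact Or.inl (by simp; exact ⟨i, hi, rfl⟩)) hz)
    obtain ⟨i, -, rfl⟩ := List.mem_map.1 hz'
    exact ⟨i, h⟩
  obtain ⟨N, hsub, hNmax⟩ := zorn_subset_nonempty {N | Good N} (fun c hc hch hne => by
    refine ⟨⋃₀ c, ?_, fun s hs => Set.subset_sUnion_of_mem hs⟩
    obtain ⟨s, hs⟩ := hne
    refine ⟨(hc hs).1.trans (Set.subset_sUnion_of_mem hs), fun i => ⟨s, hs, (hc hs).2.1 i⟩, fun x hx => ?_, ?_⟩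
    · obtain ⟨F, hF, hx⟩ := dcl_fin hx
      obtain ⟨t, ht, hFt⟩ := DirectedOn.exists_mem_subset_of_finset_subset_biUnion (f := id) (c := c) ⟨s, hs⟩
        hch.directedOn (s := F) (by simpa [Set.sUnion_eq_biUnion] using hF)
      exact ⟨t, ht, (hc ht).2.2.1 (dcl_mono hFt hx)⟩
    · rintro z ⟨t, ht, hz⟩
      exact (hc ht).2.2.2 z hz) _ hstart
  obtain ⟨hN1, hN2, hN3, hN4⟩ := hNmax.prop
  have hCN := hN1
  have sand : ∀ p q z, QQ V C p → QQ V C q → QQ V C z → q ∈ dcl (insert p C) → p < z → z < q → EE V C z p := by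
    intro p q z hp hq hz h h1 h2
    refine ⟨fun hh => lt_asymm h1 (hh.lt hp.1), fun hh => ?_⟩
    have := hV.lt_congr subset_rfl hV.ctb hp hq hz (EE.dcl hp hq h) hh
    exact lt_asymm h2 (this.lt hz.1)
  have hEl : Elem N := by
    refine tv hN3 fun l r hl hr hx => ?_
    obtain ⟨x, hx⟩ := hx
    by_contra hno
    push Not at hno
    have hxN : x ∉ N := fun h => hno x h hx.1 hx.2
    have hgood : Good (dcl (insert x N)) := by
      refine ⟨hN1.trans ((Set.subset_insert _ _).trans sub_dcl), fun i => sub_dcl (Or.inr (hN2 i)), dcl_dcl.le, ?_⟩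
      intro z hz hQ
      by_cases hzN : z ∈ N
      · exact hN4 z hzN hQ
      have hdN : dcl N = N := hN3.antisymm sub_dcl
      obtain ⟨θ, h1, h2, h3⟩ := mem_dcl_insert hz
      have hS : DP N (fun v => ∃ c, (l c ∧ r c) ∧ θ c (v 0)) :=
        DP.ex (((hl.dp.lift1 0).and (hr.dp.lift1 0)).and (h1.bind2 (DF.var 0) (DF.var 1)))
      obtain ⟨l', r', hl', hr', hlz, hrz, hS'⟩ := O1 (S := fun w => ∃ c, (l c ∧ r c) ∧ θ c w) hS
        ⟨x, hx, h2⟩ (fun h => hzN (hN3 h))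
      rw [hdN] at hl' hr'
      have hno' : ∀ w ∈ N, l' w → ¬ r' w := by
        intro w hw hlw hrw
        obtain ⟨c, hc, hcw⟩ := hS' w hlw hrw
        have hcN : c ∉ N := fun h => hno c h hc.1 hc.2
        have hT : T1 N c x := by
          refine cut_T1 (by rwa [hdN]) (by rwa [hdN]) fun e he => ?_
          rw [hdN] at he
          have key : ∀ c x, l c ∧ r c → l x ∧ r x → e < c → e < x := by
            intro c x hc hx hec
            by_contra hcon
            refine hno e he ?_ ?_
            · rcases hl with h | ⟨p, hp, h⟩
              · exact h e
              · rw [h]; exact ((h x).1 hx.1).trans_le (not_lt.1 hcon)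
            · rcases hr with h | ⟨p, hp, h⟩
              · exact h e
              · rw [h]; exact hec.trans ((h c).1 hc.2)
          exact ⟨key c x hc hx, key x c hx hc⟩
        have := hT (fun c => θ c w) (h1.bind2 (DF.var 0) (DF.par hw)) hcw
        exact hzN (h3 _ _ _ this h2 ▸ hw)
      have hDN : ∀ p ∈ N, dcl (insert p C) ⊆ N := fun p hp => by
        rw [← hdN]; exact dcl_mono (Set.insert_subset hp hN1)
      have hl'up : ∀ a b, a ≤ b → l' a → l' b := fun a b hab ha => by
        rcases hl' with h | ⟨p, hp, h⟩
        · exact h b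
        · rw [h] at ha ⊢; exact ha.trans_le hab
      have hr'dn : ∀ a b, a ≤ b → r' b → r' a := fun a b hab ha => by
        rcases hr' with h | ⟨p, hp, h⟩
        · exact h a
        · rw [h] at ha ⊢; exact hab.trans_lt ha
      have fin : ∀ p ∈ N, QQ V C p → EE V C z p → ∃ i, EE V C z (b i) := fun p hp hpQ hE => by
        obtain ⟨i, hi⟩ := hN4 p hp hpQ
        exact ⟨i, hV.EE_trans subset_rfl hV.ctb hQ hpQ (hb i) hE hi⟩
      obtain ⟨i0⟩ := ‹Nonempty X›
      rcases lt_trichotomy (b i0) z with hbz | hbz | hbz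
      · rcases hl' with h | ⟨p, hp, h⟩
        · exact (hno' _ (hN2 i0) (h _) (hr'dn _ _ hbz.le hrz)).elim
        · have hbp : b i0 ≤ p := by
            by_contra hcon
            exact hno' _ (hN2 i0) ((h _).2 (not_le.1 hcon)) (hr'dn _ _ hbz.le hrz)
          have hpz := (h _).1 hlz
          have hpQ : QQ V C p := hQ.down (fun v hv => ((hb i0).1 v hv).trans_le hbp) hpz.le
          obtain ⟨q, hq, hqQ, hpq⟩ := hmax p hpQ
          refine fin p hp hpQ (sand p q z hpQ hqQ hQ hq hpz ?_)
          by_contra hcon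
          exact hno' q (hDN p hp hq) ((h _).2 hpq) (hr'dn _ _ (not_lt.1 hcon) hrz)
      · exact (hzN (hbz ▸ hN2 i0)).elim
      · rcases hr' with h | ⟨p, hp, h⟩
        · exact (hno' _ (hN2 i0) (hl'up _ _ hbz.le hlz) (h _)).elim
        · have hbp : p ≤ b i0 := by
            by_contra hcon
            exact hno' _ (hN2 i0) (hl'up _ _ hbz.le hlz) ((h _).2 (not_le.1 hcon))
          have hpz := (h _).1 hrz
          have hpQ : QQ V C p := (hb i0).down (fun v hv => (hQ.1 v hv).trans hpz) hbp
          obtain ⟨q, hq, hqQ, hpq⟩ := hmin p hpQ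
          refine fin q (hDN p hp hq) hqQ (sand q p z hqQ hpQ hQ (exch hq hqQ.not) ?_ hpz)
          by_contra hcon
          exact hno' q (hDN p hp hq) (hl'up _ _ (not_lt.1 hcon) hlz) ((h _).2 hpq)
    exact hxN (hNmax.le_of_ge hgood ((Set.subset_insert _ _).trans sub_dcl) (sub_dcl (Or.inl rfl)))
  obtain ⟨N0, k1, k2, k3, k4⟩ := dls (B := C ∪ Set.range b) hEl (Set.union_subset hN1 (by
    rintro _ ⟨i, rfl⟩; exact hN2 i)) (hV.ctb.union (Set.countable_range b))
  exact ⟨b, ⟨N0, k4, k3⟩, Set.subset_union_left.trans k2, fun i => ⟨k2 (Or.inr ⟨i, rfl⟩), hb i⟩, hlt,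
    fun z hz => hN4 z (k1 hz)⟩

theorem VOK.inv (hV : VOK V C) {X Y : Type} [LinearOrder X] [LinearOrder Y] {b : X → M} {b' : Y → M}
    {N N' : CM M} (hC : C ⊆ N.1) (hC' : C ⊆ N'.1) (hb : ∀ i, b i ∈ N.1 ∧ QQ V C (b i))
    (hb' : ∀ i, b' i ∈ N'.1 ∧ QQ V C (b' i))
    (hlt : ∀ i j, i < j → QQ V (insert (b j) C) (b i)) (hlt' : ∀ i j, i < j → QQ V (insert (b' j) C) (b' i))
    (hN : ∀ z ∈ N.1, QQ V C z → ∃ i, EE V C z (b i)) (hN' : ∀ z ∈ N'.1, QQ V C z → ∃ i, EE V C z (b' i))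
    {σ : M → M} (hσ : IsIso σ N.1 N'.1) (hfix : ∀ c ∈ C, σ c = c) : Nonempty (X ≃o Y) := by
  have hQ : ∀ i, QQ V C (σ (b i)) := fun i => (hb i).2.of_T1 hV.sub (hσ.T1 hC hfix (hb i).1)
  choose f hf using fun i => hN' (σ (b i)) (hσ.1.1 (hb i).1) (hQ i)
  have hmono : StrictMono f := by
    intro i j hij
    have h1 : QQ V (insert (σ (b j)) C) (σ (b i)) :=
      (hlt i j hij).of_T2 hV.sub (hσ.T2 hC hfix (hb j).1 (hb i).1)
    have h2 := hV.lt_congr subset_rfl hV.ctb (hQ i) (hb' _).2 (hQ j) (hf i) h1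
    have h3 := hV.lt_congr' subset_rfl hV.ctb (hQ j) (hb' _).2 (hb' _).2 (hf j) h2
    by_contra hcon
    rcases (not_lt.1 hcon).lt_or_eq with h | h
    · exact lt_asymm (h3.lt (hb' _).2.1) ((hlt' _ _ h).lt (hb' _).2.1)
    · rw [h] at h3
      exact h3.not (sub_dcl (by simp))
  refine ⟨hmono.orderIsoOfSurjective f fun j => ?_⟩
  obtain ⟨z, hz, hzj⟩ := hσ.1.2.2 (hb' j).1
  have hzQ : QQ V C z := (hb' j).2.of_T1 hV.sub (hzj ▸ (hσ.T1 hC hfix hz).symm)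
  obtain ⟨i, hi⟩ := hN z hz hzQ
  refine ⟨i, ?_⟩
  have h1 : EE V C (b' j) (σ (b i)) := by
    rw [← hzj]
    exact ⟨fun h => hi.1 (h.of_T2 hV.sub (hσ.T2 hC hfix (hb i).1 hz).symm),
      fun h => hi.2 (h.of_T2 hV.sub (hσ.T2 hC hfix hz (hb i).1).symm)⟩
  have h2 := hV.EE_trans subset_rfl hV.ctb (hb' j).2 (hQ i) (hb' _).2 h1 (hf i)
  rcases lt_trichotomy (f i) j with h | h | h
  · exact (h2.2 (hlt' _ _ h)).elim
  · exact h
  · exact (h2.1 (hlt' _ _ h)).elim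

theorem VOK.mainA (hV : VOK V C) (hC : C.Finite) (hCl : Cl V C)
    (hmax : ∀ z, QQ V C z → ∃ z' ∈ dcl (insert z C), QQ V C z' ∧ z < z')
    (hmin : ∀ z, QQ V C z → ∃ z' ∈ dcl (insert z C), QQ V C z' ∧ z' < z) :
    2 ^ aleph0.{0} ≤ #(Quotient (isoS M)) := by
  classical
  have hc : ∀ S : Set ℕ, ∃ c : ℚ → ℕ, Set.range c = insert 0 (Nat.succ '' S) := fun S => by
    obtain ⟨f, hf⟩ := (Set.to_countable (insert 0 (Nat.succ '' S))).exists_eq_range (Set.insert_nonempty _ _)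
    obtain ⟨g, hg⟩ : ∃ g : ℚ → ℕ, Function.Surjective g := by
      obtain ⟨e⟩ := nonempty_equiv_of_countable (α := ℚ) (β := ℕ)
      exact ⟨e, e.surjective⟩
    exact ⟨f ∘ g, by rw [hg.range_comp, hf]⟩
  choose c hc using hc
  have hne : ∀ S, Nonempty (XS (c S)) := fun S => ⟨⟨toLex (0, 0), Nat.zero_le _⟩⟩
  choose b N h1 h2 h3 h4 using fun S : Set ℕ => hV.model hC hCl hmax hmin (XS (c S))
  have hinj : ∀ S S', (∃ σ, IsIso σ (N S).1 (N S').1 ∧ ∀ c ∈ C, σ c = c) → S = S' := by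
    rintro S S' ⟨σ, k1, k2⟩
    obtain ⟨f⟩ := hV.inv (h1 S) (h1 S') (h2 S) (h2 S') (h3 S) (h3 S') (h4 S) (h4 S') k1 k2
    have := XS.inj f
    rw [hc, hc] at this
    ext n
    have := Set.ext_iff.1 this (n+1)
    simpa using this
  by_contra hcon
  rw [not_le] at hcon
  let F : Set ℕ → Quotient (isoS M) ⊕ ℕ := fun S => Sum.inl (Quotient.mk _ (N S))
  have hlt : #(Quotient (isoS M) ⊕ ℕ) < #(Set ℕ) := by
    rw [mk_sum, mk_set, mk_nat]
    simp only [lift_id]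
    exact add_lt_of_lt (cantor _).le hcon (cantor _)
  have hunc : Uncountable (Set ℕ) := by
    rw [← aleph0_lt_mk_iff, mk_set, mk_nat]; exact cantor _
  obtain ⟨q, hq⟩ := exists_uncountable_fiber F hlt
  obtain ⟨⟨S0, hS0⟩⟩ := (inferInstance : Nonempty (F ⁻¹' {q}))
  have hiso : ∀ S : F ⁻¹' {q}, ∃ σ, IsIso σ (N S.1).1 (N S0).1 := fun S => by
    have : F S.1 = F S0 := S.2.trans hS0.symm
    exact Quotient.exact (s := isoS M) (Sum.inl.inj this)
  choose σ hσ using hiso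
  have hfinC := hC.to_subtype
  have hcN := (N S0).2.2.to_subtype
  refine hq.not_countable (Function.Injective.countable (β := C → (N S0).1)
    (f := fun S x => ⟨σ S x, (hσ S).1.1 (h1 S.1 x.2)⟩) fun S S' h => Subtype.ext (hinj _ _ ?_))
  obtain ⟨τ, hτ, hinv⟩ := (hσ S').symm
  refine ⟨_, (hσ S).trans hτ, fun x hx => ?_⟩
  have : σ S x = σ S' x := congrArg Subtype.val (congrFun h ⟨x, hx⟩)
  simp only [Function.comp, this]
  exact hinv.1 (h1 S'.1 hx)

end QOM

namespace QOM
open OM Cardinal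
variable {M : Type} [OM M] {A B V C : Set M}

theorem mem_dcl_bi {a b : M} (h : b ∈ dcl (insert a A)) (hb : b ∉ dcl A) :
    ∃ θ : M → M → Prop, DP A (fun v => θ (v 0) (v 1)) ∧ θ a b ∧ (∀ x y z, θ x y → θ x z → y = z) ∧
      ∀ x y z, θ x z → θ y z → x = y := by
  obtain ⟨θ, h1, h2, h3⟩ := mem_dcl_insert h
  obtain ⟨θ', h1', h2', h3'⟩ := mem_dcl_insert (exch h hb)
  exact ⟨fun x y => θ x y ∧ θ' y x, h1.and (h1'.bind2 (DF.var 1) (DF.var 0)), ⟨h2, h2'⟩,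
    fun x y z h h' => h3 x y z h.1 h'.1, fun x y z h h' => h3' z x y h.2 h'.2⟩

/-- eventual membership along a sequence -/
theorem tr1 {a : ℕ → M} (ha : StrictMono a) {S : M → Prop} (hS : DP A (fun v => S (v 0))) {z : M}
    (hz : QQ (Set.range a) A z) (h : S z) : ∃ n0, ∀ n ≥ n0, S (a n) := by
  obtain ⟨_, ⟨m, rfl⟩, hm⟩ := QQ.tr (Set.range_nonempty a) hS hz h
  exact ⟨m+1, fun n hn => hm _ (ha (by omega)) (hz.1 _ ⟨n, rfl⟩).le⟩
theorem tr2 {a : ℕ → M} (ha : StrictMono a) {S : M → Prop} (hS : DP A (fun v => S (v 0))) {z : M}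
    (hz : QQ (Set.range a) A z) {n0 : ℕ} (h : ∀ n ≥ n0, S (a n)) : S z := by
  by_contra hcon
  obtain ⟨m, hm⟩ := tr1 ha (S := fun z => ¬ S z) hS.not hz hcon
  exact hm (max m n0) (le_max_left _ _) (h _ (le_max_right _ _))

structure SQ (a : ℕ → M) (θ : M → M → Prop) : Prop where
  dp : DP ∅ (fun v => θ (v 0) (v 1))
  f1 : ∀ x y z, θ x y → θ x z → y = z
  f2 : ∀ x y z, θ x z → θ y z → x = y
  st : ∀ n, θ (a n) (a (n+1))
  mo : StrictMono a

theorem SQ.dpA {a : ℕ → M} {θ : M → M → Prop} (h : SQ a θ) : DP A (fun v => θ (v 0) (v 1)) :=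
  h.dp.mono (Set.empty_subset _)

theorem SQ.vok {a : ℕ → M} {θ : M → M → Prop} (h : SQ a θ) : VOK (Set.range a) (insert (a 0) ∅) where
  ne := Set.range_nonempty a
  sub := by
    rintro _ ⟨n, rfl⟩
    induction n with
    | zero => exact sub_dcl (by simp)
    | succ n ih =>
      exact dcl_ins_sub ih (dcl_of h.dpA h.f1 (h.st n))
  ctb := by simp
  top := by rintro _ ⟨n, rfl⟩; exact ⟨_, h.mo (Nat.lt_succ_self n)⟩
  dense := by rintro _ ⟨n, rfl⟩ e he; exact ⟨_, h.mo (Nat.lt_succ_self n), he _ ⟨_, rfl⟩⟩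

theorem SQ.mx {a : ℕ → M} {θ : M → M → Prop} (h : SQ a θ) (hA : insert (a 0) ∅ ⊆ A) {z : M}
    (hz : QQ (Set.range a) A z) : ∃ w, θ z w ∧ z < w ∧ QQ (Set.range a) A w := by
  obtain ⟨w, h1, h2⟩ := tr2 h.mo (S := fun z => ∃ w, θ z w ∧ z < w)
    (DP.ex ((h.dpA.bind2 (DF.var 1) (DF.var 0)).and (DP.lt (DF.var 1) (DF.var 0)))) hz (n0 := 0)
    fun n _ => ⟨_, h.st n, h.mo (Nat.lt_succ_self n)⟩
  refine ⟨w, h1, h2, fun v hv => (hz.1 v hv).trans h2, fun e he hVe => ?_⟩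
  obtain ⟨w', h3, h4⟩ := tr2 h.mo (S := fun z => ∃ w, θ z w ∧ w < e)
    (DP.ex ((h.dpA.bind2 (DF.var 1) (DF.var 0)).and (DP.lt (DF.var 0) (DF.cst he)))) hz (n0 := 0)
    fun n _ => ⟨_, h.st n, hVe _ ⟨_, rfl⟩⟩
  exact h.f1 _ _ _ h3 h1 ▸ h4

theorem SQ.mn {a : ℕ → M} {θ : M → M → Prop} (h : SQ a θ) (hA : insert (a 0) ∅ ⊆ A) {z : M}
    (hz : QQ (Set.range a) A z) : ∃ w, θ w z ∧ w < z ∧ QQ (Set.range a) A w := by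
  obtain ⟨w, h1, h2⟩ := tr2 h.mo (S := fun z => ∃ w, θ w z ∧ w < z)
    (DP.ex ((h.dpA.bind2 (DF.var 0) (DF.var 1)).and (DP.lt (DF.var 0) (DF.var 1)))) hz (n0 := 1)
    fun n hn => by
      obtain ⟨m, rfl⟩ : ∃ m, n = m + 1 := ⟨n-1, by omega⟩
      exact ⟨_, h.st m, h.mo (Nat.lt_succ_self m)⟩
  refine ⟨w, h1, h2, hz.down ?_ h2.le⟩
  rintro _ ⟨k, rfl⟩
  obtain ⟨w', h3, h4⟩ := tr2 h.mo (S := fun z => ∃ w, θ w z ∧ a k < w)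
    (DP.ex ((h.dpA.bind2 (DF.var 0) (DF.var 1)).and (DP.lt (DF.cst (dcl_mono hA (h.vok.sub ⟨k, rfl⟩))) (DF.var 0)))) hz (n0 := k+2)
    fun n hn => by
      obtain ⟨m, rfl⟩ : ∃ m, n = m + 1 := ⟨n-1, by omega⟩
      exact ⟨_, h.st m, h.mo (by omega)⟩
  exact h.f2 _ _ _ h3 h1 ▸ h4

theorem SQ.mainA {a : ℕ → M} {θ : M → M → Prop} (h : SQ a θ) (hCl : Cl (Set.range a) (insert (a 0) ∅)) :
    2 ^ aleph0.{0} ≤ #(Quotient (isoS M)) := by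
  refine h.vok.mainA (by simp) hCl (fun z hz => ?_) fun z hz => ?_
  · obtain ⟨w, h1, h2, h3⟩ := h.mx subset_rfl hz
    exact ⟨w, dcl_of h.dpA h.f1 h1, h3, h2⟩
  · obtain ⟨w, h1, h2, h3⟩ := h.mn subset_rfl hz
    exact ⟨w, exch (dcl_of h.dpA h.f1 h1) hz.not, h3, h2⟩

theorem SQ.exists {x y : M} (hx : x ∉ dcl ∅) (h : T1 ∅ x y) (hy : y ∈ dcl (insert x ∅)) (hlt : x < y)
    {R : M → M → Prop} (hR : DP ∅ (fun v => R (v 0) (v 1))) (hRx : R x y) :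
    ∃ a θ, SQ (M := M) a θ ∧ a 0 = x ∧ ∀ n, R (a n) (a (n+1)) := by
  obtain ⟨θ, h1, h2, h3, h4⟩ := mem_dcl_bi hy (h.ndcl hx)
  have step : ∀ u, T1 ∅ x u → ∃ w, T2 ∅ x y u w := fun u hu => hom (by simp) hu y
  choose! g hg using step
  have hT : ∀ n, T1 ∅ x (g^[n] x) := by
    intro n
    induction n with
    | zero => exact T1.refl x
    | succ n ih => rw [Function.iterate_succ_apply']; exact h.trans (hg _ ih).snd
  have hT2 : ∀ n, T2 ∅ x y (g^[n] x) (g^[n+1] x) := fun n => by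
    rw [Function.iterate_succ_apply']; exact hg _ (hT n)
  exact ⟨fun n => g^[n] x, θ, ⟨h1, h3, h4, fun n => hT2 n θ h1 h2,
    strictMono_nat_of_lt_succ fun n => hT2 n (· < ·) DP.lt0 hlt⟩, rfl, fun n => hT2 n R hR hRx⟩

/-- non-density -/
def ND (M : Type) [OM M] : Prop := ∀ z : M, z ∉ dcl (∅ : Set M) → ¬ ∃ s, z ⋖ s

theorem DP.cov {f g : (ℕ → M) → M} (hf : DF A f) (hg : DF A g) : DP A (fun v => f v ⋖ g v) := by
  refine DP.bind2 (θ := fun x y => x ⋖ y) ?_ hf hg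
  exact (DP.lt (DF.var 0) (DF.var 1)).and (DP.all ((DP.lt (DF.var 1) (DF.var 0)).imp (DP.lt (DF.var 0) (DF.var 2)).not))

/-- along a discrete sequence, germs of functions map the sequence to itself -/
theorem germ {a : ℕ → M} {θ : M → M → Prop} (h : SQ a θ) (hc : ∀ n, a n ⋖ a (n+1)) (hA : insert (a 0) ∅ ⊆ A)
    (hAc : A.Countable) {G : M → M → Prop} (hG : DP A (fun v => G (v 0) (v 1))) (hf : ∀ x y z, G x y → G x z → y = z)
    {b c : M} (hb : QQ (Set.range a) A b) (hcQ : QQ (Set.range a) A c) (hbc : G b c) :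
    ∃ n0, ∀ n ≥ n0, ∃ m, G (a n) (a m) := by
  obtain ⟨y, hy⟩ := h.vok.ex (hAc.insert c)
  have hsub : Set.range a ⊆ dcl A := h.vok.sub.trans (dcl_mono hA)
  obtain ⟨w, hw⟩ := hom hAc (hb.T1 hy.of_ins) c
  have hGw : G y w := hw G hG hbc
  have hwQ : QQ (Set.range a) A w := hcQ.of_T1 hsub hw.snd
  have hwc : w < c := h.vok.lem1 hA hAc hcQ hy (dcl_of hG hf hGw) hwQ
  obtain ⟨n0, hn0⟩ := tr1 h.mo (S := fun y => ∃ w, G y w ∧ w < c) (DP.ex (((hG.mono (Set.subset_insert _ _)).bind2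
    (DF.var 1) (DF.var 0)).and (DP.lt (DF.var 0) DF.par0))) hy ⟨w, hGw, hwc⟩
  obtain ⟨n1, hn1⟩ := tr1 h.mo (S := fun y => ∃ w, G y w ∧ a 0 < w) (DP.ex ((hG.bind2
    (DF.var 1) (DF.var 0)).and (DP.lt (DF.cst (hsub ⟨0, rfl⟩)) (DF.var 0)))) hb ⟨c, hbc, hcQ.1 _ ⟨0, rfl⟩⟩
  refine ⟨max n0 n1, fun n hn => ?_⟩
  obtain ⟨w, k1, k2⟩ := hn0 n ((le_max_left _ _).trans hn)
  obtain ⟨w', k3, k4⟩ := hn1 n ((le_max_right _ _).trans hn)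
  obtain rfl := hf _ _ _ k1 k3
  by_contra hcon
  push Not at hcon
  have : ∀ m, a m < w := by
    intro m
    induction m with
    | zero => exact k4
    | succ m ih =>
      refine lt_of_le_of_ne (not_lt.1 fun h' => (hc m).2 ih h') ?_
      rintro rfl
      exact hcon _ k1
  refine lt_asymm k2 (hcQ.2 w (dcl_ins_sub (hsub ⟨n, rfl⟩) (dcl_of hG hf k1)) ?_)
  rintro _ ⟨m, rfl⟩
  exact this m

theorem SQ.clA0 {a : ℕ → M} {θ : M → M → Prop} (h : SQ a θ) (hc : ∀ n, a n ⋖ a (n+1)) :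
    Cl (Set.range a) (insert (a 0) ∅) := by
  intro A x b c hA hAf hx hb hcQ hcb hbc
  have hA' : insert (a 0) ∅ ⊆ insert x A := hA.trans (Set.subset_insert _ _)
  have hAc : (insert x A).Countable := hAf.countable.insert x
  have hsub : Set.range a ⊆ dcl A := h.vok.sub.trans (dcl_mono hA)
  obtain ⟨G, g1, g2, g3, g4⟩ := mem_dcl_bi hcb hcQ.not
  obtain ⟨n0, hn0⟩ := germ h hc hA' hAc g1 g3 hb hcQ g2
  obtain ⟨m0, hm0⟩ := germ h hc hA' hAc (G := fun x y => G y x) (g1.bind2 (DF.var 1) (DF.var 0))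
    (fun x y z => g4 y z x) hcQ hb g2
  choose! l hl using hn0
  choose! k hk using hm0
  have lk : ∀ n m, n ≥ n0 → G (a n) (a m) → m = l n := fun n m hn hG => h.mo.injective (g3 _ _ _ hG (hl n hn))
  have inj : ∀ n n' m, G (a n) (a m) → G (a n') (a m) → n = n' := fun n n' m h1 h2 => h.mo.injective (g4 _ _ _ h1 h2)
  -- the function is eventually increasing
  have inc : ∃ n1 ≥ n0, ∀ n ≥ n1, l n < l (n+1) := by
    have hd : DP (insert x A) (fun v => ∃ y y' w, θ (v 0) y' ∧ G (v 0) y ∧ G y' w ∧ y < w) :=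
      DP.ex (DP.ex (DP.ex ((h.dpA.bind2 (DF.var 3) (DF.var 1)).and ((g1.bind2 (DF.var 3) (DF.var 2)).and
        ((g1.bind2 (DF.var 1) (DF.var 0)).and (DP.lt (DF.var 2) (DF.var 0)))))))
    have eqv : ∀ n ≥ n0, (∃ y y' w, θ (a n) y' ∧ G (a n) y ∧ G y' w ∧ y < w) ↔ l n < l (n+1) := by
      intro n hn
      constructor
      · rintro ⟨y, y', w, h1, h2, h3, h4⟩
        obtain rfl := h.f1 _ _ _ h1 (h.st n)
        obtain rfl := g3 _ _ _ h2 (hl n hn)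
        obtain rfl := g3 _ _ _ h3 (hl (n+1) (by omega))
        exact h.mo.lt_iff_lt.1 h4
      · intro h4
        exact ⟨_, _, _, h.st n, hl n hn, hl (n+1) (by omega), h.mo h4⟩
    by_cases hS : ∃ y y' w, θ b y' ∧ G b y ∧ G y' w ∧ y < w
    · obtain ⟨n1, hn1⟩ := tr1 h.mo (S := fun z => ∃ y y' w, θ z y' ∧ G z y ∧ G y' w ∧ y < w) hd hb hS
      exact ⟨max n0 n1, le_max_left _ _, fun n hn => (eqv n ((le_max_left _ _).trans hn)).1
        (hn1 n ((le_max_right _ _).trans hn))⟩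
    · exfalso
      obtain ⟨n1, hn1⟩ := tr1 h.mo (S := fun z => ¬ ∃ y y' w, θ z y' ∧ G z y ∧ G y' w ∧ y < w) hd.not hb hS
      have dec : ∀ n ≥ max n0 n1, l (n+1) < l n := fun n hn => by
        have h1 : ¬ l n < l (n+1) := fun hh => hn1 n ((le_max_right _ _).trans hn)
          ((eqv n ((le_max_left _ _).trans hn)).2 hh)
        have hn' := (le_max_left n0 n1).trans hn
        have h2 : l n ≠ l (n+1) := fun e => by
          have h3 := hl n hn'
          rw [e] at h3
          have := inj _ _ _ h3 (hl (n+1) (by omega))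
          omega
        omega
      have : ∀ i, l (max n0 n1 + i) + i ≤ l (max n0 n1) := by
        intro i
        induction i with
        | zero => simp
        | succ i ih =>
          have := dec (max n0 n1 + i) (by omega)
          have e : max n0 n1 + (i+1) = max n0 n1 + i + 1 := by omega
          rw [e]
          omega
      have := this (l (max n0 n1) + 1)
      omega
  obtain ⟨n1, hn1, inc⟩ := inc
  have mono : ∀ n m, n1 ≤ n → n < m → l n < l m := by
    intro n m hn hnm
    induction m with
    | zero => omega
    | succ m ih =>
      rcases (Nat.lt_succ_iff.1 hnm).lt_or_eq with h' | rfl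
      · exact (ih h').trans (inc m (by omega))
      · exact inc n hn
  have ge : ∀ i, i ≤ l (n1 + i) := by
    intro i
    induction i with
    | zero => simp
    | succ i ih => have := inc (n1+i) (by omega); rw [← add_assoc]; omega
  -- eventually no gaps: bounded preimages are excluded
  obtain ⟨N, hN⟩ : ∃ N ≥ n1, ∀ n ≥ N, l (n+1) = l n + 1 := by
    obtain ⟨B, hB⟩ : ∃ B, ∀ n < n1, ∀ m, G (a n) (a m) → m ≤ B := by
      clear inc mono ge
      clear hn1
      induction n1 with
      | zero => exact ⟨0, by simp⟩
      | succ n ih =>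
        obtain ⟨B, hB⟩ := ih
        by_cases hex : ∃ m, G (a n) (a m)
        · obtain ⟨m, hm⟩ := hex
          refine ⟨max B m, fun n' hn' m' hm' => ?_⟩
          rcases (Nat.lt_succ_iff.1 hn').lt_or_eq with h' | rfl
          · exact (hB _ h' _ hm').trans (le_max_left _ _)
          · rw [h.mo.injective (g3 _ _ _ hm' hm)]; exact le_max_right _ _
        · refine ⟨B, fun n' hn' m' hm' => ?_⟩
          rcases (Nat.lt_succ_iff.1 hn').lt_or_eq with h' | rfl
          · exact hB _ h' _ hm'
          · exact (hex ⟨_, hm'⟩).elim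
    refine ⟨n1 + m0 + B, by omega, fun n hn => ?_⟩
    have h1 := inc n (by omega)
    have h2 := ge (n - n1)
    rw [show n1 + (n - n1) = n by omega] at h2
    have h3 := hk (l n + 1) (by omega)
    have h4 : n1 ≤ k (l n + 1) := by
      by_contra hcon
      have := hB _ (not_le.1 hcon) _ h3
      omega
    have h5 := lk _ _ (by omega) h3
    by_contra hcon
    have h6 : l n < l (k (l n + 1)) := by omega
    have h7 : n < k (l n + 1) := by
      by_contra h8
      rcases (not_lt.1 h8).lt_or_eq with h9 | h9
      · have := mono _ _ h4 h9; omega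
      · rw [h9] at h6; omega
    have h8 : l (k (l n + 1)) < l (n+1) := by omega
    rcases (Nat.succ_le_of_lt h7).lt_or_eq with h9 | h9
    · have := mono (n+1) _ (by omega) h9; omega
    · simp only [Nat.succ_eq_add_one] at h9
      rw [← h9] at h8; omega
  have lin : ∀ i, l (N + i) = l N + i := by
    intro i
    induction i with
    | zero => rfl
    | succ i ih => rw [← add_assoc, hN.2 _ (by omega), ih]; omega
  -- iterates of the successor
  obtain ⟨I, i1, i2, i3, i4⟩ : ∃ I : ℕ → M → M → Prop, (∀ j, DP ∅ (fun v => I j (v 0) (v 1))) ∧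
      (∀ j n, I j (a n) (a (n+j))) ∧ (∀ j x y z, I j x y → I j x z → y = z) ∧
      (∀ j x y z, I j x z → I j y z → x = y) := by
    refine ⟨fun j => Nat.rec (fun x y => x = y) (fun _ I x y => ∃ w, I x w ∧ θ w y) j, fun j => ?_, fun j => ?_, fun j => ?_, fun j => ?_⟩
    · induction j with
      | zero => exact DP.eq0
      | succ j ih => exact DP.ex ((ih.bind2 (DF.var 1) (DF.var 0)).and (h.dpA.bind2 (DF.var 0) (DF.var 2)))
    · induction j with
      | zero => exact fun n => rfl
      | succ j ih => exact fun n => ⟨_, ih n, h.st _⟩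
    · induction j with
      | zero => rintro x y z rfl rfl; rfl
      | succ j ih =>
        rintro x y z ⟨w, h1, h2⟩ ⟨w', h1', h2'⟩
        obtain rfl := ih _ _ _ h1 h1'
        exact h.f1 _ _ _ h2 h2'
    · induction j with
      | zero => rintro x y z rfl rfl; rfl
      | succ j ih =>
        rintro x y z ⟨w, h1, h2⟩ ⟨w', h1', h2'⟩
        obtain rfl := h.f2 _ _ _ h2 h2'
        exact ih _ _ _ h1 h1'
  have iA : ∀ {A : Set M} j, DP A (fun v => I j (v 0) (v 1)) := fun j => (i1 j).mono (Set.empty_subset _)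
  refine hbc.not ?_
  rcases le_total N (l N) with hle | hle
  · obtain ⟨w, k1, k2⟩ := tr2 h.mo (S := fun y => ∃ w, G y w ∧ I (l N - N) y w) (DP.ex ((g1.bind2 (DF.var 1) (DF.var 0)).and
      ((iA _).bind2 (DF.var 1) (DF.var 0)))) hb (n0 := N) (fun n hn => ⟨_, hl n (by omega), by
        have h1 := lin (n - N)
        rw [show N + (n - N) = n by omega] at h1
        rw [h1]
        have := i2 (l N - N) n
        rwa [show n + (l N - N) = l N + (n - N) by omega] at this⟩)
    obtain rfl := g3 _ _ _ k1 g2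
    exact exch (dcl_of (iA _) (i3 _) k2) (hcQ.of_ins.not)
  · obtain ⟨w, k1, k2⟩ := tr2 h.mo (S := fun y => ∃ w, G y w ∧ I (N - l N) w y) (DP.ex ((g1.bind2 (DF.var 1) (DF.var 0)).and
      ((iA _).bind2 (DF.var 0) (DF.var 1)))) hb (n0 := N) (fun n hn => ⟨_, hl n (by omega), by
        have h1 := lin (n - N)
        rw [show N + (n - N) = n by omega] at h1
        rw [h1]
        have := i2 (N - l N) (l N + (n - N))
        rwa [show l N + (n - N) + (N - l N) = n by omega] at this⟩)
    obtain rfl := g3 _ _ _ k1 g2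
    exact dcl_of (iA _) (i3 _) k2

theorem caseA0 (h : ¬ ND M) : 2 ^ aleph0.{0} ≤ #(Quotient (isoS M)) := by
  unfold ND at h
  push Not at h
  obtain ⟨x, hx, s, hs⟩ := h
  have hd : s ∈ dcl (insert x ∅) := dcl_of (θ := fun x s => x ⋖ s) (DP.cov (DF.var 0) (DF.var 1))
    (fun x y z h1 h2 => h1.unique_right h2) hs
  have hs' : s ∉ dcl ∅ := fun h' => hx (dcl_of1 (S := fun x => x ⋖ s) (DP.cov (DF.var 0) (DF.cst h')) fun y =>
    ⟨fun h => h.unique_left hs, fun h => h ▸ hs⟩)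
  have hT : T1 ∅ x s := cut_T1 hx hs' fun e he => ⟨fun h => h.trans hs.1, fun h => by
    refine lt_of_le_of_ne (not_lt.1 fun h' => hs.2 h' h) ?_
    rintro rfl
    exact hx he⟩
  obtain ⟨a, θ, h1, h2, h3⟩ := SQ.exists hx hT hd hs.1 (R := fun x s => x ⋖ s) (DP.cov (DF.var 0) (DF.var 1)) hs
  exact h1.mainA (h1.clA0 h3)

theorem caseA0' (h : ¬ @ND M (OM.dual M)) : 2 ^ aleph0.{0} ≤ #(Quotient (isoS M)) :=
  @caseA0 M (OM.dual M) h

end QOM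

namespace QOM
open OM Cardinal
variable {M : Type} [OM M] {A B V C : Set M}

/-- no nontrivial function germs at a point -/
def NC (M : Type) [OM M] : Prop := ∀ (A : Set M) (d t t' : M), A.Finite → d ∈ dcl A → QQ {d} A t →
  QQ {d} A t' → t' ∈ dcl (insert t A) → t = t'

theorem vok_of {d t : M} (hA : A.Countable) (hd : d ∈ dcl A) (ht : QQ {d} A t) : VOK {d} A where
  ne := ⟨d, rfl⟩
  sub := by simpa using hd
  ctb := hA
  top := by rintro v rfl; exact ⟨t, ht.1 _ rfl⟩
  dense := by
    rintro v rfl e he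
    by_contra hcon
    push Not at hcon
    have h1 : e ≤ t := hcon t (ht.1 _ rfl)
    have h2 : v ⋖ e := ⟨he v rfl, fun c hc hc' => (hcon c hc).not_gt hc'⟩
    exact (ht.down he h1).not (dcl_of1 (S := fun x => v ⋖ x) (DP.cov (DF.cst hd) (DF.var 0)) fun y =>
      ⟨fun h => h.unique_right h2, fun h => h ▸ h2⟩)

theorem vok_mono {d : M} (h : VOK {d} A) (hAB : A ⊆ B) (hB : B.Countable) : VOK {d} B :=
  ⟨h.ne, h.sub.trans (dcl_mono hAB), hB, h.top, h.dense⟩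

def Star (d : M) (A : Set M) : Prop := ∀ e ∈ dcl A, d < e → ∃ e' ∈ dcl A, d < e' ∧ e' < e

theorem QQ.trd {d z : M} (hz : QQ {d} A z) {S : M → Prop} (hS : DP A (fun v => S (v 0)))
    (hSz : S z) : ∀ y, d < y → y ≤ z → S y := by
  obtain ⟨v, rfl, h⟩ := hz.tr (Set.singleton_nonempty d) hS hSz
  exact h

theorem KL {d w b e0 : M} (hV : VOK {d} C) (hCA : C ⊆ A) (hA : A.Countable) (hs : Star d A) (he0 : e0 ∈ dcl A)
    (hde0 : d < e0) (hw : QQ {d} A w) (hb : QQ {d} (insert w A) b) {K : M → Prop}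
    (hK : DP (insert b A) (fun v => K (v 0))) (h : ∀ e ∈ dcl A, d < e → ¬ K e) : ¬ K w := by
  intro hKw
  have hwb : w ∉ dcl (insert b A) := fun h' => hb.not (exch h' hw.not)
  rcases O1R hK hKw hwb with ⟨q, hq, h1, h2⟩ | h2
  · have hq' : ¬ QQ {d} A q := fun hh => lt_asymm h1 (hV.lem1 hCA hA hw hb hq hh)
    have hdq : d < q := (hw.1 d rfl).trans h1
    obtain ⟨e, he, hde, heq⟩ : ∃ e ∈ dcl A, d < e ∧ e ≤ q := by
      by_contra hcon
      push Not at hcon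
      exact hq' ⟨by simpa using hdq, fun e he h' => hcon e he (h' d rfl)⟩
    obtain ⟨e', he', k1, k2⟩ := hs e he hde
    exact h e' he' k1 (h2 e' (k2.trans_le heq) (hw.2 e' he' (by simpa using k1)).le)
  · exact h e0 he0 hde0 (h2 e0 (hw.2 e0 he0 (by simpa using hde0)).le)

theorem T2.toT1 {x b x' : M} (h : T2 A x b x' b) : T1 (insert b A) x x' := by
  intro S hS hx
  obtain ⟨θ, h1, h2⟩ := extr1 hS
  exact (h2 _).2 (h (fun x b => θ b x) (h1.bind2 (DF.var 1) (DF.var 0)) ((h2 _).1 hx))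

theorem clA1 {d t0 : M} (hV : VOK {d} C) (hCf : C.Finite) (hs : ∀ A, C ⊆ A → Star d A) (ht0 : t0 ∈ dcl C)
    (hdt0 : d < t0) : Cl {d} C := by
  intro A x b c hCA hAf hx hb hc hcb hbc
  have hA := hAf.countable
  have hsub : ({d} : Set M) ⊆ dcl A := hV.sub.trans (dcl_mono hCA)
  have hdA : d ∈ dcl A := hsub rfl
  have hdb : d < b := hb.1 d rfl
  have hxb : x ∉ dcl (insert b A) := fun h' => hb.not (exch h' hx.not)
  obtain ⟨θ, g1, g2, g3⟩ := mem_dcl_insert (by rwa [Set.insert_comm] at hcb : c ∈ dcl (insert x (insert b A)))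
  obtain ⟨G, G1, G2⟩ := extr2 g1
  have Gf : ∀ x y z, G b x y → G b x z → y = z := fun x y z h1 h2 => g3 x y z ((G2 _ _).2 h1) ((G2 _ _).2 h2)
  have Gc : G b x c := (G2 _ _).1 g2
  have hbc' : b < c := hbc.lt hc.1
  obtain ⟨p, hp, hpx, hpS⟩ : ∃ p ∈ dcl (insert b A), p < x ∧ ∀ z, p < z → z ≤ x → ∃ s', G b z s' ∧ b < s' ∧ s' < z := by
    rcases O1L (S := fun z => ∃ s', G b z s' ∧ b < s' ∧ s' < z) (DP.ex (((G1.mono (Set.subset_insert _ _)).bind3 DF.par0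
      (DF.var 1) (DF.var 0)).and ((DP.lt DF.par0 (DF.var 0)).and (DP.lt (DF.var 0) (DF.var 1)))))
      ⟨c, Gc, hbc', hc.lt hx.1⟩ hxb with h | h
    · exact h
    · obtain ⟨s, k1, k2, k3⟩ := h b (hb.lt hx.1).le
      exact (lt_asymm k2 k3).elim
  obtain ⟨H, H1, H2, H3⟩ := mem_dcl_insert hp
  obtain ⟨K, hKdef⟩ : ∃ K : M → M → M → Prop, ∀ b' x' s, K b' x' s ↔ ∃ h x'' s', H b' h ∧ h < x'' ∧ x'' ≤ x' ∧ G b' x'' s' ∧ s ≤ s' :=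
    ⟨_, fun _ _ _ => Iff.rfl⟩
  have KD : DP A (fun v => K (v 0) (v 1) (v 2)) := by
    refine DP.iff (DP.ex (DP.ex (DP.ex ((H1.bind2 (DF.var 3) (DF.var 2)).and ((DP.lt (DF.var 2) (DF.var 1)).and
      ((DP.le (DF.var 1) (DF.var 4)).and ((G1.bind3 (DF.var 3) (DF.var 1) (DF.var 0)).and
        (DP.le (DF.var 5) (DF.var 0))))))))) fun v => (hKdef _ _ _).symm
  have hxA : C ⊆ insert x A := hCA.trans (Set.subset_insert _ _)
  have hAx : (insert x A).Countable := hA.insert x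
  have F1 : ∀ e ∈ dcl (insert x A), d < e → ¬ K b x e := by
    intro e he hde hK
    obtain ⟨h, x2, s, k1, k2, k3, k4, k5⟩ := (hKdef _ _ _).1 hK
    obtain rfl := H3 _ _ _ k1 H2
    obtain ⟨s', l1, l2, l3⟩ := hpS x2 k2 k3
    obtain rfl := Gf _ _ _ k4 l1
    have hx2 : QQ {d} A x2 := hx.down (by simpa using hdb.trans (l2.trans l3)) k3
    have hes : ∀ v ∈ ({d} : Set M), v < e := by simpa using hde
    by_cases hb2 : QQ {d} (insert x2 A) b
    · have hT : T2 A x b x2 b := by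
        obtain ⟨b1, hb1⟩ := hom hA (hx.T1 hx2) b
        have h3 : QQ {d} (insert x2 A) b1 := QQ.of_T2 hsub hb1 hb
        intro S hS h4
        exact h3.T1 hb2 (S x2) ((hS.mono (Set.subset_insert _ _)).bind2 DF.par0 (DF.var 0)) (hb1 S hS h4)
      obtain ⟨c1, hc1⟩ := hom (hA.insert b) hT.toT1 c
      have h5 : G b x2 c1 := hc1 (fun x c => G b x c) ((G1.mono (Set.subset_insert _ _)).bind3 DF.par0 (DF.var 0) (DF.var 1)) Gc
      obtain rfl := Gf _ _ _ h5 k4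
      have h6 : QQ {d} (insert x2 A) c1 := QQ.of_T2 hsub (hc1.mono (Set.subset_insert _ _)) hc
      by_cases h7 : QQ {d} (insert x A) x2
      · exact lt_irrefl _ ((l3.trans (h7.2 e he hes)).trans_le k5)
      · have h8 : EE {d} A x2 x := ⟨h7, fun h' => k3.not_gt (h'.lt hx2.1)⟩
        exact k5.not_gt ((hV.lt_congr' hCA hA hx2 hx h6.of_ins h8 h6).2 e he hes)
    · have h8 : EE {d} A b x2 := ⟨hb2, fun h' => lt_asymm (h'.lt hb.1) (l2.trans l3)⟩
      have h9 := hV.lt_congr hCA hA hb.of_ins hx2 hx h8 hb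
      exact lt_irrefl _ ((l3.trans (h9.2 e he hes)).trans_le k5)
  obtain ⟨w, hw⟩ := hV.ex hAx
  obtain ⟨b', hb'⟩ := hV.ex (hAx.insert w)
  have KDx := KD.mono (Set.subset_insert x A)
  have F2 : ∀ e ∈ dcl (insert x A), d < e → ¬ K b' x e := fun e he hde =>
    hb.T1 hb'.of_ins (fun b => ¬ K b x e) ((KDx.bind3 (DF.var 0) DF.par0 (DF.cst he)).not) (F1 e he hde)
  have ht0A : t0 ∈ dcl A := dcl_mono hCA ht0
  have F3 : ¬ K b' x w := KL hV hxA hAx (hs _ hxA) (dcl_mono hxA ht0) hdt0 hw hb' (K := K b' x)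
    ((KDx.mono (Set.subset_insert _ _)).bind3 DF.par0 DF.par1 (DF.var 0)) F2
  have F4 := hb'.trd (S := fun y => ¬ K y x w)
    ((KDx.mono (Set.subset_insert _ _)).bind3 (DF.var 0) DF.par1 DF.par0).not F3
  obtain ⟨W, hW⟩ : ∃ W : M → M → Prop, ∀ x w, W x w ↔ ∃ u, d < u ∧ ∀ y, d < y → y ≤ u → ¬ K y x w :=
    ⟨_, fun _ _ => Iff.rfl⟩
  have KDw : DP A (fun v => W (v 0) (v 1)) :=
    DP.iff (DP.ex ((DP.lt (DF.cst hdA) (DF.var 0)).and (DP.all ((DP.lt (DF.cst hdA) (DF.var 0)).imp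
      ((DP.le (DF.var 0) (DF.var 1)).imp (KD.bind3 (DF.var 0) (DF.var 2) (DF.var 3)).not)))))
      fun v => (hW _ _).symm
  have F5 := hw.trd (S := fun w => W x w) ((KDw.mono (Set.subset_insert _ _)).bind2 DF.par0 (DF.var 0))
    ((hW _ _).2 ⟨b', hb'.1 d rfl, F4⟩)
  have F6 : ∀ w', d < w' → W x w' := by
    intro w' hw'
    rcases le_total w' w with h | h
    · exact F5 w' hw' h
    · obtain ⟨u, hu, h1⟩ := (hW _ _).1 (F5 w (hw.1 d rfl) le_rfl)
      refine (hW _ _).2 ⟨u, hu, fun y hy hyu hK => h1 y hy hyu ?_⟩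
      obtain ⟨h, x2, s, k1, k2, k3, k4, k5⟩ := (hKdef _ _ _).1 hK
      exact (hKdef _ _ _).2 ⟨h, x2, s, k1, k2, k3, k4, by order⟩
  obtain ⟨x0, hx0, hxx0, F7⟩ : ∃ x0 ∈ dcl A, x < x0 ∧ ∀ w', d < w' → W x0 w' := by
    rcases O1R (S := fun x => ∀ w', d < w' → W x w')
      (DP.all ((DP.lt (DF.cst hdA) (DF.var 0)).imp (KDw.bind2 (DF.var 1) (DF.var 0)))) F6 hx.not with ⟨q, hq, h1, h2⟩ | h2
    · obtain ⟨x0, h3, h4, h5⟩ := hs A hCA q hq ((hx.1 d rfl).trans h1)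
      have h6 := hx.2 x0 h3 (by simpa using h4)
      exact ⟨x0, h3, h6, h2 x0 h5 h6.le⟩
    · have h6 := hx.2 t0 ht0A (by simpa using hdt0)
      exact ⟨t0, ht0A, h6, h2 t0 h6.le⟩
  have F8 : ∀ e ∈ dcl A, d < e → ¬ K b x0 e := by
    intro e he hde hK
    have h1 := hb.of_ins.trd (S := fun y => K y x0 e) (KD.bind3 (DF.var 0) (DF.cst hx0) (DF.cst he)) hK
    obtain ⟨u, hu, h2⟩ := (hW _ _).1 (F7 e hde)
    exact h2 (min u b) (lt_min hu hdb) (min_le_left _ _) (h1 _ (lt_min hu hdb) (min_le_right _ _))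
  refine KL hV hCA hA (hs _ hCA) ht0A hdt0 hc.of_ins hbc (K := K b x0)
    ((KD.mono (Set.subset_insert _ _)).bind3 DF.par0 (DF.cst (dcl_mono (Set.subset_insert _ _) hx0)) (DF.var 0)) F8 ?_
  exact (hKdef _ _ _).2 ⟨p, x, c, H2, hpx, hxx0.le, Gc, le_rfl⟩

theorem caseA1 (h : ¬ NC M) : 2 ^ aleph0.{0} ≤ #(Quotient (isoS M)) := by
  unfold NC at h
  push Not at h
  obtain ⟨A, d, t, t', hA, hd, ht, ht', hdc, hne⟩ := h
  wlog hlt : t < t' generalizing t t'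
  · exact this t' t ht' ht (exch hdc ht'.not) hne.symm (lt_of_le_of_ne (not_lt.1 hlt) hne.symm)
  have hV0 : VOK {d} A := vok_of hA.countable hd ht
  have hV : VOK {d} (insert t' A) := vok_mono hV0 (Set.subset_insert _ _) (hA.insert t').countable
  have hdt := ht.1 d rfl
  have hdt' := ht'.1 d rfl
  have htd : t ∈ dcl (insert t' A) := exch hdc ht'.not
  have hs : ∀ B, insert t' A ⊆ B → Star d B := by
    intro B hB e he hde
    have hAB : A ⊆ dcl B := (Set.subset_insert _ _).trans (hB.trans sub_dcl)
    rcases le_or_gt t' e with h1 | h1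
    · exact ⟨t, dcl_mono hB htd, hdt, hlt.trans_le h1⟩
    · have heQ : QQ {d} A e := ht'.down (by simpa using hde) h1.le
      obtain ⟨e', he'⟩ := hom hA.countable (ht'.T1 heQ) t
      exact ⟨e', dcl_sub (Set.insert_subset he hAB) (he'.dcl htd), (ht.of_T1 (by simpa using hd) he'.snd).1 d rfl,
        he'.swap (fun x y => x < y) (DP.lt (DF.var 0) (DF.var 1)) hlt⟩
  refine hV.mainA (hA.insert t') (clA1 hV (hA.insert t') hs (sub_dcl (by simp)) hdt') (fun z hz => ?_) fun z hz => ?_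
  · obtain ⟨z', hz'⟩ := hom hA.countable (ht.T1 hz.of_ins) t'
    have h1 := hz'.dcl hdc
    exact ⟨z', dcl_mono (Set.insert_subset_insert (Set.subset_insert _ _)) h1,
      hV0.dclosed subset_rfl (Set.subset_insert _ _) hA.countable hz h1 (ht'.of_T1 (by simpa using hd) hz'.snd),
      hz' (fun x y => x < y) (DP.lt (DF.var 0) (DF.var 1)) hlt⟩
  · obtain ⟨z', hz'⟩ := hom hA.countable (ht'.T1 hz.of_ins) t
    have h1 := hz'.dcl htd
    exact ⟨z', dcl_mono (Set.insert_subset_insert (Set.subset_insert _ _)) h1,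
      hV0.dclosed subset_rfl (Set.subset_insert _ _) hA.countable hz h1 (ht.of_T1 (by simpa using hd) hz'.snd),
      hz'.swap (fun x y => x < y) (DP.lt (DF.var 0) (DF.var 1)) hlt⟩

end QOM

namespace QOM
open OM Cardinal
variable {M : Type} [OM M] {A B V C : Set M}

theorem vok_nd (hN : ND M) {z : M} (hz : z ∉ dcl (∅ : Set M)) (hzB : z ∈ dcl B) (hB : B.Countable) : VOK {z} B where
  ne := Set.singleton_nonempty z
  sub := by simpa using hzB
  ctb := hB
  top := by
    rintro v rfl
    by_contra hcon
    push Not at hcon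
    exact hz (dcl_of1 (S := fun z => ∀ y, y ≤ z) (DP.all (DP.le (DF.var 0) (DF.var 1))) fun y =>
      ⟨fun h => le_antisymm (hcon y) (h v), fun h => h ▸ hcon⟩)
  dense := by
    rintro v rfl e he
    by_contra hcon
    push Not at hcon
    exact hN v hz ⟨e, he v rfl, fun c h1 h2 => (hcon c h1).not_gt h2⟩

theorem btw (hN : ND M) {u w : M} (hu : u ∉ dcl (∅ : Set M)) (hB : B.Countable) (huB : u ∈ dcl B) (hwB : w ∈ dcl B) (h : u < w) :
    ∃ w1, w1 ∉ dcl B ∧ u < w1 ∧ w1 < w := by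
  obtain ⟨z, hz⟩ := (vok_nd hN hu huB hB).ex hB
  exact ⟨z, hz.not, hz.1 u rfl, hz.2 w hwB (by simpa using h)⟩

theorem cont_core {y t u u' w w1 : M} {θ R : M → M → Prop} (hAB : A ⊆ dcl B) (hy : y ∈ dcl B) (hyA : y ∉ dcl A)
    (hθ : DP A (fun v => θ (v 0) (v 1))) (f1 : ∀ x y z, θ x y → θ x z → y = z) (hyu : θ y u)
    (htB : t ∉ dcl B) (hyt : y < t) (hn : ∀ e ∈ dcl B, y < e → ¬ e < t) (htu : θ t u')
    (hR : DP ∅ (fun v => R (v 0) (v 1))) (hw : w ∈ dcl B) (hw1 : w1 ∉ dcl B) (h1 : R u w1)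
    (h2 : ∀ z, R z w1 → R z w) (h3 : ¬ R u' w) : False := by
  have hyw : y ∉ dcl (insert w1 A) := fun h => hw1 (dcl_sub (Set.insert_subset hy hAB) (exch h hyA))
  obtain ⟨d, hd, hS⟩ := nbR (S := fun z => ∃ z', θ z z' ∧ R z' w1) (DP.ex (((hθ.mono (Set.subset_insert _ _)).bind2
    (DF.var 1) (DF.var 0)).and ((hR.mono (Set.empty_subset _)).bind2 (DF.var 0) DF.par0))) ⟨u, hyu, h1⟩ hyw
  have hdp : DP B (fun v => ¬ ∀ z, y ≤ z → z ≤ v 0 → ∃ z', θ z z' ∧ R z' w) :=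
    (DP.all ((DP.le (DF.cst hy) (DF.var 0)).imp ((DP.le (DF.var 0) (DF.var 1)).imp
      (DP.ex (((hθ.of_dcl hAB).bind2 (DF.var 1) (DF.var 0)).and ((hR.mono (Set.empty_subset _)).bind2 (DF.var 0) (DF.cst hw))))))).not
  have hSt : ¬ ∀ z, y ≤ z → z ≤ t → ∃ z', θ z z' ∧ R z' w := fun h => by
    obtain ⟨z', k1, k2⟩ := h t hyt.le le_rfl
    exact h3 (f1 _ _ _ k1 htu ▸ k2)
  have key : ∀ z, y < z → z ≤ t → ¬ ∀ z', y ≤ z' → z' ≤ z → ∃ w', θ z' w' ∧ R w' w := by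
    rcases O1L (S := fun z0 => ¬ ∀ z, y ≤ z → z ≤ z0 → ∃ z', θ z z' ∧ R z' w) hdp hSt htB with ⟨p, hp, hpt, hh⟩ | hh
    · have : p ≤ y := not_lt.1 fun h' => hn p hp h' hpt
      exact fun z hz => hh z (this.trans_lt hz)
    · exact fun z _ => hh z
  refine key (min d t) (lt_min hd hyt) (min_le_right _ _) fun z hz hz' => ?_
  obtain ⟨z', k1, k2⟩ := hS z (hz'.trans (min_le_left _ _)) hz
  exact ⟨z', k1, h2 _ k2⟩

def NR (B : Set M) (y t : M) : Prop := t ∉ dcl B ∧ ∀ e ∈ dcl B, ¬ (y < e ∧ e < t) ∧ ¬ (t < e ∧ e < y)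

theorem NR.T1 {y t : M} (h : NR B y t) (hAB : A ⊆ dcl B) (hy : y ∉ dcl A) : T1 A y t := by
  have hdd := dcl_sub hAB
  refine cut_T1 hy (fun h' => h.1 (hdd h')) fun e he => ?_
  have h1 : e ≠ y := by rintro rfl; exact hy he
  have h2 : e ≠ t := by rintro rfl; exact h.1 (hdd he)
  have h3 := h.2 e (hdd he)
  constructor
  · intro h4; by_contra h5; exact h3.2 ⟨lt_of_le_of_ne (not_lt.1 h5) h2.symm, h4⟩
  · intro h4; by_contra h5; exact h3.1 ⟨lt_of_le_of_ne (not_lt.1 h5) h1.symm, h4⟩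

theorem cont (hN : ND M) (hN' : @ND M (OM.dual M)) {y t u : M} {θ : M → M → Prop} (hB : B.Countable)
    (hAB : A ⊆ dcl B) (hy : y ∈ dcl B) (hyA : y ∉ dcl A)
    (hθ : DP A (fun v => θ (v 0) (v 1))) (f1 : ∀ x y z, θ x y → θ x z → y = z) (f2 : ∀ x y z, θ x z → θ y z → x = y)
    (hyu : θ y u) (hu : u ∉ dcl A) (h : NR B y t) : ∃ u', θ t u' ∧ NR B u u' := by
  obtain ⟨u', hu'⟩ := h.T1 hAB hyA (fun z => ∃ u, θ z u) (DP.ex (hθ.bind2 (DF.var 1) (DF.var 0))) ⟨u, hyu⟩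
  have hu0 : u ∉ dcl (∅ : Set M) := fun h' => hu (dcl_mono (Set.empty_subset _) h')
  have huB : u ∈ dcl B := dcl_sub (Set.insert_subset hy hAB) (dcl_of hθ f1 hyu)
  have huB' : u' ∉ dcl B := fun h' => h.1 (dcl_sub (Set.insert_subset h' hAB) (dcl_of (θ := fun x y => θ y x)
    (hθ.bind2 (DF.var 1) (DF.var 0)) (fun x y z k1 k2 => f2 _ _ _ k1 k2) hu'))
  have hty : y ≠ t := by rintro rfl; exact h.1 hy
  have main : ∀ (R : M → M → Prop) (w w1 : M), DP ∅ (fun v => R (v 0) (v 1)) → w ∈ dcl B → w1 ∉ dcl B → R u w1 →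
      (∀ z, R z w1 → R z w) → ¬ R u' w → False := by
    intro R w w1 hR hw hw1 k1 k2 k3
    rcases hty.lt_or_gt with hlt | hlt
    · exact cont_core hAB hy hyA hθ f1 hyu h.1 hlt (fun e he k k' => (h.2 e he).1 ⟨k, k'⟩) hu' hR hw hw1 k1 k2 k3
    · exact @cont_core M (OM.dual M) A B y t u u' w w1 θ R hAB hy hyA hθ f1 hyu h.1 hlt (fun e he k k' => (h.2 e he).2 ⟨k', k⟩) hu' hR hw hw1 k1 k2 k3
  refine ⟨u', hu', huB', fun w hw => ⟨fun k => ?_, fun k => ?_⟩⟩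
  · obtain ⟨w1, l1, l2, l3⟩ := btw hN hu0 hB huB hw k.1
    exact main (· < ·) w w1 DP.lt0 hw l1 l2 (fun z hz => hz.trans l3) k.2.not_gt
  · obtain ⟨w1, l1, l2, l3⟩ := @btw M (OM.dual M) B hN' u w hu0 hB huB hw k.2
    exact main (fun x y => y < x) w w1 (DP.lt (DF.var 1) (DF.var 0)) hw l1 l2 (fun z hz => lt_trans l3 hz) (lt_asymm k.1)

theorem NC.QQ (hNC : NC M) {d x y : M} (hA : A.Finite) (hd : d ∈ dcl A) (hx : QQ {d} A x) (hy : QQ {d} A y) (h : x < y) :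
    QQ {d} (insert y A) x := by
  refine ⟨hx.1, fun e he hde => ?_⟩
  by_contra hcon
  have := hNC A d y e hA hd hy (hx.down hde (not_lt.1 hcon)) he
  exact hcon (this ▸ h)

theorem mem_dcl_insert2 {a a' b : M} (h : b ∈ dcl (insert a (insert a' A))) : ∃ F : M → M → M → Prop,
    DP A (fun v => F (v 0) (v 1) (v 2)) ∧ F a' a b ∧ ∀ x y b b', F x y b → F x y b' → b = b' := by
  obtain ⟨ψ, h1, h2, h3⟩ := mem_dcl_insert h
  obtain ⟨F, F1, F2⟩ := extr2 h1
  refine ⟨fun x y b => F x y b ∧ ∀ b', F x y b' → b' = b, ?_, ⟨(F2 _ _).1 h2, fun b' hb' => h3 _ _ _ ((F2 _ _).2 hb') h2⟩, ?_⟩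
  · exact F1.and (DP.all ((F1.bind3 (DF.var 1) (DF.var 2) (DF.var 0)).imp (DP.eq (DF.var 0) (DF.var 3))))
  · exact fun x y b b' h h' => h'.2 _ h.1

theorem dcl_of3 {a a' b : M} {F : M → M → M → Prop} (h : DP A (fun v => F (v 0) (v 1) (v 2)))
    (hf : ∀ x y b b', F x y b → F x y b' → b = b') (hF : F a' a b) : b ∈ dcl (insert a (insert a' A)) :=
  dcl_of ((h.mono (Set.subset_insert _ _)).bind3 DF.par0 (DF.var 0) (DF.var 1)) (fun x y z => hf a' x y z) hF

theorem QQ.NR {z t : M} (h : QQ {z} B t) : NR B z t :=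
  ⟨h.not, fun e he => ⟨fun k => lt_asymm k.2 (h.2 e he (by simpa using k.1)), fun k => lt_asymm (h.1 z rfl) (k.1.trans k.2)⟩⟩

theorem ins2 {a b : M} {D : Set M} (ha : a ∈ dcl D) (hb : b ∈ dcl D) (hC : C ⊆ dcl D) : dcl (insert a (insert b C)) ⊆ dcl D :=
  dcl_sub (Set.insert_subset ha (Set.insert_subset hb hC))

theorem triv2 (hN : ND M) (hN' : @ND M (OM.dual M)) (hNC : NC M) (hC : C.Finite) {z b1 b2 : M}
    (hz : z ∈ dcl (insert b1 (insert b2 C))) : z ∈ dcl (insert b1 C) ∨ z ∈ dcl (insert b2 C) := by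
  by_contra hcon
  push Not at hcon
  obtain ⟨hz1, hz2⟩ := hcon
  have hz0 : z ∉ dcl C := fun h => hz1 (dcl_mono (Set.subset_insert _ _) h)
  have hz00 : z ∉ dcl (∅ : Set M) := fun h => hz0 (dcl_mono (Set.empty_subset _) h)
  have hzc : z ∈ dcl (insert b2 (insert b1 C)) := by rwa [Set.insert_comm] at hz
  have hb1 : b1 ∉ dcl (insert b2 C) := fun h => hz2 (dcl_ins_sub h hz)
  have hb2 : b2 ∉ dcl (insert b1 C) := fun h => hz1 (dcl_ins_sub h hzc)
  have hb20 : b2 ∉ dcl C := fun h => hb2 (dcl_mono (Set.subset_insert _ _) h)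
  have hb1z : b1 ∈ dcl (insert z (insert b2 C)) := exch hz hz2
  have hb2z : b2 ∈ dcl (insert z (insert b1 C)) := exch hzc hz1
  obtain ⟨C', hC'⟩ : ∃ C', C' = insert b1 (insert b2 C) := ⟨_, rfl⟩
  rw [← hC'] at hz
  have hC'f : C'.Finite := by rw [hC']; exact (hC.insert b2).insert b1
  have hb1C' : b1 ∈ C' := by simp [hC']
  have hb2C' : b2 ∈ C' := by simp [hC']
  have hCC' : C ⊆ C' := by rw [hC']; exact (Set.subset_insert _ _).trans (Set.subset_insert _ _)
  have hV := vok_nd hN hz00 hz hC'f.countable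
  obtain ⟨t1, ht1⟩ := hV.ex hC'f.countable
  have hb2C : insert b2 C ⊆ dcl C' := (Set.insert_subset hb2C' hCC').trans sub_dcl
  have hb1C : insert b1 C ⊆ dcl C' := (Set.insert_subset hb1C' hCC').trans sub_dcl
  obtain ⟨b1', hT1⟩ := hom (hC.insert b2).countable (ht1.NR.T1 hb2C hz2) b1
  obtain ⟨B, hB⟩ : ∃ B, B = insert t1 C' := ⟨_, rfl⟩
  have hBf : B.Finite := by rw [hB]; exact hC'f.insert t1
  have hC'B : C' ⊆ B := by rw [hB]; exact Set.subset_insert _ _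
  have ht1B : t1 ∈ B := by simp [hB]
  obtain ⟨t2, ht2⟩ := hV.ex hBf.countable
  have hzB : z ∈ dcl B := dcl_mono hC'B hz
  have hdd : dcl C' ⊆ dcl B := dcl_mono hC'B
  obtain ⟨b2', hT2⟩ := hom (hC.insert b1).countable (ht2.NR.T1 (hb1C.trans hdd) hz1) b2
  obtain ⟨F, F1, F2, F3⟩ := mem_dcl_insert2 hb1z
  have FT1 : F b2 t1 b1' := hT1 (fun z b1 => F b2 z b1) ((F1.mono (Set.subset_insert _ _)).bind3 DF.par0 (DF.var 0) (DF.var 1)) F2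
  have FT2 : F b2' t2 b1 := hT2 (fun z b2 => F b2 z b1) ((F1.mono (Set.subset_insert _ _)).bind3 (DF.var 1) (DF.var 0) DF.par0) F2
  have hb2B : b2 ∈ dcl B := sub_dcl (hC'B hb2C')
  have hCB : C ⊆ dcl B := (hCC'.trans hC'B).trans sub_dcl
  have hb1B : b1' ∈ dcl B := ins2 (sub_dcl ht1B) hb2B hCB (dcl_of3 F1 F3 FT1)
  -- first use of continuity
  have hNR1 : NR B b2 b2' := by
    obtain ⟨θ, h1, h2, h3, h4⟩ := mem_dcl_bi hb2z hb2
    obtain ⟨u', h5, h6⟩ := cont hN hN' hBf.countable (hb1C.trans hdd) hzB hz1 h1 h3 h4 h2 hb2 ht2.NR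
    rwa [h3 _ _ _ (hT2 θ h1 h2) h5]
  -- second use
  have hb12 : b1' ∉ dcl (insert b2 C) := hT1.snd.ndcl hb1
  have hb21 : b2 ∉ dcl (insert b1' C) := fun h => hb12 (exch h hb20)
  have ht11 : t1 ∉ dcl (insert b1' C) := fun h => hz1 ((hT1.mono (Set.subset_insert _ _)).swap.symm.dcl h)
  have ht12 : t1 ∈ dcl (insert b2 (insert b1' C)) := by
    rw [Set.insert_comm]; exact hT1.swap.dcl (by rw [hC'] at hz; exact hz)
  obtain ⟨c, hθc, Fc, hNR2⟩ : ∃ c, c ∈ dcl (insert b2' (insert b1' C)) ∧ F b2' c b1' ∧ NR B t1 c := by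
    obtain ⟨θ, h1, h2, h3, h4⟩ := mem_dcl_bi ht12 ht11
    obtain ⟨u', h5, h6⟩ := cont hN hN' (θ := fun x y => θ x y ∧ F x y b1') hBf.countable (Set.insert_subset hb1B hCB) hb2B hb21
      (h1.and ((F1.mono (Set.subset_insert _ _)).bind3 (DF.var 0) (DF.var 1) DF.par0)) (fun x y z k k' => h3 _ _ _ k.1 k'.1)
      (fun x y z k k' => h4 _ _ _ k.1 k'.1) ⟨h2, FT1⟩ ht11 hNR1
    exact ⟨u', dcl_of h1 h3 h5.1, h5.2, h6⟩
  have hzt1 : z < t1 := ht1.1 z rfl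
  have hct : c ≠ t1 := by rintro rfl; exact hNR2.1 (sub_dcl ht1B)
  have hcz : c ≠ z := by rintro rfl; exact hNR2.1 hzB
  have hzc' : z < c := by
    by_contra h
    exact (hNR2.2 z hzB).2 ⟨lt_of_le_of_ne (not_lt.1 h) hcz, hzt1⟩
  have ht2B := ht2
  rw [hB] at ht2
  have ht21 : t2 < t1 := ht2.lt ht1.1
  have hb1'c : b1' ∈ dcl (insert c (insert b2' C)) := dcl_of3 F1 F3 Fc
  rcases hct.lt_or_gt with hlt | hlt
  · have hcQ : QQ {z} B c := by
      refine ⟨by simpa using hzc', fun e he hze => ?_⟩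
      by_contra hcon
      have h1 : e < t1 := (not_lt.1 hcon).trans_lt hlt
      rw [hB] at he
      exact h1.ne (hNC C' z t1 e hC'f hz ht1 (ht1.down hze h1.le) he).symm
    have hcc : c ∈ dcl (insert t2 B) := by
      have e0 : dcl B ⊆ dcl (insert t2 B) := dcl_mono (Set.subset_insert _ _)
      refine ins2 ?_ (e0 hb1B) (hCB.trans e0) hθc
      refine ins2 (sub_dcl (by simp)) (e0 (hdd (sub_dcl hb1C'))) (hCB.trans e0) (hT2.dcl hb2z)
    have := hNC B z t2 c hBf hzB ht2B hcQ hcc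
    rw [← this] at Fc
    have h1 : b1' = b1 := F3 _ _ _ _ Fc FT2
    rw [h1] at hT1
    have h3 := hT1.toT1.dcl (hC' ▸ hz)
    exact hzt1.ne h3
  · have hcQ : QQ {z} C' c := by
      refine ⟨by simpa using hzc', fun e he hze => ?_⟩
      by_contra hcon
      have h1 : e ≠ c := by rintro rfl; exact hNR2.1 (hdd he)
      exact (hNR2.2 e (hdd he)).1 ⟨ht1.2 e he hze, lt_of_le_of_ne (not_lt.1 hcon) h1⟩
    have q1 := hNC.QQ hC'f hz ht1 hcQ hlt
    have q2 := hNC.QQ hC'f hz ht2.of_ins hcQ (ht21.trans hlt)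
    have e0 : dcl C' ⊆ dcl (insert t2 (insert c C')) := dcl_mono ((Set.subset_insert _ _).trans (Set.subset_insert _ _))
    have hCe : C ⊆ dcl (insert t2 (insert c C')) := (hCC'.trans sub_dcl).trans e0
    have m1 : b2' ∈ dcl (insert t2 (insert c C')) := ins2 (sub_dcl (by simp)) (e0 (sub_dcl hb1C')) hCe (hT2.dcl hb2z)
    have m2 : b1' ∈ dcl (insert t2 (insert c C')) := ins2 (sub_dcl (by simp)) m1 hCe hb1'c
    have m3 : t1 ∈ dcl (insert t2 (insert c C')) := ins2 (e0 (sub_dcl hb2C')) m2 hCe ht12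
    exact ht21.ne (hNC (insert c C') z t2 t1 (hC'f.insert c) (dcl_mono (Set.subset_insert _ _) hz) q2 q1 m3)

def TRIV (M : Type) [OM M] : Prop := ∀ (C : Set M) (z b1 b2 : M), C.Finite → z ∈ dcl (insert b1 (insert b2 C)) →
  z ∈ dcl (insert b1 C) ∨ z ∈ dcl (insert b2 C)

theorem TRIV.fin (h : TRIV M) (F : Finset M) : ∀ (C : Set M) z, C.Finite → z ∈ dcl (↑F ∪ C) → z ∈ dcl C ∨ ∃ b ∈ F, z ∈ dcl (insert b C) := by
  classical
  induction F using Finset.induction_on with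
  | empty => intro C z _ hz; left; simpa using hz
  | insert a F _ ih =>
    intro C z hC hz
    rcases ih (insert a C) z (hC.insert a) (by simpa [Set.insert_union, Set.union_insert] using hz) with h1 | ⟨b, hb, h1⟩
    · exact Or.inr ⟨a, by simp, h1⟩
    · rcases h C z b a hC h1 with h2 | h2
      · exact Or.inr ⟨b, by simp [hb], h2⟩
      · exact Or.inr ⟨a, by simp, h2⟩

theorem TRIV.gen (h : TRIV M) {z : M} (hz : z ∈ dcl B) : z ∈ dcl (∅ : Set M) ∨ ∃ b ∈ B, z ∈ dcl (insert b ∅) := by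
  obtain ⟨F, h1, h2⟩ := dcl_fin hz
  rcases h.fin F ∅ z (by simp) (by simpa using h2) with h3 | ⟨b, hb, h3⟩
  · exact Or.inl h3
  · exact Or.inr ⟨b, h1 hb, h3⟩

def S0 (M : Type) [OM M] : Prop := ∀ x y : M, x ∉ dcl (∅ : Set M) → T1 ∅ x y → y ∈ dcl (insert x ∅) → x = y

theorem caseA2 (hT : TRIV M) (h : ¬ S0 M) : 2 ^ aleph0.{0} ≤ #(Quotient (isoS M)) := by
  unfold S0 at h
  push Not at h
  obtain ⟨x, y, hx, hxy, hd, hne⟩ := h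
  wlog hlt : x < y generalizing x y
  · exact this y x (hxy.ndcl hx) hxy.symm (exch hd (hxy.ndcl hx)) hne.symm (lt_of_le_of_ne (not_lt.1 hlt) hne.symm)
  obtain ⟨a, θ, h1, h2, h3⟩ := SQ.exists hx hxy hd hlt (R := fun _ _ => True) (DP.triv _) trivial
  refine h1.mainA fun A x b c hCA hAf hx hb hc hcb hbc => ?_
  rcases hT A c b x hAf hcb with h | h
  · exact hbc.not (exch h hc.of_ins.not)
  · exact hc.not h

end QOM

namespace QOM
open OM Cardinal
variable {M : Type} [OM M] {A B V C : Set M}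

theorem sep {x z : M} (h : x < z) (hx : x ∉ dcl (∅ : Set M)) (hz : z ∉ dcl (∅ : Set M))
    (hT : ¬ T1 ∅ x z) : ∃ f ∈ dcl (∅ : Set M), x < f ∧ f < z := by
  by_contra hcon
  push Not at hcon
  refine hT (cut_T1 hx hz fun e he => ⟨fun h' => h'.trans h, fun h' => ?_⟩)
  by_contra h''
  have h3 : x < e := lt_of_le_of_ne (not_lt.1 h'') (fun hh => hx (hh ▸ he))
  exact absurd h' (not_lt.2 (hcon e he h3))

theorem convT {a z b : M} (h1 : a < z) (h2 : z < b) (h : T1 ∅ a b) (ha : a ∉ dcl (∅ : Set M)) :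
    T1 ∅ a z := by
  have hz : z ∉ dcl (∅ : Set M) := fun hz => absurd ((h.lt hz).2 h2) (not_lt.2 h1.le)
  by_contra hT
  obtain ⟨f, hf, h3, h4⟩ := sep h1 ha hz hT
  exact absurd ((h.lt hf).2 (h4.trans h2)) (not_lt.2 h3.le)

theorem pair (hS : S0 M) {y y' z z' : M} (hy : y ∉ dcl (∅ : Set M)) (h1 : T1 ∅ y y') (h2 : T1 ∅ y z)
    (h3 : T1 ∅ y z') (h : y < y') (h' : z < z') : T2 ∅ y y' z z' := by
  obtain ⟨w, hw⟩ := hom Set.countable_empty h2 y'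
  have hzw : z < w := hw (· < ·) DP.lt0 h
  have hz := h2.ndcl hy
  have hT : T1 (insert z ∅) w z' := by
    have hzw' : T1 ∅ z w := (h2.symm.trans h1).trans hw.snd
    have hzz' : T1 ∅ z z' := (h2.symm.trans h3)
    refine cut_T1 (fun hh => hzw.ne (hS z w hz hzw' hh)) (fun hh => h'.ne (hS z z' hz hzz' hh)) ?_
    intro e he
    by_cases heE : e ∈ dcl (∅ : Set M)
    · exact (hzw'.symm.trans hzz').lt heE
    · by_cases heT : T1 ∅ z e
      · have := hS z e hz heT he
        subst this
        simp [hzw, h']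
      · rcases lt_trichotomy z e with hlt | heq | hgt
        · obtain ⟨f, hf, h4, h5⟩ := sep hlt hz heE heT
          refine iff_of_false (fun h6 => ?_) (fun h6 => ?_)
          · exact absurd ((hzw'.lt hf).2 (h5.trans h6)) (not_lt.2 h4.le)
          · exact absurd ((hzz'.lt hf).2 (h5.trans h6)) (not_lt.2 h4.le)
        · exact (heT (heq ▸ T1.refl _)).elim
        · exact iff_of_true (hgt.trans hzw) (hgt.trans h')
  intro S hS hyy
  have h4 := hw S hS hyy
  exact hT (fun x => S z x) ((hS.mono (Set.empty_subset _)).bind2 DF.par0 (DF.var 0)) h4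

theorem T2.func {x y z : M} (h : T2 A x y x z) (hy : y ∈ QOM.dcl (insert x A)) : y = z := by
  obtain ⟨θ, h1, h2, h3⟩ := mem_dcl_insert hy
  exact h3 x y z h2 (h θ h1 h2)

theorem T2.comb {r a e r' a' e' : M} (h : T2 A r a r' a') (h' : T2 A r e r' e')
    (ha : a ∈ QOM.dcl (insert r A)) : T2 A a e a' e' := by
  obtain ⟨θ, h1, h2, h3⟩ := mem_dcl_insert ha
  intro S hS hae
  obtain ⟨a1, h4, h5⟩ := h' (fun x y => ∃ z, θ x z ∧ S z y)
    (DP.ex ((h1.bind2 (DF.var 1) (DF.var 0)).and (hS.bind2 (DF.var 0) (DF.var 2)))) ⟨a, h2, hae⟩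
  have := h3 r' a1 a' h4 (h θ h1 h2)
  exact this ▸ h5

theorem T2.diag {x y : M} (h : T1 A x y) : T2 A x x y y := fun S hS hx =>
  h (fun z => S z z) (hS.bind2 (DF.var 0) (DF.var 0)) hx

def Dep (n : ℕ) (P : (ℕ → M) → Prop) : Prop := ∀ v w : ℕ → M, (∀ i < n, v i = w i) → P v → P w

theorem DP.upd {P : (ℕ → M) → Prop} (h : DP A P) {c : M} (hc : c ∈ A) (j : ℕ) :
    DP A (fun v => P (Function.update v j c)) := by
  refine DP.iff (DP.ex (Q := fun v y => c = y ∧ P (Function.update v j y)) ?_) fun v => by simp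
  refine DP.and (DF.par hc) ?_
  refine DP.iff (DP.ren (fun i => if i = j then 0 else i + 1) h) fun v => ?_
  have : (fun i => v (if i = j then 0 else i + 1)) = Function.update (fun i => v (i+1)) j (v 0) := by
    funext i
    by_cases hi : i = j
    · subst hi; simp
    · simp [hi]
  rw [this]

theorem cons_tail (v : ℕ → M) : cons (v 0) (fun i => v (i+1)) = v := by
  funext i; cases i <;> rfl

theorem DP.sub {P : (ℕ → M) → Prop} (h : DP ∅ P) {n : ℕ} (hn : Dep (n+1) P) (u : ℕ → M) :
    DP {a | ∃ i < n, u i = a} (fun v => P (cons (v 0) u)) := by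
  have key : ∀ m ≤ n, DP {a | ∃ i < n, u i = a}
      (fun v => P (fun i => if 1 ≤ i ∧ i ≤ m then u (i-1) else v i)) := by
    intro m
    induction m with
    | zero =>
      intro _
      refine DP.iff (h.mono (Set.empty_subset _)) fun v => ?_
      have : (fun i => if 1 ≤ i ∧ i ≤ 0 then u (i-1) else v i) = v := by
        funext i
        rw [if_neg]; omega
      rw [this]
    | succ m ih =>
      intro hm
      refine DP.iff (DP.upd (ih (by omega)) (c := u m) ⟨m, by omega, rfl⟩ (m+1)) fun v => ?_
      have : (fun i => if 1 ≤ i ∧ i ≤ m then u (i-1) else Function.update v (m+1) (u m) i) =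
          (fun i => if 1 ≤ i ∧ i ≤ m + 1 then u (i-1) else v i) := by
        funext i
        by_cases h1 : 1 ≤ i ∧ i ≤ m
        · rw [if_pos h1, if_pos ⟨h1.1, by omega⟩]
        · rw [if_neg h1]
          by_cases h2 : i = m + 1
          · subst h2; simp
          · rw [Function.update_of_ne h2, if_neg (by omega)]
      rw [this]
  refine DP.iff (key n le_rfl) fun v => ?_
  have : ∀ i < n + 1, (if 1 ≤ i ∧ i ≤ n then u (i-1) else v i) = cons (v 0) u i := by
    intro i hi
    rcases i with _ | i
    · simp [cons]
    · rw [if_pos (by omega)]; rfl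
  exact ⟨hn _ _ this, hn _ _ fun i hi => (this i hi).symm⟩

theorem iso_crit (hT : TRIV M) {N N' : Set M} (hN : dcl N = N) {σ : M → M} (hb : Set.BijOn σ N N')
    (h2 : ∀ a ∈ N, ∀ e ∈ N, e ∈ dcl (insert a ∅) → T2 ∅ a e (σ a) (σ e))
    (h3 : ∀ y ∈ N, ∀ y' ∈ N, y ∉ dcl (∅ : Set M) → T1 ∅ y y' → y < y' → σ y < σ y') :
    IsIso σ N N' := by
  have hT1 : ∀ x ∈ N, T1 ∅ x (σ x) := fun x hx => (h2 x hx x hx (sub_dcl (by simp))).fst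
  have hE : ∀ x ∈ N, x ∈ dcl (∅ : Set M) → σ x = x := fun x hx hxE => ((hT1 x hx).dcl hxE).symm
  have hmono : ∀ x ∈ N, ∀ y ∈ N, x < y → σ x < σ y := by
    intro x hx y hy hxy
    by_cases hxE : x ∈ dcl (∅ : Set M)
    · rw [hE x hx hxE]; exact ((hT1 y hy).lt hxE).1 hxy
    by_cases hyE : y ∈ dcl (∅ : Set M)
    · rw [hE y hy hyE]
      exact hT1 x hx (fun z => z < y) (DP.lt (DF.var 0) (DF.cst hyE)) hxy
    by_cases hxy' : T1 ∅ x y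
    · exact h3 x hx y hy hxE hxy' hxy
    obtain ⟨f, hf, h4, h5⟩ := sep hxy hxE hyE hxy'
    exact lt_trans (hT1 x hx (fun z => z < f) (DP.lt (DF.var 0) (DF.cst hf)) h4)
      (((hT1 y hy).lt hf).1 h5)
  have main : ∀ n, ∀ P : (ℕ → M) → Prop, DP ∅ P → Dep n P → ∀ v, (∀ i, v i ∈ N) → P v →
      P (fun i => σ (v i)) := by
    intro n
    induction n with
    | zero => intro P _ hd v _ hP; exact hd v _ (by simp) hP
    | succ n ih =>
      intro P hP hd v hv hPv
      set b := v 0 with hbdef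
      set u : ℕ → M := fun i => v (i+1) with hudef
      have hu : ∀ i, u i ∈ N := fun i => hv _
      have hvb : cons b u = v := cons_tail v
      have hsb : cons (σ b) (fun i => σ (u i)) = fun i => σ (v i) := cons_tail (fun i => σ (v i))
      rw [← hvb] at hPv
      rw [← hsb]
      set Au : Set M := {a | ∃ i < n, u i = a} with hAu
      have hAN : Au ⊆ N := by rintro a ⟨i, -, rfl⟩; exact hu i
      have hdN : ∀ p ∈ dcl Au, p ∈ N := fun p hp => hN ▸ dcl_mono hAN hp
      have par : ∀ p ∈ dcl Au, ∃ R : (ℕ → M) → Prop, DP ∅ R ∧ Dep (n+1) R ∧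
          (∀ y z w, R (cons y w) → R (cons z w) → y = z) ∧ R (cons p u) ∧
          R (cons (σ p) (fun i => σ (u i))) := by
        intro p hp
        rcases hT.gen hp with hpE | ⟨_, ⟨i, hi, rfl⟩, hpi⟩
        · refine ⟨fun v => v 0 = p, hpE, ?_, ?_, rfl, hE p (hdN p hp) hpE⟩
          · intro v w hvw hh
            rw [← hvw 0 (by omega)]; exact hh
          · intro y z w h1 h2
            exact h1.trans h2.symm
        · obtain ⟨θ, g1, g2, g3⟩ := mem_dcl_insert hpi
          refine ⟨fun v => θ (v (i+1)) (v 0), g1.bind2 (DF.var _) (DF.var _), ?_, ?_, g2,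
            h2 _ (hu i) _ (hdN p hp) hpi θ g1 g2⟩
          · intro v w hvw hh
            rw [← hvw 0 (by omega), ← hvw (i+1) (by omega)]; exact hh
          · intro y z w k1 k2
            exact g3 _ _ _ k1 k2
      have dcons : ∀ {Q : (ℕ → M) → Prop}, Dep (n+1) Q → ∀ y (w w' : ℕ → M),
          (∀ i < n, w i = w' i) → Q (cons y w) → Q (cons y w') := by
        intro Q hQ y w w' hw
        refine hQ _ _ fun i hi => ?_
        rcases i with _ | i
        · rfl
        · exact hw i (by omega)
      have dpc : ∀ {Q : (ℕ → M) → Prop}, DP ∅ Q → DP ∅ (fun v => Q (cons (v 0) fun i => v (i+1))) := by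
        intro Q hQ
        exact hQ.iff fun v => by rw [cons_tail]
      by_cases hbA : b ∈ dcl Au
      · obtain ⟨R, r1, r2, r3, r4, r5⟩ := par b hbA
        obtain ⟨y, k1, k2⟩ := ih (fun u => ∃ y, R (cons y u) ∧ P (cons y u))
          (DP.ex (Q := fun u y => R (cons y u) ∧ P (cons y u)) ((dpc r1).and (dpc hP)))
          (fun v w hvw ⟨y, k1, k2⟩ => ⟨y, dcons r2 y _ _ hvw k1, dcons hd y _ _ hvw k2⟩)
          u hu ⟨b, r4, hPv⟩
        exact r3 _ _ _ k1 r5 ▸ k2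
      · obtain ⟨l, r, hl, hr, hlb, hrb, hlr⟩ := O1 (S := fun x => P (cons x u)) (DP.sub hP hd u) hPv hbA
        have hLp : ∃ Q : (ℕ → M) → Prop, DP ∅ Q ∧ Dep (n+1) Q ∧ (∀ x, Q (cons x u) → l x) ∧
            Q (cons (σ b) (fun i => σ (u i))) := by
          rcases hl with hl | ⟨p, hp, hl⟩
          · exact ⟨fun _ => True, DP.triv _, fun _ _ _ _ => trivial, fun x _ => hl x, trivial⟩
          · obtain ⟨R, r1, r2, r3, r4, r5⟩ := par p (dcl_dcl (A := Au) ▸ sub_dcl hp)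
            refine ⟨fun v => ∃ y, R (cons y (fun i => v (i+1))) ∧ y < v 0, ?_, ?_, ?_, ?_⟩
            · refine DP.ex (Q := fun v y => R (cons y (fun i => v (i+1))) ∧ y < v 0) (DP.and ?_ (DP.lt (DF.var 0) (DF.var 1)))
              refine (DP.ren (fun i => if i = 0 then 0 else i + 1) r1).iff fun v => ?_
              have : (fun i => v (if i = 0 then 0 else i + 1)) = cons (v 0) (fun i => v (i + 1 + 1)) := by
                funext i; cases i <;> simp [cons]
              rw [this]
            · rintro v w hvw ⟨y, k1, k2⟩
              exact ⟨y, dcons r2 y _ _ (fun i hi => hvw (i+1) (by omega)) k1, hvw 0 (by omega) ▸ k2⟩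
            · rintro x ⟨y, k1, k2⟩
              have : y = p := r3 _ _ _ k1 r4
              exact (hl x).2 (this ▸ k2)
            · exact ⟨σ p, r5, hmono p (hdN p hp) b (hv 0) ((hl b).1 hlb)⟩
        have hRp : ∃ Q : (ℕ → M) → Prop, DP ∅ Q ∧ Dep (n+1) Q ∧ (∀ x, Q (cons x u) → r x) ∧
            Q (cons (σ b) (fun i => σ (u i))) := by
          rcases hr with hl | ⟨p, hp, hl⟩
          · exact ⟨fun _ => True, DP.triv _, fun _ _ _ _ => trivial, fun x _ => hl x, trivial⟩
          · obtain ⟨R, r1, r2, r3, r4, r5⟩ := par p (dcl_dcl (A := Au) ▸ sub_dcl hp)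
            refine ⟨fun v => ∃ y, R (cons y (fun i => v (i+1))) ∧ v 0 < y, ?_, ?_, ?_, ?_⟩
            · refine DP.ex (Q := fun v y => R (cons y (fun i => v (i+1))) ∧ v 0 < y) (DP.and ?_ (DP.lt (DF.var 1) (DF.var 0)))
              refine (DP.ren (fun i => if i = 0 then 0 else i + 1) r1).iff fun v => ?_
              have : (fun i => v (if i = 0 then 0 else i + 1)) = cons (v 0) (fun i => v (i + 1 + 1)) := by
                funext i; cases i <;> simp [cons]
              rw [this]
            · rintro v w hvw ⟨y, k1, k2⟩
              exact ⟨y, dcons r2 y _ _ (fun i hi => hvw (i+1) (by omega)) k1, hvw 0 (by omega) ▸ k2⟩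
            · rintro x ⟨y, k1, k2⟩
              have : y = p := r3 _ _ _ k1 r4
              exact (hl x).2 (this ▸ k2)
            · exact ⟨σ p, r5, hmono b (hv 0) p (hdN p hp) ((hl b).1 hrb)⟩
        obtain ⟨Lp, l1, l2, l3, l4⟩ := hLp
        obtain ⟨Rp, r1, r2, r3, r4⟩ := hRp
        refine ih (fun u => ∀ x, Lp (cons x u) → Rp (cons x u) → P (cons x u)) ?_ ?_ u hu
          (fun x k1 k2 => hlr x (l3 x k1) (r3 x k2)) (σ b) l4 r4
        · exact DP.all (Q := fun u x => Lp (cons x u) → Rp (cons x u) → P (cons x u))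
            ((dpc l1).imp ((dpc r1).imp (dpc hP)))
        · intro v w hvw k x k1 k2
          exact dcons hd x _ _ hvw (k x (dcons l2 x _ _ (fun i hi => (hvw i hi).symm) k1)
            (dcons r2 x _ _ (fun i hi => (hvw i hi).symm) k2))
  refine ⟨hb, fun P hP v hv => ⟨fun h => ?_, fun h => ?_⟩⟩
  · obtain ⟨n, hn⟩ := OM.fv hP
    exact main n P hP hn v hv h
  · by_contra hcon
    obtain ⟨n, hn⟩ := OM.fv (DP.not hP)
    exact main n (fun v => ¬ P v) hP.not hn v hv hcon h

end QOM

namespace QOM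
open OM Cardinal
variable {M : Type} [OM M] {A B V C : Set M}

structure CD (M : Type) [OM M] (K : Type) (rep : K → M) (κ : M → K) (ρ : M → M) : Prop where
  nE : ∀ k, rep k ∉ dcl (∅ : Set M)
  a1 : ∀ y, y ∉ dcl (∅ : Set M) → ρ y ∈ dcl (insert y ∅)
  a2 : ∀ y, y ∉ dcl (∅ : Set M) → T1 ∅ (rep (κ y)) (ρ y)
  b : ∀ y y', y ∉ dcl (∅ : Set M) → y' ∉ dcl (∅ : Set M) → y' ∈ dcl (insert y ∅) → κ y' = κ y ∧ ρ y' = ρ y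
  c : ∀ y y', y ∉ dcl (∅ : Set M) → T1 ∅ y y' → κ y' = κ y ∧ T2 ∅ y (ρ y) y' (ρ y')
  d : ∀ k y, T1 ∅ (rep k) y → κ y = k ∧ ρ y = y

theorem dcl_tr {x y z : M} (h : z ∈ dcl (insert y A)) (h' : y ∈ dcl (insert x A)) : z ∈ dcl (insert x A) :=
  dcl_sub (Set.insert_subset h' ((Set.subset_insert _ _).trans sub_dcl)) h

theorem CD.exists (hS : S0 M) (hne : ∃ x : M, x ∉ dcl (∅ : Set M)) :
    ∃ (K : Type) (rep : K → M) (κ : M → K) (ρ : M → M), CD M K rep κ ρ := by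
  classical
  let X := {x : M // x ∉ dcl (∅ : Set M)}
  let s : Setoid X :=
    { r := fun x y => ∃ y', T1 ∅ y.1 y' ∧ y' ∈ dcl (insert x.1 ∅)
      iseqv := by
        refine ⟨fun x => ⟨x.1, T1.refl _, sub_dcl (by simp)⟩, ?_, ?_⟩
        · rintro x y ⟨y', h1, h2⟩
          obtain ⟨x', h3⟩ := hom Set.countable_empty h1.symm x.1
          exact ⟨x', h3.snd, h3.dcl (exch h2 (h1.ndcl y.2))⟩
        · rintro x y z ⟨y', h1, h2⟩ ⟨z', h3, h4⟩
          obtain ⟨w, h5⟩ := hom Set.countable_empty h1 z'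
          exact ⟨w, h3.trans h5.snd, dcl_tr (h5.dcl h4) h2⟩ }
  have key : ∀ y : M, ∃ (k : Quotient s) (r : M), ∀ hy : y ∉ dcl (∅ : Set M), k = Quotient.mk s ⟨y, hy⟩ ∧
      T1 ∅ k.out.1 r ∧ r ∈ dcl (insert y ∅) := by
    intro y
    by_cases hy : y ∈ dcl (∅ : Set M)
    · obtain ⟨x, hx⟩ := hne
      exact ⟨Quotient.mk s ⟨x, hx⟩, x, fun h => (h hy).elim⟩
    · have : s.r ⟨y, hy⟩ (Quotient.mk s ⟨y, hy⟩).out := s.symm' (Quotient.mk_out (s := s) ⟨y, hy⟩)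
      obtain ⟨r, h1, h2⟩ := this
      exact ⟨Quotient.mk s ⟨y, hy⟩, r, fun _ => ⟨rfl, h1, h2⟩⟩
  choose κ ρ h using key
  have nE : ∀ k : Quotient s, k.out.1 ∉ dcl (∅ : Set M) := fun k => k.out.2
  have uniq : ∀ y r r' : M, y ∉ dcl (∅ : Set M) → r ∉ dcl (∅ : Set M) → T1 ∅ r r' →
      r ∈ dcl (insert y ∅) → r' ∈ dcl (insert y ∅) → r = r' := by
    intro y r r' hy hr h1 h2 h3
    exact hS r r' hr h1 (dcl_tr h3 (exch h2 hr))
  refine ⟨Quotient s, fun k => k.out.1, κ, ρ, nE, fun y hy => (h y hy).2.2, fun y hy => (h y hy).2.1, ?_, ?_, ?_⟩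
  · intro y y' hy hy' hyy
    have hk : κ y' = κ y := by
      rw [(h y' hy').1, (h y hy).1]
      exact Quotient.sound (s.symm' ⟨y', T1.refl _, hyy⟩)
    refine ⟨hk, (uniq y _ _ hy ((h y hy).2.1.ndcl (nE _)) ?_ (h y hy).2.2 (dcl_tr (h y' hy').2.2 hyy)).symm⟩
    have h1 := (h y' hy').2.1
    rw [hk] at h1
    exact (h y hy).2.1.symm.trans h1
  · intro y y' hy hyy
    have hy' := hyy.ndcl hy
    have hk : κ y' = κ y := by
      rw [(h y' hy').1, (h y hy).1]
      exact Quotient.sound ⟨y', hyy, sub_dcl (by simp)⟩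
    refine ⟨hk, ?_⟩
    obtain ⟨w, hw⟩ := hom Set.countable_empty hyy (ρ y)
    have h1 := (h y' hy').2.1
    rw [hk] at h1
    have h2 := (h y hy).2.1.trans hw.snd
    have := uniq y' w (ρ y') hy' (h2.ndcl (nE _)) (h2.symm.trans h1) (hw.dcl (h y hy).2.2) (h y' hy').2.2
    exact this ▸ hw
  · intro k y hy
    have hy' := hy.ndcl (nE k)
    have hk : κ y = k := by
      rw [(h y hy').1, ← Quotient.out_eq k]
      exact Quotient.sound ⟨y, hy, sub_dcl (by simp)⟩
    refine ⟨hk, ?_⟩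
    have h1 := (h y hy').2.1
    rw [hk] at h1
    exact uniq y _ _ hy' (h1.ndcl (nE k)) (h1.symm.trans hy) (h y hy').2.2 (sub_dcl (by simp))

def OI (D D' : Set M) : Prop := ∃ f : M → M, Set.BijOn f D D' ∧ StrictMonoOn f D

variable {K : Type} {rep : K → M} {κ : M → K} {ρ : M → M}

theorem CD.exch (h : CD M K rep κ ρ) {y : M} (hy : y ∉ dcl (∅ : Set M)) : y ∈ dcl (insert (ρ y) ∅) :=
  QOM.exch (h.a1 y hy) ((h.a2 y hy).ndcl (h.nE _))

/-- recover from the representative -/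
theorem CD.rec' (h : CD M K rep κ ρ) {k : K} {r y : M} (hr : T1 ∅ (rep k) r) (hy : y ∉ dcl (∅ : Set M))
    (hyr : y ∈ dcl (insert r ∅)) : κ y = k ∧ ρ y = r := by
  have h1 := h.b r y (hr.ndcl (h.nE k)) hy hyr
  have h2 := h.d k r hr
  exact ⟨h1.1.trans h2.1, h1.2.trans h2.2⟩

theorem iso_of (hT : TRIV M) (hS : S0 M) (h : CD M K rep κ ρ) {N N' : Set M} (hN : dcl N = N) (hN' : dcl N' = N')
    (hf : ∀ k, OI (N ∩ {y | T1 ∅ (rep k) y}) (N' ∩ {y | T1 ∅ (rep k) y})) : ∃ σ, IsIso σ N N' := by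
  classical
  choose f hf1 hf2 using hf
  have sub1 : ∀ {y z}, y ∈ N → z ∈ dcl (insert y ∅) → z ∈ N := fun {y z} hy hz => by
    rw [← hN]; exact dcl_mono (by simpa using hy) hz
  have sub1' : ∀ {y z}, y ∈ N' → z ∈ dcl (insert y ∅) → z ∈ N' := fun {y z} hy hz => by
    rw [← hN']; exact dcl_mono (by simpa using hy) hz
  have ρN : ∀ y ∈ N, y ∉ dcl (∅ : Set M) → ρ y ∈ N ∩ {z | T1 ∅ (rep (κ y)) z} := fun y hy hyE =>
    ⟨sub1 hy (h.a1 y hyE), h.a2 y hyE⟩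
  have ex : ∀ y, ∃ s, (y ∈ dcl (∅ : Set M) → s = y) ∧ (y ∉ dcl (∅ : Set M) → y ∈ N →
      T2 ∅ (ρ y) y (f (κ y) (ρ y)) s) := by
    intro y
    by_cases hy : y ∈ dcl (∅ : Set M)
    · exact ⟨y, fun _ => rfl, fun h => (h hy).elim⟩
    by_cases hyN : y ∈ N
    · have h1 := (hf1 (κ y)).1 (ρN y hyN hy)
      obtain ⟨w, hw⟩ := hom Set.countable_empty ((h.a2 y hy).symm.trans h1.2) y
      exact ⟨w, fun h => (hy h).elim, fun _ _ => hw⟩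
    · exact ⟨y, fun _ => rfl, fun _ h => (hyN h).elim⟩
  choose σ hσ1 hσ2 using ex
  have ho : ∀ y ∈ N, y ∉ dcl (∅ : Set M) → σ y ∉ dcl (∅ : Set M) ∧ σ y ∈ N' ∧ κ (σ y) = κ y ∧
      ρ (σ y) = f (κ y) (ρ y) ∧ σ y ∈ dcl (insert (f (κ y) (ρ y)) ∅) := by
    intro y hy hyE
    have h1 := hσ2 y hyE hy
    have h2 := h1.snd.ndcl hyE
    have h3 := h1.dcl (h.exch hyE)
    have h4 := (hf1 (κ y)).1 (ρN y hy hyE)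
    have h5 := h.rec' h4.2 h2 h3
    exact ⟨h2, sub1' h4.1 h3, h5.1, h5.2, h3⟩
  have EN : dcl (∅ : Set M) ⊆ N := by rw [← hN]; exact dcl_mono (Set.empty_subset _)
  have EN' : dcl (∅ : Set M) ⊆ N' := by rw [← hN']; exact dcl_mono (Set.empty_subset _)
  refine ⟨σ, iso_crit hT hN ⟨?_, ?_, ?_⟩ ?_ ?_⟩
  · intro y hy
    by_cases hyE : y ∈ dcl (∅ : Set M)
    · rw [hσ1 y hyE]; exact EN' hyE
    · exact (ho y hy hyE).2.1
  · intro y hy z hz hyz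
    by_cases hyE : y ∈ dcl (∅ : Set M) <;> by_cases hzE : z ∈ dcl (∅ : Set M)
    · rw [← hσ1 y hyE, ← hσ1 z hzE, hyz]
    · exact ((ho z hz hzE).1 (hyz ▸ (hσ1 y hyE).symm ▸ hyE)).elim
    · exact ((ho y hy hyE).1 (hyz ▸ (hσ1 z hzE).symm ▸ hzE)).elim
    · have h1 := ho y hy hyE
      have h2 := ho z hz hzE
      have hk : κ y = κ z := by rw [← h1.2.2.1, ← h2.2.2.1, hyz]
      have hr : ρ y = ρ z := by
        refine (hf1 (κ y)).2.1 (ρN y hy hyE) (hk ▸ ρN z hz hzE) ?_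
        rw [← h1.2.2.2.1, hyz, h2.2.2.2.1, hk]
      have h3 := hσ2 y hyE hy
      have h4 := hσ2 z hzE hz
      rw [← hyz, ← hr, ← hk] at h4
      have h5 : T2 ∅ (ρ y) y (ρ y) z := fun S hS hh => h4.symm S hS (h3 S hS hh)
      exact h5.func (h.exch hyE)
  · intro s hs
    by_cases hsE : s ∈ dcl (∅ : Set M)
    · exact ⟨s, EN hsE, hσ1 s hsE⟩
    have h1 : ρ s ∈ N' ∩ {z | T1 ∅ (rep (κ s)) z} := ⟨sub1' hs (h.a1 s hsE), h.a2 s hsE⟩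
    obtain ⟨r, hr, hrs⟩ := (hf1 (κ s)).2.2 h1
    obtain ⟨y, hy⟩ := hom Set.countable_empty (h1.2.symm.trans hr.2) s
    have hyE := hy.snd.ndcl hsE
    have h2 := hy.dcl (h.exch hsE)
    have hyN := sub1 hr.1 h2
    have h3 := h.rec' hr.2 hyE h2
    have h4 := hσ2 y hyE hyN
    rw [h3.1, h3.2, hrs] at h4
    have h5 : T2 ∅ (ρ s) s (ρ s) (σ y) := fun S hS hh => h4 S hS (hy S hS hh)
    exact ⟨y, hyN, (h5.func (h.exch hsE)).symm⟩
  · intro a ha e he hea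
    by_cases haE : a ∈ dcl (∅ : Set M)
    · rw [hσ1 a haE, hσ1 e (dcl_ins_sub haE hea)]
      exact fun S _ h => h
    have h1 := hσ2 a haE ha
    by_cases heE : e ∈ dcl (∅ : Set M)
    · rw [hσ1 e heE]
      intro S hS hh
      exact h1.snd (fun x => S x e) (hS.bind2 (DF.var 0) (DF.cst heE)) hh
    · have h2 := h.b a e haE heE hea
      have h3 := hσ2 e heE he
      rw [h2.1, h2.2] at h3
      exact h1.comb h3 (h.exch haE)
  · intro y hy z hz hyE hyz hlt
    have hzE := hyz.ndcl hyE
    have hc := h.c y z hyE hyz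
    have h1 := hσ2 y hyE hy
    have h2 := hσ2 z hzE hz
    rw [hc.1] at h2
    have r1 := ρN y hy hyE
    have r2 := ρN z hz hzE
    rw [hc.1] at r2
    have ryz : T1 ∅ (ρ y) (ρ z) := hc.2.snd
    have rnE := (h.a2 y hyE).ndcl (h.nE _)
    have f1 := (hf1 (κ y)).1 r1
    have f2 := (hf1 (κ y)).1 r2
    obtain ⟨θ, t1, t2, t3⟩ := mem_dcl_insert (h.exch hyE)
    have t4 : θ (ρ z) z := hc.2 (fun a b => θ b a) (t1.bind2 (DF.var 1) (DF.var 0)) t2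
    have t5 := h1 θ t1 t2
    have t6 := h2 θ t1 t4
    have dS : DP (∅ : Set M) (fun v => ∃ u w, θ (v 0) u ∧ θ (v 1) w ∧ u < w) :=
      DP.ex (DP.ex (Q := fun v w => θ (v 1) (v 0) ∧ θ (v 2) w ∧ v 0 < w) ((t1.bind2 (DF.var 2) (DF.var 1)).and ((t1.bind2 (DF.var 3) (DF.var 0)).and
        (DP.lt (DF.var 1) (DF.var 0)))))
    rcases lt_trichotomy (ρ y) (ρ z) with hr | hr | hr
    · have := pair hS rnE ryz (r1.2.symm.trans f1.2) (r1.2.symm.trans f2.2) hr (hf2 (κ y) r1 r2 hr)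
      obtain ⟨u, w, k1, k2, k3⟩ := this (fun a b => ∃ u w, θ a u ∧ θ b w ∧ u < w) dS ⟨y, z, t2, t4, hlt⟩
      rw [t3 _ _ _ k1 t5, t3 _ _ _ k2 t6] at k3
      exact k3
    · rw [← hr] at t4
      exact (hlt.ne (t3 _ _ _ t2 t4)).elim
    · have := pair hS (ryz.ndcl rnE) ryz.symm (r2.2.symm.trans f2.2) (r2.2.symm.trans f1.2) hr (hf2 (κ y) r2 r1 hr)
      obtain ⟨u, w, k1, k2, k3⟩ := this (fun b a => ∃ u w, θ a u ∧ θ b w ∧ u < w) (dS.bind2 (θ := fun a b => ∃ u w, θ a u ∧ θ b w ∧ u < w) (DF.var 1) (DF.var 0)) ⟨y, z, t2, t4, hlt⟩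
      rw [t3 _ _ _ k1 t5, t3 _ _ _ k2 t6] at k3
      exact k3

theorem IsIso.oi {σ : M → M} {N N' : Set M} (h : IsIso σ N N') (x : M) :
    OI (N ∩ {y | QOM.T1 ∅ x y}) (N' ∩ {y | QOM.T1 ∅ x y}) := by
  have hT : ∀ y ∈ N, QOM.T1 ∅ y (σ y) := fun y hy => h.T1 (Set.empty_subset _) (by simp) hy
  refine ⟨σ, ⟨?_, h.1.2.1.mono Set.inter_subset_left, ?_⟩, ?_⟩
  · rintro y ⟨hy, hy'⟩
    exact ⟨h.1.1 hy, hy'.trans (hT y hy)⟩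
  · rintro s ⟨hs, hs'⟩
    obtain ⟨y, hy, rfl⟩ := h.1.2.2 hs
    exact ⟨y, ⟨hy, hs'.trans (hT y hy).symm⟩, rfl⟩
  · rintro y ⟨hy, _⟩ z ⟨hz, _⟩ hlt
    exact h.T2 (Set.empty_subset _) (by simp) hy hz (· < ·) DP.lt0 hlt

end QOM

namespace QOM
open OM Cardinal
variable {M : Type} [OM M] {A B V C : Set M} {D D' : Set M}

def HMin (D : Set M) : Prop := ∃ m ∈ D, ∀ y ∈ D, m ≤ y
def HMax (D : Set M) : Prop := ∃ m ∈ D, ∀ y ∈ D, y ≤ m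
def Dense' (D : Set M) : Prop := ∀ x ∈ D, ∀ y ∈ D, x < y → ∃ z ∈ D, x < z ∧ z < y
def Inn (D : Set M) : Set M := {x | x ∈ D ∧ (∃ y ∈ D, y < x) ∧ ∃ y ∈ D, x < y}

abbrev Code := Option (Option (Bool × Bool))

open Classical in
noncomputable def cd (D : Set M) : Code :=
  if D = ∅ then none else if D.Subsingleton then some none else some (some (decide (HMin D), decide (HMax D)))

theorem OI.img {f : M → M} (hb : Set.BijOn f D D') (hm : StrictMonoOn f D) :
    (D = ∅ ↔ D' = ∅) ∧ (D.Subsingleton ↔ D'.Subsingleton) ∧ (HMin D ↔ HMin D') ∧ (HMax D ↔ HMax D') := by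
  have hi := hb.image_eq
  subst hi
  refine ⟨by simp, ?_, ?_, ?_⟩
  · exact ⟨fun h => h.image f, fun h => Set.subsingleton_of_image_of_injOn h⟩
  · constructor
    · rintro ⟨m, h1, h2⟩
      refine ⟨f m, ⟨m, h1, rfl⟩, ?_⟩
      rintro _ ⟨y, hy, rfl⟩
      exact (hm.le_iff_le h1 hy).2 (h2 y hy)
    · rintro ⟨_, ⟨m, h1, rfl⟩, h2⟩
      exact ⟨m, h1, fun y hy => (hm.le_iff_le h1 hy).1 (h2 _ ⟨y, hy, rfl⟩)⟩
  · constructor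
    · rintro ⟨m, h1, h2⟩
      refine ⟨f m, ⟨m, h1, rfl⟩, ?_⟩
      rintro _ ⟨y, hy, rfl⟩
      exact (hm.le_iff_le hy h1).2 (h2 y hy)
    · rintro ⟨_, ⟨m, h1, rfl⟩, h2⟩
      exact ⟨m, h1, fun y hy => (hm.le_iff_le hy h1).1 (h2 _ ⟨y, hy, rfl⟩)⟩
where
  Set.subsingleton_of_image_of_injOn (h : (f '' D).Subsingleton) : D.Subsingleton := fun a ha b hb' =>
    hb.2.1 ha hb' (h ⟨a, ha, rfl⟩ ⟨b, hb', rfl⟩)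

theorem OI.cd (h : OI D D') : cd D = cd D' := by
  classical
  obtain ⟨f, hb, hm⟩ := h
  obtain ⟨h1, h2, h3, h4⟩ := OI.img hb hm
  unfold QOM.cd
  refine if_congr h1 rfl (if_congr h2 rfl ?_)
  simp only [h3, h4]

theorem Inn.inst (hD : Dense' D) (hn : ¬ D.Subsingleton) : DenselyOrdered (Inn D) ∧ NoMinOrder (Inn D) ∧
    NoMaxOrder (Inn D) ∧ Nonempty (Inn D) := by
  refine ⟨⟨?_⟩, ⟨?_⟩, ⟨?_⟩, ?_⟩
  · rintro ⟨x, h1, h2, h3⟩ ⟨y, h4, h5, h6⟩ hxy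
    obtain ⟨z, h7, h8, h9⟩ := hD x h1 y h4 hxy
    exact ⟨⟨z, h7, ⟨x, h1, h8⟩, ⟨y, h4, h9⟩⟩, h8, h9⟩
  · rintro ⟨x, h1, ⟨y, h2, h2'⟩, h3⟩
    obtain ⟨z, h7, h8, h9⟩ := hD y h2 x h1 h2'
    exact ⟨⟨z, h7, ⟨y, h2, h8⟩, ⟨x, h1, h9⟩⟩, h9⟩
  · rintro ⟨x, h1, h3, ⟨y, h2, h2'⟩⟩
    obtain ⟨z, h7, h8, h9⟩ := hD x h1 y h2 h2'
    exact ⟨⟨z, h7, ⟨x, h1, h8⟩, ⟨y, h2, h9⟩⟩, h8⟩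
  · rw [Set.not_subsingleton_iff] at hn
    obtain ⟨x, hx, y, hy, hxy⟩ := hn.exists_lt
    obtain ⟨z, h7, h8, h9⟩ := hD x hx y hy hxy
    exact ⟨⟨z, h7, ⟨x, hx, h8⟩, ⟨y, hy, h9⟩⟩⟩

theorem OI.of_cd (hc : D.Countable) (hc' : D'.Countable) (hD : Dense' D) (hD' : Dense' D')
    (h : QOM.cd D = QOM.cd D') : OI D D' := by
  classical
  unfold QOM.cd at h
  by_cases h1 : D = ∅ <;> by_cases h2 : D' = ∅
  · subst h1; subst h2
    exact ⟨id, Set.bijOn_id _, fun x hx => hx.elim⟩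
  · rw [if_pos h1, if_neg h2] at h; split_ifs at h
  · rw [if_neg h1, if_pos h2] at h; split_ifs at h
  rw [if_neg h1, if_neg h2] at h
  by_cases h3 : D.Subsingleton <;> by_cases h4 : D'.Subsingleton
  · obtain ⟨a, rfl⟩ := (Set.exists_eq_singleton_iff_nonempty_subsingleton.2 ⟨Set.nonempty_iff_ne_empty.2 h1, h3⟩)
    obtain ⟨b, rfl⟩ := (Set.exists_eq_singleton_iff_nonempty_subsingleton.2 ⟨Set.nonempty_iff_ne_empty.2 h2, h4⟩)
    refine ⟨fun _ => b, ⟨fun x hx => rfl, h3.injOn _, ?_⟩, ?_⟩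
    · rintro x rfl
      exact ⟨a, rfl, rfl⟩
    · intro x hx y hy hxy
      exact (hxy.ne (h3 hx hy)).elim
  · rw [if_pos h3, if_neg h4] at h; simp at h
  · rw [if_neg h3, if_pos h4] at h; simp at h
  rw [if_neg h3, if_neg h4] at h
  simp only [Option.some.injEq, Prod.mk.injEq, decide_eq_decide] at h
  obtain ⟨hmin, hmax⟩ := h
  obtain ⟨i1, i2, i3, i4⟩ := Inn.inst hD h3
  obtain ⟨j1, j2, j3, j4⟩ := Inn.inst hD' h4
  have k1 : Countable (Inn D) := (hc.mono fun x hx => hx.1).to_subtype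
  have k2 : Countable (Inn D') := (hc'.mono fun x hx => hx.1).to_subtype
  obtain ⟨e⟩ := Order.iso_of_countable_dense (Inn D) (Inn D')
  obtain ⟨x0⟩ := i4
  obtain ⟨m', hm'⟩ : ∃ m', HMin D' → m' ∈ D' ∧ ∀ y ∈ D', m' ≤ y := by
    by_cases h : HMin D'
    · exact ⟨h.choose, fun _ => h.choose_spec⟩
    · exact ⟨x0, fun h' => (h h').elim⟩
  obtain ⟨X', hX'⟩ : ∃ m', HMax D' → m' ∈ D' ∧ ∀ y ∈ D', y ≤ m' := by
    by_cases h : HMax D'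
    · exact ⟨h.choose, fun _ => h.choose_spec⟩
    · exact ⟨x0, fun h' => (h h').elim⟩
  let f : M → M := fun x => if h : x ∈ Inn D then (e ⟨x, h⟩).1 else if ∃ y ∈ D, y < x then X' else m'
  have fI : ∀ x (h : x ∈ Inn D), f x = (e ⟨x, h⟩).1 := fun x h => dif_pos h
  have fX : ∀ x ∈ D, x ∉ Inn D → (∃ y ∈ D, y < x) → f x = X' ∧ HMax D' := by
    intro x hx h h'
    refine ⟨by simp only [f]; rw [dif_neg h, if_pos h'], hmax.1 ⟨x, hx, fun y hy => ?_⟩⟩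
    by_contra hlt
    exact h ⟨hx, h', y, hy, not_le.1 hlt⟩
  have fm : ∀ x ∈ D, (¬ ∃ y ∈ D, y < x) → f x = m' ∧ HMin D' := by
    intro x hx h'
    refine ⟨by simp only [f]; rw [dif_neg fun h => h' h.2.1, if_neg h'], hmin.1 ⟨x, hx, fun y hy => ?_⟩⟩
    by_contra hlt
    exact h' ⟨y, hy, not_le.1 hlt⟩
  have hmap : ∀ x ∈ D, f x ∈ D' := by
    intro x hx
    by_cases a1 : x ∈ Inn D
    · rw [fI x a1]; exact (e ⟨x, a1⟩).2.1
    by_cases a2 : ∃ y ∈ D, y < x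
    · obtain ⟨b1, b2⟩ := fX x hx a1 a2
      rw [b1]; exact (hX' b2).1
    · obtain ⟨b1, b2⟩ := fm x hx a2
      rw [b1]; exact (hm' b2).1
  have hmono : StrictMonoOn f D := by
    intro x hx y hy hxy
    have hy2 : ∃ z ∈ D, z < y := ⟨x, hx, hxy⟩
    have hx2 : ∃ z ∈ D, x < z := ⟨y, hy, hxy⟩
    by_cases a1 : x ∈ Inn D <;> by_cases a2 : y ∈ Inn D
    · rw [fI x a1, fI y a2]
      exact e.strictMono (show (⟨x, a1⟩ : Inn D) < ⟨y, a2⟩ from hxy)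
    · obtain ⟨b1, b2⟩ := fX y hy a2 hy2
      rw [fI x a1, b1]
      obtain ⟨-, -, z, hz, hz'⟩ := (e ⟨x, a1⟩).2
      exact lt_of_lt_of_le hz' ((hX' b2).2 z hz)
    · obtain ⟨b1, b2⟩ := fm x hx fun h => a1 ⟨hx, h, hx2⟩
      rw [fI y a2, b1]
      obtain ⟨-, ⟨z, hz, hz'⟩, -⟩ := (e ⟨y, a2⟩).2
      exact lt_of_le_of_lt ((hm' b2).2 z hz) hz'
    · obtain ⟨b1, b2⟩ := fm x hx fun h => a1 ⟨hx, h, hx2⟩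
      obtain ⟨b3, b4⟩ := fX y hy a2 hy2
      rw [b1, b3]
      rw [Set.not_subsingleton_iff] at h4
      obtain ⟨x, hx, y, hy, hxy⟩ := h4.exists_lt
      exact lt_of_le_of_lt ((hm' b2).2 x hx) (lt_of_lt_of_le hxy ((hX' b4).2 y hy))
  refine ⟨f, ⟨hmap, hmono.injOn, ?_⟩, hmono⟩
  rw [Set.not_subsingleton_iff] at h3
  obtain ⟨p, hp, q, hq, hpq⟩ := h3.exists_lt
  intro s hs
  by_cases a1 : s ∈ Inn D'
  · refine ⟨(e.symm ⟨s, a1⟩).1, (e.symm ⟨s, a1⟩).2.1, ?_⟩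
    rw [fI _ (e.symm ⟨s, a1⟩).2]
    simp
  by_cases a2 : ∃ y ∈ D', y < s
  · have hs' : ∀ y ∈ D', y ≤ s := fun y hy => by
      by_contra hlt
      exact a1 ⟨hs, a2, y, hy, not_le.1 hlt⟩
    obtain ⟨x, hx, hx'⟩ := hmax.2 ⟨s, hs, hs'⟩
    obtain ⟨b1, b2⟩ := fX x hx (fun h => by
      obtain ⟨_, _, y, hy, hy'⟩ := h
      exact absurd hy' (not_lt.2 (hx' y hy))) ⟨p, hp, lt_of_lt_of_le hpq (hx' q hq)⟩
    exact ⟨x, hx, b1.trans (le_antisymm (hs' _ (hX' b2).1) ((hX' b2).2 s hs))⟩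
  · have hs' : ∀ y ∈ D', s ≤ y := fun y hy => by
      by_contra hlt
      exact a2 ⟨y, hy, not_le.1 hlt⟩
    obtain ⟨x, hx, hx'⟩ := hmin.2 ⟨s, hs, hs'⟩
    obtain ⟨b1, b2⟩ := fm x hx (fun h => by
      obtain ⟨y, hy, hy'⟩ := h
      exact absurd hy' (not_lt.2 (hx' y hy)))
    exact ⟨x, hx, b1.trans (le_antisymm ((hm' b2).2 s hs) (hs' _ (hm' b2).1))⟩

end QOM

namespace QOM
open OM Cardinal
variable {M : Type} [OM M] {A B V C : Set M} {D D' : Set M}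
variable {K : Type} {rep : K → M} {κ : M → K} {ρ : M → M}

def Isol (R : M → M → Prop) (x : M) : Prop :=
  ∃ S : M → Prop, DP (∅ : Set M) (fun v => S (v 0)) ∧ S x ∧ ∀ y z, T1 ∅ x y → R y z → S z → T1 ∅ x z
def IU (x : M) : Prop := Isol (fun a b => a < b) x
def ID (x : M) : Prop := Isol (fun a b => b < a) x

theorem Isol.inv {R : M → M → Prop} {x y : M} (h : Isol R x) (hxy : T1 ∅ x y) : Isol R y := by
  obtain ⟨S, h1, h2, h3⟩ := h
  exact ⟨S, h1, hxy S h1 h2, fun a z ha hz hS => hxy.symm.trans (h3 a z (hxy.trans ha) hz hS)⟩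

theorem transU {x r : M} (h : IU x) {θ : M → M → Prop} (hθ : DP (∅ : Set M) (fun v => θ (v 0) (v 1)))
    (hf : ∀ x y z, θ x y → θ x z → y = z) (hxr : θ x r) (hr : r ∈ dcl (insert x ∅)) {R : M → M → Prop}
    (hR : DP (∅ : Set M) (fun v => R (v 0) (v 1))) (has : ∀ a b, R a b → ¬ R b a)
    (hm : ∀ z w, T1 ∅ x z → x < z → θ z w → R r w) : Isol R r := by
  obtain ⟨S, h1, h2, h3⟩ := h
  have tr : ∀ z w, T1 ∅ x z → θ z w → T1 ∅ r w := by
    intro z w hz hw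
    obtain ⟨w', hw'⟩ := hom Set.countable_empty hz r
    have := hf z w w' hw (hw' θ hθ hxr)
    exact this ▸ hw'.snd
  refine ⟨fun w => ∃ z, S z ∧ θ z w ∧ ∀ z' w', S z' → z < z' → θ z' w' → R w w', ?_, ?_, ?_⟩
  · refine DP.ex ((h1.lift1 0).and (hθ.and (DP.all (DP.all (Q := fun v w' => S (v 0) → v 1 < v 0 → θ (v 0) w' → R (v 2) w') ?_))))
    exact (h1.lift1 1).imp ((DP.lt (DF.var 2) (DF.var 1)).imp ((hθ.bind2 (DF.var 1) (DF.var 0)).imp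
      (hR.bind2 (DF.var 3) (DF.var 0))))
  · exact ⟨x, h2, hxr, fun z' w' a b c => hm z' w' (h3 x z' (T1.refl _) b a) b c⟩
  · rintro y w hy hyw ⟨z, a, b, c⟩
    obtain ⟨x1, hx1⟩ := hom Set.countable_empty hy x
    have hθ1 : θ x1 y := hx1.swap θ hθ hxr
    have hx1x := hx1.snd
    rcases lt_trichotomy x1 z with hlt | heq | hgt
    · exact tr z w (h3 x1 z hx1x hlt a) b
    · subst heq
      exact hf _ _ _ b hθ1 ▸ hy
    · exact (has _ _ hyw (c x1 y (hx1x S h1 h2) hgt hθ1)).elim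

theorem transD {x r : M} (h : ID x) {θ : M → M → Prop} (hθ : DP (∅ : Set M) (fun v => θ (v 0) (v 1)))
    (hf : ∀ x y z, θ x y → θ x z → y = z) (hxr : θ x r) (hr : r ∈ dcl (insert x ∅)) {R : M → M → Prop}
    (hR : DP (∅ : Set M) (fun v => R (v 0) (v 1))) (has : ∀ a b, R a b → ¬ R b a)
    (hm : ∀ z w, T1 ∅ x z → z < x → θ z w → R r w) : Isol R r :=
  @transU M (OM.dual M) x r h θ hθ hf hxr hr R hR has hm

theorem extR {N : Set M} {r : M → Prop} (hr : IsR N r) {x : M} (hx : r x) (hxE : x ∉ dcl (∅ : Set M)) :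
    (∃ b ∈ N, T1 ∅ x b ∧ x < b ∧ ∀ z, r z ↔ z < b) ∨
    ((∀ y, T1 ∅ x y → r y) ∧ (IU x ∨ ∃ f ∈ dcl (∅ : Set M), x < f ∧ r f)) := by
  rcases hr with hr | ⟨p, hp, hr⟩
  · right
    refine ⟨fun y _ => hr y, ?_⟩
    by_contra hcon
    push Not at hcon
    obtain ⟨h1, h2⟩ := hcon
    refine h1 ⟨fun _ => True, DP.triv _, trivial, fun y z hy hyz _ => ?_⟩
    have h3 : ∀ f ∈ dcl (∅ : Set M), f < y := fun f hf => by
      refine (hy.lt hf).1 (lt_of_le_of_ne (not_lt.1 fun h => h2 f hf h (hr f)) ?_)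
      rintro rfl
      exact hxE hf
    have hz : z ∉ dcl (∅ : Set M) := fun hz => absurd (h3 z hz) (not_lt.2 hyz.le)
    by_contra hT
    obtain ⟨f, hf, h4, h5⟩ := sep hyz (hy.ndcl hxE) hz fun h => hT (hy.trans h)
    exact absurd (h3 f hf) (not_lt.2 h4.le)
  · have hxp := (hr x).1 hx
    by_cases hT : T1 ∅ x p
    · exact Or.inl ⟨p, hp, hT, hxp, hr⟩
    right
    by_cases hpE : p ∈ dcl (∅ : Set M)
    · refine ⟨fun y hy => (hr y).2 (hy (fun z => z < p) (DP.lt (DF.var 0) (DF.cst hpE)) hxp), ?_⟩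
      by_contra hcon
      push Not at hcon
      obtain ⟨h1, h2⟩ := hcon
      refine h1 ⟨fun z => z < p, DP.lt (DF.var 0) (DF.cst hpE), hxp, fun y z hy hyz hzp => ?_⟩
      have h3 : ∀ f ∈ dcl (∅ : Set M), y < f → f < p → False := fun f hf h3 h4 => by
        refine h2 f hf (lt_of_le_of_ne (not_lt.1 fun h => ?_) ?_) ((hr f).2 h4)
        · exact absurd ((hy.lt hf).1 h) (not_lt.2 h3.le)
        · rintro rfl
          exact hxE hf
      have hz : z ∉ dcl (∅ : Set M) := fun hz => h3 z hz hyz hzp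
      by_contra hT
      obtain ⟨f, hf, h4, h5⟩ := sep hyz (hy.ndcl hxE) hz fun h => hT (hy.trans h)
      exact h3 f hf h4 (h5.trans hzp)
    · obtain ⟨f, hf, h4, h5⟩ := sep hxp hxE hpE hT
      exact ⟨fun y hy => (hr y).2 (lt_trans (hy (fun z => z < f) (DP.lt (DF.var 0) (DF.cst hf)) h4) h5),
        Or.inr ⟨f, hf, h4, (hr f).2 h5⟩⟩

theorem extL {N : Set M} {r : M → Prop} (hr : IsL N r) {x : M} (hx : r x) (hxE : x ∉ dcl (∅ : Set M)) :
    (∃ b ∈ N, T1 ∅ x b ∧ b < x ∧ ∀ z, r z ↔ b < z) ∨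
    ((∀ y, T1 ∅ x y → r y) ∧ (ID x ∨ ∃ f ∈ dcl (∅ : Set M), f < x ∧ r f)) :=
  @extR M (OM.dual M) N r hr x hx hxE

theorem IsL.up {N : Set M} {l : M → Prop} (hl : IsL N l) {x y : M} (hx : l x) (hxy : x ≤ y) : l y := by
  rcases hl with hl | ⟨p, hp, hl⟩
  · exact hl y
  · exact (hl y).2 (lt_of_lt_of_le ((hl x).1 hx) hxy)
theorem IsR.down {N : Set M} {l : M → Prop} (hl : IsR N l) {x y : M} (hx : l x) (hxy : y ≤ x) : l y := by
  rcases hl with hl | ⟨p, hp, hl⟩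
  · exact hl y
  · exact (hl y).2 (lt_of_le_of_lt hxy ((hl x).1 hx))

theorem CD.θ (h : CD M K rep κ ρ) {x : M} (hx : x ∉ dcl (∅ : Set M)) :
    ∃ θ : M → M → Prop, DP (∅ : Set M) (fun v => θ (v 0) (v 1)) ∧ (∀ x y z, θ x y → θ x z → y = z) ∧
      ∀ y, T1 ∅ x y → θ y (ρ y) := by
  obtain ⟨θ, h1, h2, h3⟩ := mem_dcl_insert (h.a1 x hx)
  exact ⟨θ, h1, h3, fun y hy => (h.c x y hx hy).2 θ h1 h2⟩

theorem CD.inj (h : CD M K rep κ ρ) {x y : M} (hx : x ∉ dcl (∅ : Set M)) (hxy : T1 ∅ x y) (he : ρ x = ρ y) : x = y := by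
  have h1 := (h.c x y hx hxy).2.swap
  rw [← he] at h1
  exact h1.func (h.exch hx)

theorem CD.mono_or (h : CD M K rep κ ρ) (hS : S0 M) {x : M} (hx : x ∉ dcl (∅ : Set M)) :
    (∀ y z, T1 ∅ x y → T1 ∅ x z → y < z → ρ y < ρ z) ∨ (∀ y z, T1 ∅ x y → T1 ∅ x z → y < z → ρ z < ρ y) := by
  by_contra hcon
  push Not at hcon
  obtain ⟨⟨y, z, h1, h2, h3, h4⟩, ⟨y', z', h1', h2', h3', h4'⟩⟩ := hcon
  obtain ⟨θ, t1, t2, t3⟩ := h.θ hx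
  have hp := pair hS (h1.ndcl hx) (h1.symm.trans h2) (h1.symm.trans h1') (h1.symm.trans h2') h3 h3'
  obtain ⟨u, w, k1, k2, k3⟩ := hp (fun a b => ∃ u w, θ a u ∧ θ b w ∧ w ≤ u)
    (DP.ex (DP.ex (Q := fun v w => θ (v 1) (v 0) ∧ θ (v 2) w ∧ w ≤ v 0) ((t1.bind2 (DF.var 2) (DF.var 1)).and ((t1.bind2 (DF.var 3) (DF.var 0)).and
        (DP.le (DF.var 0) (DF.var 1)))))) ⟨_, _, t3 y h1, t3 z h2, h4⟩
  rw [t2 _ _ _ k1 (t3 y' h1'), t2 _ _ _ k2 (t3 z' h2')] at k3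
  exact h3'.ne (h.inj (h1'.ndcl hx) (h1'.symm.trans h2') (le_antisymm h4' k3))

/-- transport of isolation along the map to the representative -/
theorem CD.trans (h : CD M K rep κ ρ) (hS : S0 M) {x : M} (hx : x ∉ dcl (∅ : Set M)) :
    ((∀ y z, T1 ∅ x y → T1 ∅ x z → y < z → ρ y < ρ z) ∧ (IU x → IU (rep (κ x))) ∧ (ID x → ID (rep (κ x)))) ∨
    ((∀ y z, T1 ∅ x y → T1 ∅ x z → y < z → ρ z < ρ y) ∧ (IU x → ID (rep (κ x))) ∧ (ID x → IU (rep (κ x)))) := by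
  obtain ⟨θ, t1, t2, t3⟩ := h.θ hx
  have inv := (h.a2 x hx).symm
  have ha := h.a1 x hx
  have dlt : DP (∅ : Set M) (fun v => v 1 < v 0) := DP.lt (DF.var 1) (DF.var 0)
  rcases h.mono_or hS hx with hm | hm
  · left
    refine ⟨hm, fun hU => ?_, fun hU => ?_⟩
    · refine Isol.inv (transU hU t1 t2 (t3 x (T1.refl _)) ha (R := fun a b => a < b) DP.lt0
        (fun a b h1 h2 => lt_asymm h1 h2) ?_) inv
      intro z w hz hlt hw
      rw [t2 _ _ _ hw (t3 z hz)]; exact hm x z (T1.refl _) hz hlt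
    · refine Isol.inv (transD hU t1 t2 (t3 x (T1.refl _)) ha (R := fun a b => b < a) dlt
        (fun a b h1 h2 => lt_asymm h1 h2) ?_) inv
      intro z w hz hlt hw
      rw [t2 _ _ _ hw (t3 z hz)]; exact hm z x hz (T1.refl _) hlt
  · right
    refine ⟨hm, fun hU => ?_, fun hU => ?_⟩
    · refine Isol.inv (transU hU t1 t2 (t3 x (T1.refl _)) ha (R := fun a b => b < a) dlt
        (fun a b h1 h2 => lt_asymm h1 h2) ?_) inv
      intro z w hz hlt hw
      rw [t2 _ _ _ hw (t3 z hz)]; exact hm x z (T1.refl _) hz hlt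
    · refine Isol.inv (transD hU t1 t2 (t3 x (T1.refl _)) ha (R := fun a b => a < b) DP.lt0
        (fun a b h1 h2 => lt_asymm h1 h2) ?_) inv
      intro z w hz hlt hw
      rw [t2 _ _ _ hw (t3 z hz)]; exact hm z x hz (T1.refl _) hlt

structure OKs (x : M) (D : Set M) : Prop where
  sub : ∀ y ∈ D, T1 ∅ x y
  ctb : D.Countable
  dense : Dense' D
  up : IU x → ¬ HMax D
  dn : ID x → ¬ HMin D
  ne : IU x → ID x → D.Nonempty

theorem build (h : CD M K rep κ ρ) (hT : TRIV M) (hS : S0 M) {D : K → Set M} (hD : ∀ k, OKs (rep k) (D k))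
    (hc : (⋃ k, D k).Countable) : ∃ N : CM M, ∀ k, N.1 ∩ {y | T1 ∅ (rep k) y} = D k := by
  classical
  set N : Set M := {y | y ∈ dcl (∅ : Set M) ∨ (y ∉ dcl (∅ : Set M) ∧ ρ y ∈ D (κ y))} with hN
  have hdcl : dcl N ⊆ N := by
    intro z hz
    by_cases hzE : z ∈ dcl (∅ : Set M)
    · exact Or.inl hzE
    rcases hT.gen hz with h1 | ⟨b, hb, h1⟩
    · exact Or.inl h1
    rcases hb with hb | ⟨hbE, hb⟩
    · exact (hzE (dcl_ins_sub hb h1)).elim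
    · have := h.b b z hbE hzE h1
      exact Or.inr ⟨hzE, by rw [this.1, this.2]; exact hb⟩
  have hcN : N.Countable := by
    refine (dcl_ctb hc).mono ?_
    rintro y (hy | ⟨hy, hy'⟩)
    · exact dcl_mono (Set.empty_subset _) hy
    · exact dcl_mono (by simpa using ⟨κ y, hy'⟩) (h.exch hy)
  -- pulling back an element of `D`
  have pull : ∀ x, x ∉ dcl (∅ : Set M) → ∀ r ∈ D (κ x), ∃ y ∈ N, T1 ∅ x y ∧ ρ y = r := by
    intro x hx r hr
    have h1 : T1 ∅ (ρ x) r := (h.a2 x hx).symm.trans ((hD (κ x)).sub r hr)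
    obtain ⟨y, hy⟩ := hom Set.countable_empty h1 x
    have hyE := hy.snd.ndcl hx
    have h2 := h.rec' ((hD (κ x)).sub r hr) hyE (hy.dcl (h.exch hx))
    exact ⟨y, Or.inr ⟨hyE, by rw [h2.1, h2.2]; exact hr⟩, hy.snd, h2.2⟩
  have push : ∀ x, x ∉ dcl (∅ : Set M) → ∀ y ∈ N, T1 ∅ x y → ρ y ∈ D (κ x) := by
    intro x hx y hy hxy
    rcases hy with hy | ⟨_, hy⟩
    · exact (hxy.ndcl hx hy).elim
    · rw [(h.c x y hx hxy).1] at hy; exact hy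
  -- `ρ` reflects the order
  have hup : ∀ x, x ∉ dcl (∅ : Set M) → IU x → ∀ a ∈ N, T1 ∅ x a → ∃ y ∈ N, T1 ∅ x y ∧ a < y := by
    intro x hx hU a ha hxa
    have h1 := push x hx a ha hxa
    rcases h.trans hS hx with ⟨hm, h2, -⟩ | ⟨hm, h2, -⟩
    · have := (hD (κ x)).up (h2 hU)
      unfold HMax at this
      push Not at this
      obtain ⟨r, hr, hr'⟩ := this _ h1
      obtain ⟨y, y1, y2, rfl⟩ := pull x hx r hr
      refine ⟨y, y1, y2, not_le.1 fun hle => ?_⟩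
      rcases hle.eq_or_lt with rfl | hlt
      · exact lt_irrefl _ hr'
      · exact lt_asymm hr' (hm y a y2 hxa hlt)
    · have := (hD (κ x)).dn (h2 hU)
      unfold HMin at this
      push Not at this
      obtain ⟨r, hr, hr'⟩ := this _ h1
      obtain ⟨y, y1, y2, rfl⟩ := pull x hx r hr
      refine ⟨y, y1, y2, not_le.1 fun hle => ?_⟩
      rcases hle.eq_or_lt with rfl | hlt
      · exact lt_irrefl _ hr'
      · exact lt_asymm hr' (hm y a y2 hxa hlt)
  have hdn : ∀ x, x ∉ dcl (∅ : Set M) → ID x → ∀ a ∈ N, T1 ∅ x a → ∃ y ∈ N, T1 ∅ x y ∧ y < a := by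
    intro x hx hU a ha hxa
    have h1 := push x hx a ha hxa
    rcases h.trans hS hx with ⟨hm, -, h2⟩ | ⟨hm, -, h2⟩
    · have := (hD (κ x)).dn (h2 hU)
      unfold HMin at this
      push Not at this
      obtain ⟨r, hr, hr'⟩ := this _ h1
      obtain ⟨y, y1, y2, rfl⟩ := pull x hx r hr
      refine ⟨y, y1, y2, not_le.1 fun hle => ?_⟩
      rcases hle.eq_or_lt with rfl | hlt
      · exact lt_irrefl _ hr'
      · exact lt_asymm hr' (hm a y hxa y2 hlt)
    · have := (hD (κ x)).up (h2 hU)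
      unfold HMax at this
      push Not at this
      obtain ⟨r, hr, hr'⟩ := this _ h1
      obtain ⟨y, y1, y2, rfl⟩ := pull x hx r hr
      refine ⟨y, y1, y2, not_le.1 fun hle => ?_⟩
      rcases hle.eq_or_lt with rfl | hlt
      · exact lt_irrefl _ hr'
      · exact lt_asymm hr' (hm a y hxa y2 hlt)
  have hne : ∀ x, x ∉ dcl (∅ : Set M) → IU x → ID x → ∃ y ∈ N, T1 ∅ x y := by
    intro x hx hU hV
    have : (D (κ x)).Nonempty := by
      rcases h.trans hS hx with ⟨-, h1, h2⟩ | ⟨-, h1, h2⟩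
      · exact (hD (κ x)).ne (h1 hU) (h2 hV)
      · exact (hD (κ x)).ne (h2 hV) (h1 hU)
    obtain ⟨r, hr⟩ := this
    obtain ⟨y, y1, y2, rfl⟩ := pull x hx r hr
    exact ⟨y, y1, y2⟩
  have hbt : ∀ x, x ∉ dcl (∅ : Set M) → ∀ a ∈ N, T1 ∅ x a → ∀ b ∈ N, T1 ∅ x b → a < b → ∃ y ∈ N, a < y ∧ y < b := by
    intro x hx a ha hxa b hb hxb hab
    have h1 := push x hx a ha hxa
    have h2 := push x hx b hb hxb
    rcases h.mono_or hS hx with hm | hm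
    · obtain ⟨r, hr, r1, r2⟩ := (hD (κ x)).dense _ h1 _ h2 (hm a b hxa hxb hab)
      obtain ⟨y, y1, y2, rfl⟩ := pull x hx r hr
      refine ⟨y, y1, not_le.1 fun hle => ?_, not_le.1 fun hle => ?_⟩
      · rcases hle.eq_or_lt with rfl | hlt
        · exact lt_irrefl _ r1
        · exact lt_asymm r1 (hm y a y2 hxa hlt)
      · rcases hle.eq_or_lt with rfl | hlt
        · exact lt_irrefl _ r2
        · exact lt_asymm r2 (hm b y hxb y2 hlt)
    · obtain ⟨r, hr, r1, r2⟩ := (hD (κ x)).dense _ h2 _ h1 (hm a b hxa hxb hab)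
      obtain ⟨y, y1, y2, rfl⟩ := pull x hx r hr
      refine ⟨y, y1, not_le.1 fun hle => ?_, not_le.1 fun hle => ?_⟩
      · rcases hle.eq_or_lt with rfl | hlt
        · exact lt_irrefl _ r2
        · exact lt_asymm r2 (hm y a y2 hxa hlt)
      · rcases hle.eq_or_lt with rfl | hlt
        · exact lt_irrefl _ r1
        · exact lt_asymm r1 (hm b y hxb y2 hlt)
  have hEl : Elem N := by
    refine tv hdcl ?_
    rintro l r hl hr ⟨x, hlx, hrx⟩
    by_cases hx : x ∈ dcl (∅ : Set M)
    · exact ⟨x, Or.inl hx, hlx, hrx⟩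
    rcases extL hl hlx hx with ⟨a, ha, hxa, hax, hla⟩ | ⟨hl1, hl2⟩ <;>
      rcases extR hr hrx hx with ⟨b, hb, hxb, hbx, hrb⟩ | ⟨hr1, hr2⟩
    · obtain ⟨y, hy, y1, y2⟩ := hbt x hx a ha hxa b hb hxb (hax.trans hbx)
      exact ⟨y, hy, (hla y).2 y1, (hrb y).2 y2⟩
    · rcases hr2 with hU | ⟨f, hf, f1, f2⟩
      · obtain ⟨y, hy, y1, y2⟩ := hup x hx hU a ha hxa
        exact ⟨y, hy, (hla y).2 y2, hr1 y y1⟩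
      · exact ⟨f, Or.inl hf, hl.up hlx f1.le, f2⟩
    · rcases hl2 with hU | ⟨f, hf, f1, f2⟩
      · obtain ⟨y, hy, y1, y2⟩ := hdn x hx hU b hb hxb
        exact ⟨y, hy, hl1 y y1, (hrb y).2 y2⟩
      · exact ⟨f, Or.inl hf, f2, hr.down hrx f1.le⟩
    · rcases hr2 with hU | ⟨f, hf, f1, f2⟩
      · rcases hl2 with hV | ⟨f, hf, f1, f2⟩
        · obtain ⟨y, hy, y1⟩ := hne x hx hU hV
          exact ⟨y, hy, hl1 y y1, hr1 y y1⟩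
        · exact ⟨f, Or.inl hf, f2, hr.down hrx f1.le⟩
      · exact ⟨f, Or.inl hf, hl.up hlx f1.le, f2⟩
  refine ⟨⟨N, hEl, hcN⟩, fun k => ?_⟩
  ext y
  constructor
  · rintro ⟨hy | ⟨hyE, hy⟩, hy2⟩
    · exact (T1.ndcl hy2 (h.nE k) hy).elim
    · obtain ⟨h1, h2⟩ := h.d k y hy2
      rw [h1, h2] at hy
      exact hy
  · intro hy
    have hy2 := (hD k).sub y hy
    obtain ⟨h1, h2⟩ := h.d k y hy2
    exact ⟨Or.inr ⟨hy2.ndcl (h.nE k), by rw [h1, h2]; exact hy⟩, hy2⟩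

theorem isolU {N : Set M} (hN : Elem N) {x : M} (hx : x ∉ dcl (∅ : Set M)) (h : IU x) :
    ¬ HMax (N ∩ {y | T1 ∅ x y}) := by
  rintro ⟨m, ⟨hm, hxm⟩, h1⟩
  obtain ⟨S, s1, s2, s3⟩ := h
  obtain ⟨d, hd, hd'⟩ := nbR s1 (hxm S s1 s2) (T1.ndcl hxm hx)
  obtain ⟨z, hz, z1, z2⟩ := hN (fun z => m < z ∧ S z) ((DP.lt (DF.par hm) (DF.var 0)).and (s1.mono (Set.empty_subset _)))
    ⟨d, hd, hd' d le_rfl hd.le⟩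
  exact absurd z1 (not_lt.2 (h1 z ⟨hz, s3 m z hxm z1 z2⟩))

theorem isolD {N : Set M} (hN : Elem N) {x : M} (hx : x ∉ dcl (∅ : Set M)) (h : ID x) :
    ¬ HMin (N ∩ {y | T1 ∅ x y}) := @isolU M (OM.dual M) N hN x hx h

theorem isolated {x : M} (hU : IU x) (hD : ID x) :
    ∃ S : M → Prop, DP (∅ : Set M) (fun v => S (v 0)) ∧ S x ∧ ∀ z, S z → T1 ∅ x z := by
  obtain ⟨S, s1, s2, s3⟩ := hU
  obtain ⟨S', s1', s2', s3'⟩ := hD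
  refine ⟨fun z => S z ∧ S' z, s1.and s1', ⟨s2, s2'⟩, fun z hz => ?_⟩
  rcases lt_trichotomy x z with h | h | h
  · exact s3 x z (T1.refl _) h hz.1
  · exact h ▸ T1.refl _
  · exact s3' x z (T1.refl _) h hz.2

theorem btwN (hND : ND M) {N : Set M} (hN : Elem N) {a b : M} (ha : a ∈ N) (hb : b ∈ N) (haE : a ∉ dcl (∅ : Set M))
    (hab : a < b) : ∃ z ∈ N, a < z ∧ z < b := by
  refine hN (fun z => a < z ∧ z < b) ((DP.lt (DF.par ha) (DF.var 0)).and (DP.lt (DF.var 0) (DF.par hb))) ?_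
  by_contra hcon
  push Not at hcon
  exact hND a haE ⟨b, hab, fun z h1 h2 => absurd h2 (not_lt.2 (hcon z h1))⟩

theorem elem_oks (hND : ND M) (N : CM M) {x : M} (hx : x ∉ dcl (∅ : Set M)) : OKs x (N.1 ∩ {y | T1 ∅ x y}) where
  sub := fun y hy => hy.2
  ctb := N.2.2.mono Set.inter_subset_left
  dense := by
    rintro a ⟨ha, hxa⟩ b ⟨hb, hxb⟩ hab
    have haE := T1.ndcl hxa hx
    obtain ⟨z, hz, h1, h2⟩ := btwN hND N.2.1 ha hb haE hab
    exact ⟨z, ⟨hz, T1.trans hxa (convT h1 h2 (T1.trans (T1.symm hxa) hxb) haE)⟩, h1, h2⟩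
  up := isolU N.2.1 hx
  dn := isolD N.2.1 hx
  ne := by
    intro hU hD
    obtain ⟨S, s1, s2, s3⟩ := isolated hU hD
    obtain ⟨z, hz, hSz⟩ := N.2.1 S (s1.mono (Set.empty_subset _)) ⟨x, s2⟩
    exact ⟨z, hz, s3 z hSz⟩

end QOM

namespace QOM
open OM Cardinal
variable {M : Type} [OM M] {A B V C : Set M} {D D' : Set M}
variable {K : Type} {rep : K → M} {κ : M → K} {ρ : M → M}

def cmx : Code → Bool
  | none => false
  | some none => true
  | some (some (_, b)) => b
def cmn : Code → Bool
  | none => false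
  | some none => true
  | some (some (b, _)) => b

theorem cd_none : cd D = none ↔ D = ∅ := by
  classical
  unfold cd
  split_ifs with h1 h2 <;> simp [h1]

theorem cd_mx : cmx (cd D) = true ↔ HMax D := by
  classical
  unfold cd
  split_ifs with h1 h2
  · subst h1
    simp [cmx, HMax]
  · simp only [cmx, true_iff]
    obtain ⟨a, ha⟩ := Set.nonempty_iff_ne_empty.2 h1
    exact ⟨a, ha, fun y hy => (h2 hy ha).le⟩
  · simp [cmx]

theorem cd_mn : cmn (cd D) = true ↔ HMin D := by
  classical
  unfold cd
  split_ifs with h1 h2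
  · subst h1
    simp [cmn, HMin]
  · simp only [cmn, true_iff]
    obtain ⟨a, ha⟩ := Set.nonempty_iff_ne_empty.2 h1
    exact ⟨a, ha, fun y hy => (h2 ha hy).le⟩
  · simp [cmn]

theorem exists_above (hN : ND M) {x : M} (hx : x ∉ dcl (∅ : Set M)) : ∃ b, x < b ∧ T1 ∅ x b := by
  obtain ⟨b, hb⟩ := (vok_nd hN hx (B := {x}) (sub_dcl (by simp)) (Set.countable_singleton x)).ex
    (A := {x}) (Set.countable_singleton x)
  have hxb : x < b := hb.1 x rfl
  refine ⟨b, hxb, cut_T1 hx (fun h => hb.not (dcl_mono (Set.empty_subset _) h)) fun e he => ⟨fun h => h.trans hxb, fun h => ?_⟩⟩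
  by_contra hcon
  have h1 : x < e := lt_of_le_of_ne (not_lt.1 hcon) (fun hh => hx (hh ▸ he))
  exact lt_asymm h (hb.2 e (dcl_mono (Set.empty_subset _) he) (by
    intro v hv
    have : v = x := hv
    rw [this]; exact h1))

theorem Elem_univ : Elem (Set.univ : Set M) := fun S _ ⟨x, hx⟩ => ⟨x, trivial, hx⟩

theorem real1 (hN : ND M) {x : M} (hx : x ∉ dcl (∅ : Set M)) (c : Code) :
    ∃ D : Set M, (∀ y ∈ D, T1 ∅ x y) ∧ D.Countable ∧ Dense' D ∧ cd D = c := by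
  classical
  rcases c with _ | _ | ⟨p, q⟩
  · exact ⟨∅, by simp, by simp, fun x hx => hx.elim, cd_none.2 rfl⟩
  · refine ⟨{x}, ?_, by simp, ?_, ?_⟩
    · rintro y rfl
      exact T1.refl _
    · rintro y rfl z rfl h
      exact (lt_irrefl _ h).elim
    · unfold cd
      rw [if_neg (by simp), if_pos (by simp)]
  obtain ⟨b, hxb, hT⟩ := exists_above hN hx
  obtain ⟨N, -, hsub, hNc, hNE⟩ := dls (B := {x, b}) Elem_univ (Set.subset_univ _) (by simp)
  have hxN : x ∈ N := hsub (by simp)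
  have hbN : b ∈ N := hsub (by simp)
  set D : Set M := {y | y ∈ N ∧ (x < y ∨ (p = true ∧ y = x)) ∧ (y < b ∨ (q = true ∧ y = b))} with hD
  have hsubT : ∀ y ∈ D, T1 ∅ x y := by
    rintro y ⟨-, h1 | ⟨-, h1⟩, h2 | ⟨-, h2⟩⟩
    · exact convT h1 h2 hT hx
    · exact h2 ▸ hT
    · exact h1 ▸ T1.refl _
    · exact h1 ▸ T1.refl _
  have hin : ∀ z ∈ N, x < z → z < b → z ∈ D := fun z hz h1 h2 => ⟨hz, Or.inl h1, Or.inl h2⟩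
  have hge : ∀ y ∈ D, x ≤ y := by
    rintro y ⟨-, h1 | ⟨-, h1⟩, -⟩
    · exact h1.le
    · exact h1.ge
  have hle : ∀ y ∈ D, y ≤ b := by
    rintro y ⟨-, -, h1 | ⟨-, h1⟩⟩
    · exact h1.le
    · exact h1.le
  obtain ⟨z1, hz1, k1, k2⟩ := btwN hN hNE hxN hbN hx hxb
  have hz1E : z1 ∉ dcl (∅ : Set M) := (hsubT z1 (hin z1 hz1 k1 k2)).ndcl hx
  obtain ⟨z2, hz2, k3, k4⟩ := btwN hN hNE hz1 hbN hz1E k2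
  refine ⟨D, hsubT, hNc.mono fun y hy => hy.1, ?_, ?_⟩
  · intro y hy z hz hyz
    obtain ⟨w, hw, h1, h2⟩ := btwN hN hNE hy.1 hz.1 ((hsubT y hy).ndcl hx) hyz
    exact ⟨w, hin w hw (lt_of_le_of_lt (hge y hy) h1) (lt_of_lt_of_le h2 (hle z hz)), h1, h2⟩
  · unfold cd
    rw [if_neg (Set.nonempty_iff_ne_empty.1 ⟨z1, hin z1 hz1 k1 k2⟩), if_neg (fun h =>
      k3.ne (h (hin z1 hz1 k1 k2) (hin z2 hz2 (k1.trans k3) k4)))]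
    have hmin : HMin D ↔ p = true := by
      constructor
      · rintro ⟨m, hm, hm'⟩
        rcases hm.2.1 with h | ⟨h, -⟩
        · obtain ⟨w, hw, h1, h2⟩ := btwN hN hNE hxN hm.1 hx h
          exact absurd (hm' w (hin w hw h1 (lt_of_lt_of_le h2 (hle m hm)))) (not_le.2 h2)
        · exact h
      · intro h
        exact ⟨x, ⟨hxN, Or.inr ⟨h, rfl⟩, Or.inl hxb⟩, hge⟩
    have hmax : HMax D ↔ q = true := by
      constructor
      · rintro ⟨m, hm, hm'⟩
        rcases hm.2.2 with h | ⟨h, -⟩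
        · obtain ⟨w, hw, h1, h2⟩ := btwN hN hNE hm.1 hbN ((hsubT m hm).ndcl hx) h
          exact absurd (hm' w (hin w hw (lt_of_le_of_lt (hge m hm) h1) h2)) (not_le.2 h1)
        · exact h
      · intro h
        exact ⟨b, ⟨hbN, Or.inl hxb, Or.inr ⟨h, rfl⟩⟩, hle⟩
    simp [hmin, hmax]

def Al (u d : Bool) (c : Code) : Prop :=
  (u = true → cmx c = false) ∧ (d = true → cmn c = false) ∧ (u = true → d = true → c ≠ none)

instance (u d : Bool) : DecidablePred (Al u d) := fun c => by unfold Al; infer_instance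

theorem Al_ff : Fintype.card {c // Al false false c} = 6 := by decide
theorem Al_tf : Fintype.card {c // Al true false c} = 3 := by decide
theorem Al_ft : Fintype.card {c // Al false true c} = 3 := by decide
theorem Al_tt : ∀ c, Al true true c ↔ c = some (some (false, false)) := by decide

open Classical in
noncomputable def uu (x : M) : Bool := decide (IU x)
open Classical in
noncomputable def dd (x : M) : Bool := decide (ID x)

theorem OKs.al {x : M} (h : OKs x D) : Al (uu x) (dd x) (cd D) := by
  classical
  refine ⟨fun hu => ?_, fun hd => ?_, fun hu hd hc => ?_⟩
  · rw [← Bool.not_eq_true, cd_mx]; exact h.up (by simpa [uu] using hu)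
  · rw [← Bool.not_eq_true, cd_mn]; exact h.dn (by simpa [dd] using hd)
  · have := h.ne (by simpa [uu] using hu) (by simpa [dd] using hd)
    rw [cd_none.1 hc] at this
    simp at this

theorem OKs.of_al {x : M} (h1 : ∀ y ∈ D, T1 ∅ x y) (h2 : D.Countable) (h3 : Dense' D)
    (h : Al (uu x) (dd x) (cd D)) : OKs x D := by
  classical
  obtain ⟨a, b, c⟩ := h
  refine ⟨h1, h2, h3, fun hu => ?_, fun hd => ?_, fun hu hd => ?_⟩
  · rw [← cd_mx, a (by simpa [uu] using hu)]; simp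
  · rw [← cd_mn, b (by simpa [dd] using hd)]; simp
  · rw [Set.nonempty_iff_ne_empty]
    exact fun he => c (by simpa [uu] using hu) (by simpa [dd] using hd) (cd_none.2 he)

theorem realize (h : CD M K rep κ ρ) (hT : TRIV M) (hS : S0 M) (hN : ND M) (c : K → Code)
    (hc : ∀ k, Al (uu (rep k)) (dd (rep k)) (c k)) (hcc : {k | c k ≠ none}.Countable) :
    ∃ N : CM M, ∀ k, cd (N.1 ∩ {y | T1 ∅ (rep k) y}) = c k := by
  choose D h1 h2 h3 h4 using fun k => real1 hN (h.nE k) (c k)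
  obtain ⟨N, hN'⟩ := build h hT hS (D := D) (fun k => OKs.of_al (h1 k) (h2 k) (h3 k) ((h4 k).symm ▸ hc k)) (by
    have : (⋃ k, D k) ⊆ ⋃ k ∈ {k | c k ≠ none}, D k := by
      intro y hy
      obtain ⟨k, hk⟩ := Set.mem_iUnion.1 hy
      refine Set.mem_biUnion (x := k) (fun hn => ?_) hk
      rw [← h4 k, cd_none] at hn
      rw [hn] at hk
      exact hk
    exact (hcc.biUnion fun k _ => h2 k).mono this)
  exact ⟨N, fun k => by rw [hN' k, h4 k]⟩

theorem iso_iff (h : CD M K rep κ ρ) (hT : TRIV M) (hS : S0 M) (hN : ND M) (N N' : CM M) :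
    (isoS M).r N N' ↔ ∀ k, cd (N.1 ∩ {y | T1 ∅ (rep k) y}) = cd (N'.1 ∩ {y | T1 ∅ (rep k) y}) := by
  constructor
  · rintro ⟨σ, hσ⟩ k
    exact (hσ.oi (rep k)).cd
  · intro hc
    refine iso_of hT hS h N.2.1.dcl N'.2.1.dcl fun k => ?_
    have h1 := elem_oks hN N (h.nE k)
    have h2 := elem_oks hN N' (h.nE k)
    exact OI.of_cd h1.ctb h2.ctb h1.dense h2.dense (hc k)

theorem iso_ctb (h : CD M K rep κ ρ) : {k | uu (rep k) = true ∧ dd (rep k) = true}.Countable := by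
  classical
  have key : ∀ k, ∃ S : M → Prop, (uu (rep k) = true ∧ dd (rep k) = true) →
      DP (∅ : Set M) (fun v => S (v 0)) ∧ S (rep k) ∧ ∀ z, S z → T1 ∅ (rep k) z := by
    intro k
    by_cases hk : uu (rep k) = true ∧ dd (rep k) = true
    · obtain ⟨S, hS⟩ := isolated (x := rep k) (by simpa [uu] using hk.1) (by simpa [dd] using hk.2)
      exact ⟨S, fun _ => hS⟩
    · exact ⟨fun _ => True, fun h => (hk h).elim⟩
  choose S hS using key
  refine Set.MapsTo.countable_of_injOn (f := fun k => (fun v : ℕ → M => S k (v 0))) (t := {P | OM.dp (∅ : Set M) P})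
    (fun k hk => (hS k hk).1) ?_ (OM.ctb Set.countable_empty)
  intro k hk k' hk' he
  have h1 : S k (rep k') := by
    have h0 : S k (rep k') = S k' (rep k') := congrFun he (fun _ => rep k')
    rw [h0]
    exact (hS k' hk').2.1
  have h2 := (hS k hk).2.2 _ h1
  rw [← (h.d k _ h2).1, (h.d k' _ (T1.refl _)).1]

theorem prod36 {ι : Type} [Fintype ι] (n : ι → ℕ) (h : ∀ i, n i = 3 ∨ n i = 6) :
    ∃ k s : ℕ, ∏ i, n i = 3 ^ k * 6 ^ s := by
  classical
  have : ∀ F : Finset ι, ∃ k s : ℕ, ∏ i ∈ F, n i = 3 ^ k * 6 ^ s := by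
    intro F
    induction F using Finset.induction_on with
    | empty => exact ⟨0, 0, by simp⟩
    | insert a F ha ih =>
      obtain ⟨k, s, hk⟩ := ih
      rw [Finset.prod_insert ha, hk]
      rcases h a with h | h <;> rw [h]
      · exact ⟨k+1, s, by ring⟩
      · exact ⟨k, s+1, by ring⟩
  exact this Finset.univ

theorem case3 (hT : TRIV M) (hS : S0 M) (hN : ND M) :
    #(Quotient (isoS M)) = 2 ^ aleph0.{0} ∨ ∃ k s : ℕ, #(Quotient (isoS M)) = ((3 ^ k * 6 ^ s : ℕ) : Cardinal) := by
  classical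
  by_cases hne : ∃ x : M, x ∉ dcl (∅ : Set M)
  swap
  · push Not at hne
    right
    refine ⟨0, 0, ?_⟩
    have hE : dcl (∅ : Set M) = Set.univ := Set.eq_univ_of_forall hne
    have hu : ∀ N : CM M, N.1 = Set.univ := fun N => by
      rw [← N.2.1.dcl]
      exact Set.eq_univ_of_forall fun x => dcl_mono (Set.empty_subset _) (hne x)
    have hc : (Set.univ : Set M).Countable := hE ▸ dcl_ctb Set.countable_empty
    have : #(Quotient (isoS M)) = 1 := by
      rw [eq_one_iff_unique]
      refine ⟨⟨fun a b => ?_⟩, ⟨Quotient.mk _ ⟨Set.univ, Elem_univ, hc⟩⟩⟩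
      induction a using Quotient.inductionOn with | _ a =>
      induction b using Quotient.inductionOn with | _ b =>
      have : a = b := Subtype.ext ((hu a).trans (hu b).symm)
      rw [this]
    simp [this]
  obtain ⟨K, rep, κ, ρ, h⟩ := CD.exists hS hne
  let Kn := {k : K // ¬ (uu (rep k) = true ∧ dd (rep k) = true)}
  rcases finite_or_infinite Kn with hfin | hinf
  · right
    have hKc : Countable K := by
      rw [← Set.countable_univ_iff]
      have : (Set.univ : Set K) ⊆ {k | uu (rep k) = true ∧ dd (rep k) = true} ∪ {k | ¬ (uu (rep k) = true ∧ dd (rep k) = true)} :=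
        fun k _ => em _
      exact ((iso_ctb h).union (show Set.Countable {k | ¬ (uu (rep k) = true ∧ dd (rep k) = true)} from (Set.finite_coe_iff.1 hfin).countable)).mono this
    have := Fintype.ofFinite Kn
    let Φ : Quotient (isoS M) → ∀ k : Kn, {c // Al (uu (rep k.1)) (dd (rep k.1)) c} :=
      Quotient.lift (fun N k => ⟨cd (N.1 ∩ {y | T1 ∅ (rep k.1) y}), (elem_oks hN N (h.nE k.1)).al⟩)
        (fun N N' hNN => by
          funext k
          exact Subtype.ext ((iso_iff h hT hS hN N N').1 hNN k.1))
    have hΦ : Function.Bijective Φ := by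
      constructor
      · intro a b
        induction a using Quotient.inductionOn with | _ a =>
        induction b using Quotient.inductionOn with | _ b =>
        intro hab
        refine Quotient.sound ((iso_iff h hT hS hN a b).2 fun k => ?_)
        by_cases hk : uu (rep k) = true ∧ dd (rep k) = true
        · have h1 := (elem_oks hN a (h.nE k)).al
          have h2 := (elem_oks hN b (h.nE k)).al
          rw [hk.1, hk.2, Al_tt] at h1 h2
          rw [h1, h2]
        · exact congrArg Subtype.val (congrFun hab ⟨k, hk⟩)
      · intro c
        obtain ⟨N, hN'⟩ := realize h hT hS hN
          (fun k => if hk : uu (rep k) = true ∧ dd (rep k) = true then some (some (false, false)) else (c ⟨k, hk⟩).1)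
          (fun k => by
            by_cases hk : uu (rep k) = true ∧ dd (rep k) = true
            · rw [dif_pos hk, hk.1, hk.2, Al_tt]
            · rw [dif_neg hk]; exact (c ⟨k, hk⟩).2) (Set.to_countable _)
        refine ⟨Quotient.mk _ N, ?_⟩
        funext k
        apply Subtype.ext
        have := hN' k.1
        rw [dif_neg k.2] at this
        exact this
    rw [mk_congr (Equiv.ofBijective Φ hΦ), mk_fintype, Fintype.card_pi]
    obtain ⟨k, s, hks⟩ := prod36 (fun k : Kn => Fintype.card {c // Al (uu (rep k.1)) (dd (rep k.1)) c}) (by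
      rintro ⟨k, hk⟩
      dsimp only
      cases hu : uu (rep k) <;> cases hd : dd (rep k)
      · right; exact Al_ff
      · left; exact Al_ft
      · left; exact Al_tf
      · exact (hk ⟨hu, hd⟩).elim)
    exact ⟨k, s, by rw [hks]⟩
  · left
    refine le_antisymm upper ?_
    let g := Infinite.natEmbedding Kn
    let c : Set ℕ → K → Code := fun s k =>
      if (uu (rep k) = true ∧ dd (rep k) = true) ∨ ∃ n ∈ s, (g n).1 = k then some (some (false, false)) else none
    have ex : ∀ s, ∃ N : CM M, ∀ k, cd (N.1 ∩ {y | T1 ∅ (rep k) y}) = c s k := by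
      intro s
      refine realize h hT hS hN (c s) (fun k => ?_) ?_
      · simp only [c]
        split_ifs with hk
        · exact ⟨fun _ => rfl, fun _ => rfl, fun _ _ => by simp⟩
        · exact ⟨fun _ => rfl, fun _ => rfl, fun h1 h2 => (hk (Or.inl ⟨h1, h2⟩)).elim⟩
      · refine ((iso_ctb h).union (Set.countable_range fun n => (g n).1)).mono fun k hk => ?_
        simp only [c, Set.mem_setOf_eq] at hk
        split_ifs at hk with h1
        · rcases h1 with h1 | ⟨n, -, hn⟩
          · exact Or.inl h1
          · exact Or.inr ⟨n, hn⟩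
        · exact (hk rfl).elim
    choose N hN' using ex
    have hinj : Function.Injective fun s : Set ℕ => (Quotient.mk (isoS M) (N s)) := by
      intro s t hst
      have h1 := (iso_iff h hT hS hN _ _).1 (Quotient.exact hst)
      ext n
      have h2 := h1 (g n).1
      rw [hN', hN'] at h2
      have h3 : ∀ s, c s (g n).1 = some (some (false, false)) ↔ n ∈ s := by
        intro s
        simp only [c]
        constructor
        · intro hh
          split_ifs at hh with h4
          rcases h4 with h4 | ⟨m, hm, hmn⟩
          · exact ((g n).2 h4).elim
          · have := g.injective (Subtype.ext hmn)
            exact this ▸ hm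
        · intro hn
          rw [if_pos (Or.inr ⟨n, hn, rfl⟩)]
      rw [← h3 s, ← h3 t, h2]
    have := mk_le_of_injective hinj
    rwa [mk_set, mk_nat] at this

theorem abstract_main (M : Type) [OM M] :
    #(Quotient (isoS M)) = 2 ^ aleph0.{0} ∨ ∃ k s : ℕ, #(Quotient (isoS M)) = ((3 ^ k * 6 ^ s : ℕ) : Cardinal) := by
  by_cases h1 : ND M
  swap
  · exact Or.inl (le_antisymm upper (caseA0 h1))
  by_cases h2 : @ND M (OM.dual M)
  swap
  · exact Or.inl (le_antisymm upper (caseA0' h2))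
  by_cases h3 : NC M
  swap
  · exact Or.inl (le_antisymm upper (caseA1 h3))
  have hT : TRIV M := fun C z b1 b2 hC hz => triv2 h1 h2 h3 hC hz
  by_cases h4 : S0 M
  swap
  · exact Or.inl (le_antisymm upper (caseA2 hT h4))
  exact case3 hT h4 h1

end QOM

namespace QOM

section glue
variable {L : FirstOrder.Language.{u, v}}

/-- definable predicates of a structure -/
def gdp (L : FirstOrder.Language.{u, v}) (M : Type) [L.Structure M] (A : Set M) (P : (ℕ → M) → Prop) : Prop :=
  ∃ φ : L.Formula (A ⊕ ℕ), ∀ v : ℕ → M, P v ↔ φ.Realize (Sum.elim (fun a : A => (a : M)) v)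

variable {M : Type} [L.Structure M] {A B : Set M} {P Q : (ℕ → M) → Prop}

theorem gdp.mono (h : A ⊆ B) (hP : gdp L M A P) : gdp L M B P := by
  obtain ⟨φ, hφ⟩ := hP
  refine ⟨φ.relabel (Sum.map (Set.inclusion h) id), fun v => ?_⟩
  rw [hφ, Formula.realize_relabel]
  congr! 1
  ext x; rcases x with x | x <;> rfl

theorem gdp.and (hP : gdp L M A P) (hQ : gdp L M A Q) : gdp L M A (fun v => P v ∧ Q v) := by
  obtain ⟨φ, hφ⟩ := hP
  obtain ⟨ψ, hψ⟩ := hQ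
  exact ⟨φ ⊓ ψ, fun v => by show P v ∧ Q v ↔ _; rw [hφ, hψ, Formula.realize_inf]⟩

theorem gdp.not (hP : gdp L M A P) : gdp L M A (fun v => ¬ P v) := by
  obtain ⟨φ, hφ⟩ := hP
  exact ⟨φ.not, fun v => by show ¬ P v ↔ _; rw [hφ, Formula.realize_not]⟩

theorem gdp.ex (hP : gdp L M A P) : gdp L M A (fun v => ∃ y, P (cons y v)) := by
  obtain ⟨φ, hφ⟩ := hP
  let s : A ⊕ ℕ → (A ⊕ ℕ) ⊕ Unit := fun x => match x with
    | Sum.inl a => Sum.inl (Sum.inl a)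
    | Sum.inr 0 => Sum.inr ()
    | Sum.inr (i+1) => Sum.inl (Sum.inr i)
  refine ⟨(φ.relabel s).iExs Unit, fun v => ?_⟩
  rw [Formula.realize_iExs]
  have key : ∀ i : Unit → M, (φ.relabel s).Realize (Sum.elim (Sum.elim (fun a : A => (a : M)) v) i) ↔ P (cons (i ()) v) := by
    intro i
    rw [Formula.realize_relabel, hφ]
    congr! 1
    ext x; rcases x with x | (_ | x) <;> rfl
  simp only [key]
  exact ⟨fun ⟨y, hy⟩ => ⟨fun _ => y, hy⟩, fun ⟨i, hi⟩ => ⟨_, hi⟩⟩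

theorem gdp.ren (s : ℕ → ℕ) (hP : gdp L M A P) : gdp L M A (fun v => P (fun i => v (s i))) := by
  obtain ⟨φ, hφ⟩ := hP
  refine ⟨φ.relabel (Sum.map id s), fun v => ?_⟩
  show P _ ↔ _
  rw [hφ, Formula.realize_relabel]
  congr! 1
  ext x; rcases x with x | x <;> rfl

theorem gdp.eq0 : gdp L M ∅ (fun v => v 0 = v 1) :=
  ⟨Term.equal (Term.var (Sum.inr 0)) (Term.var (Sum.inr 1)), fun v => by
    simp [Formula.realize_equal]⟩

theorem gdp.lt0 (lt : L.Relations 2) : gdp L M ∅ (fun v => ltInterp lt (v 0) (v 1)) :=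
  ⟨lt.formula₂ (Term.var (Sum.inr 0)) (Term.var (Sum.inr 1)), fun v => by
    rw [Formula.realize_rel₂]; simp [ltInterp]⟩

theorem gdp.cst (a : M) : gdp L M {a} (fun v => v 0 = a) :=
  ⟨Term.equal (Term.var (Sum.inr 0)) (Term.var (Sum.inl ⟨a, rfl⟩)), fun v => by
    simp [Formula.realize_equal]⟩

theorem gdp.extr {a : M} (hP : gdp L M (insert a A) P) :
    ∃ P', gdp L M A P' ∧ ∀ v, P v ↔ P' (cons a v) := by
  classical
  obtain ⟨φ, hφ⟩ := hP
  let s : ↑(insert a A) ⊕ ℕ → A ⊕ ℕ := fun x => match x with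
    | Sum.inl b => if h : (b : M) ∈ A then Sum.inl ⟨b, h⟩ else Sum.inr 0
    | Sum.inr i => Sum.inr (i+1)
  refine ⟨_, ⟨φ.relabel s, fun v => Iff.rfl⟩, fun v => ?_⟩
  rw [hφ, Formula.realize_relabel]
  congr! 1
  ext x; rcases x with ⟨x, hx⟩ | x
  · simp only [Function.comp, s]
    split_ifs with h
    · rfl
    · rcases hx with rfl | hx
      · rfl
      · exact (h hx).elim
  · rfl

theorem gdp.fin (hP : gdp L M A P) : ∃ F : Finset M, ↑F ⊆ A ∧ gdp L M (↑F : Set M) P := by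
  classical
  obtain ⟨φ, hφ⟩ := hP
  let F : Finset M := φ.freeVarFinset.biUnion (fun x => match x with
    | Sum.inl a => {(a : M)}
    | Sum.inr _ => ∅)
  have hF : ∀ a : A, Sum.inl a ∈ φ.freeVarFinset → (a : M) ∈ (↑F : Set M) := by
    intro a ha
    exact Finset.mem_biUnion.2 ⟨_, ha, by simp⟩
  refine ⟨F, ?_, φ.restrictFreeVar (fun x => match x with
    | ⟨Sum.inl a, h⟩ => Sum.inl ⟨a, hF a h⟩
    | ⟨Sum.inr i, _⟩ => Sum.inr i), fun v => ?_⟩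
  · intro x hx
    obtain ⟨y, hy, hxy⟩ := Finset.mem_biUnion.1 (Finset.mem_coe.1 hx)
    rcases y with y | y
    · have := Finset.mem_singleton.1 hxy
      rw [this]; exact y.2
    · simp at hxy
  · rw [hφ]
    symm
    refine BoundedFormula.realize_restrictFreeVar _ ?_
    rintro ⟨x | x, hx⟩ <;> rfl

theorem realize_congr_fv {α : Type} {φ : L.Formula α} [DecidableEq α] {v w : α → M}
    (h : ∀ a ∈ φ.freeVarFinset, v a = w a) : φ.Realize v ↔ φ.Realize w := by
  have h1 := BoundedFormula.realize_restrictFreeVar (φ := φ) (f := id) (v := fun a => v a.1) (xs := (default : Fin 0 → M)) v (fun a => rfl)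
  have h2 := BoundedFormula.realize_restrictFreeVar (φ := φ) (f := id) (v := fun a => v a.1) (xs := (default : Fin 0 → M)) w (fun a => h _ a.2)
  exact h1.symm.trans h2

theorem gdp.fv (hP : gdp L M A P) : ∃ n : ℕ, ∀ v w : ℕ → M, (∀ i < n, v i = w i) → P v → P w := by
  classical
  obtain ⟨φ, hφ⟩ := hP
  refine ⟨φ.freeVarFinset.sup (fun x => match x with
    | Sum.inl _ => 0
    | Sum.inr i => i + 1), fun v w h => ?_⟩
  rw [hφ, hφ]
  refine (realize_congr_fv ?_).1
  rintro (a | i) hi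
  · rfl
  · refine h i ?_
    have := Finset.le_sup (f := fun x : A ⊕ ℕ => match x with
      | Sum.inl _ => 0
      | Sum.inr i => i + 1) hi
    exact this

theorem gdp.ctb [Countable L.Symbols] (hA : A.Countable) : {P | gdp L M A P}.Countable := by
  have := hA.to_subtype
  refine (Set.countable_range (fun φ : L.Formula (A ⊕ ℕ) => fun v : ℕ → M => φ.Realize (Sum.elim (fun a : A => (a : M)) v))).mono ?_
  rintro P ⟨φ, hφ⟩
  exact ⟨φ, funext fun v => propext (hφ v).symm⟩

theorem gdp.dwp {S : M → Prop} (h : gdp L M Set.univ (fun v => S (v 0))) :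
    DefinableWithParams L M {x | S x} := by
  classical
  obtain ⟨F, -, φ, hφ⟩ := h.fin
  let e := F.equivFin
  refine ⟨F.card, φ.relabel (fun x => match x with
    | Sum.inl a => Sum.inl (e ⟨a.1, a.2⟩)
    | Sum.inr _ => Sum.inr 0), fun i => (e.symm i : M), ?_⟩
  ext x
  simp only [Set.mem_ofPred_eq]
  refine (hφ (fun _ => x)).trans ?_
  rw [Formula.realize_relabel]
  congr! 1
  ext y; rcases y with y | y
  · simp
  · rfl

section order
variable {lt : L.Relations 2}

theorem omin_conv (hM : OMinimalStructure lt M) {S : M → Prop} (h : gdp L M Set.univ (fun v => S (v 0))) :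
    ∃ (N : ℕ) (f : Fin N → Set M), (∀ x, S x ↔ ∃ i, x ∈ f i) ∧
      ∀ i, (∃ x, f i = {x}) ∨ ∃ a b : Option M, f i = OIntv (ltInterp lt) a b := by
  obtain ⟨N, f, h1, h2⟩ := hM.2 _ h.dwp
  refine ⟨N, f, fun x => ?_, h2⟩
  have : x ∈ {x | S x} ↔ x ∈ ⋃ i, f i := by rw [h1]
  simpa using this

/-- the order -/
@[reducible] noncomputable def glo (hM : OMinimalStructure lt M) : LinearOrder M where
  le a b := ¬ ltInterp lt b a
  lt a b := ltInterp lt a b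
  le_refl a := hM.1.1 a
  le_trans a b c h1 h2 h3 := by
    rcases hM.1.2.2 a b with h | h | h
    · exact h2 (hM.1.2.1 _ _ _ h3 h)
    · subst h; exact h2 h3
    · exact h1 h
  lt_iff_le_not_ge a b := by
    constructor
    · exact fun h => ⟨fun h' => hM.1.1 _ (hM.1.2.1 _ _ _ h h'), fun h' => h' h⟩
    · exact fun h => not_not.1 h.2
  le_antisymm a b h1 h2 := by
    rcases hM.1.2.2 a b with h | h | h
    · exact (h2 h).elim
    · exact h
    · exact (h1 h).elim
  le_total a b := by
    by_contra h
    push Not at h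
    exact hM.1.1 _ (hM.1.2.1 _ _ _ h.1 h.2)
  toDecidableLE := Classical.decRel _

theorem lo_conv [LinearOrder M] {N : ℕ} {f : Fin N → Set M}
    (hf : ∀ i, (∃ x, f i = {x}) ∨ ∃ a b : Option M, f i = OIntv (· < ·) a b) :
    ∀ i x y z, x ∈ f i → y ∈ f i → x ≤ z → z ≤ y → z ∈ f i := by
  intro i x y z hx hy h1 h2
  rcases hf i with ⟨c, hc⟩ | ⟨a, b, hab⟩
  · rw [hc] at hx hy ⊢
    have hx : x = c := hx
    have hy : y = c := hy
    subst hx; subst hy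
    exact le_antisymm h2 h1
  · rw [hab] at hx hy ⊢
    exact ⟨fun t ht => (hx.1 t ht).trans_le h1, fun t ht => h2.trans_lt (hy.2 t ht)⟩

theorem lo_cut [LinearOrder M] {N : ℕ} {f : Fin N → Set M} {S : M → Prop}
    (hS : ∀ x, S x ↔ ∃ i, x ∈ f i)
    (hf : ∀ i, (∃ x, f i = {x}) ∨ ∃ a b : Option M, f i = OIntv (· < ·) a b)
    (hd : ∀ x y, x ≤ y → S y → S x) :
    (∀ x, ¬ S x) ∨ (∀ x, S x) ∨ (∃ e, ∀ x, S x ↔ x < e) ∨ (∃ e, ∀ x, S x ↔ x ≤ e) := by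
  classical
  by_cases hA : ∀ x, S x
  · exact Or.inr (Or.inl hA)
  by_cases hE : ∀ x, ¬ S x
  · exact Or.inl hE
  push Not at hE hA
  obtain ⟨z, hz⟩ := hA
  have key : ∀ i, ∃ e, (f i).Nonempty → (∀ x ∈ f i, x ≤ e) ∧ (S e ∨ ∀ y, y < e → S y) := by
    intro i
    by_cases hi : (f i).Nonempty
    · obtain ⟨p, hp⟩ := hi
      rcases hf i with ⟨c, hc⟩ | ⟨a, b, hab⟩
      · refine ⟨c, fun _ => ⟨fun x hx => ?_, Or.inl ((hS c).2 ⟨i, by rw [hc]; rfl⟩)⟩⟩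
        rw [hc] at hx; exact le_of_eq hx
      · rcases b with _ | b
        · exfalso
          refine hz ?_
          rcases le_total z p with h | h
          · exact hd _ _ h ((hS p).2 ⟨i, hp⟩)
          · refine (hS z).2 ⟨i, ?_⟩
            rw [hab] at hp ⊢
            exact ⟨fun t ht => (hp.1 t ht).trans_le h, fun t ht => by simp at ht⟩
        · refine ⟨b, fun _ => ⟨fun x hx => ?_, Or.inr fun y hy => ?_⟩⟩
          · rw [hab] at hx; exact (hx.2 b rfl).le
          · rcases le_total y p with h | h
            · exact hd _ _ h ((hS p).2 ⟨i, hp⟩)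
            · refine (hS y).2 ⟨i, ?_⟩
              rw [hab] at hp ⊢
              refine ⟨fun t ht => (hp.1 t ht).trans_le h, fun t ht => ?_⟩
              have : b = t := by simpa using ht
              rw [← this]; exact hy
    · exact ⟨z, fun h => (hi h).elim⟩
  choose e he using key
  obtain ⟨x0, hx0⟩ := hE
  obtain ⟨i0, hi0⟩ := (hS x0).1 hx0
  let J : Finset (Fin N) := Finset.univ.filter (fun i => (f i).Nonempty)
  have hJ : J.Nonempty := ⟨i0, by simp only [J, Finset.mem_filter, Finset.mem_univ, true_and]; exact ⟨_, hi0⟩⟩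
  obtain ⟨m, hm, hmx⟩ := Finset.exists_max_image J e hJ
  have hm' : (f m).Nonempty := by simpa [J] using hm
  have hub : ∀ x, S x → x ≤ e m := by
    intro x hx
    obtain ⟨i, hi⟩ := (hS x).1 hx
    exact ((he i ⟨x, hi⟩).1 x hi).trans (hmx i (by simp only [J, Finset.mem_filter, Finset.mem_univ, true_and]; exact ⟨_, hi⟩))
  right; right
  by_cases hem : S (e m)
  · exact Or.inr ⟨e m, fun x => ⟨hub x, fun h => hd _ _ h hem⟩⟩
  · refine Or.inl ⟨e m, fun x => ⟨fun h => lt_of_le_of_ne (hub x h) (fun h' => hem (h' ▸ h)), fun h => ?_⟩⟩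
    rcases (he m hm').2 with h' | h'
    · exact (hem h').elim
    · exact h' x h

end order

/-- ultrapower -/
abbrev UP (M0 : Type) : Type := (Filter.hyperfilter ℕ : Filter ℕ).Product (fun _ => M0)

/-- class of a sequence -/
noncomputable def upmk {M0 : Type} (y : ℕ → M0) : UP M0 := Quotient.mk _ y

theorem up_sat {M0 : Type} [L.Structure M0] [Nonempty M0] (S : ℕ → UP M0 → Prop)
    (hS : ∀ n, gdp L (UP M0) Set.univ (fun v => S n (v 0))) (h : ∀ n, ∃ x, ∀ i ≤ n, S i x) :
    ∃ x, ∀ n, S n x := by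
  classical
  choose φ hφ using hS
  let rep : UP M0 → ℕ → M0 := Quotient.out
  have hrep : ∀ x, upmk (rep x) = x := fun x => Quotient.out_eq x
  let R : ℕ → ℕ → M0 → Prop := fun i j y =>
    (φ i).Realize (Sum.elim (fun p : (Set.univ : Set (UP M0)) => rep p.1 j) (fun _ => y))
  have los : ∀ i (y : ℕ → M0), S i (upmk y) ↔ ∀ᶠ j in (Filter.hyperfilter ℕ : Filter ℕ), R i j (y j) := by
    intro i y
    refine (hφ i (fun _ => upmk y)).trans ?_
    have := Ultraproduct.realize_formula_cast (u := Filter.hyperfilter ℕ) (M := fun _ => M0) (φ i) (Sum.elim (fun p : (Set.univ : Set (UP M0)) => rep p.1) (fun _ => y))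
    have e1 : (Sum.elim (fun a : (Set.univ : Set (UP M0)) => (a : UP M0)) (fun _ => upmk y)) =
      fun k => upmk ((Sum.elim (fun p : (Set.univ : Set (UP M0)) => rep p.1) (fun _ => y) : _ ⊕ ℕ → ℕ → M0) k) := by
      ext k; rcases k with k | k
      · exact (hrep k.1).symm
      · rfl
    rw [e1]
    refine this.trans ?_
    refine Filter.eventually_congr (Filter.Eventually.of_forall fun j => ?_)
    simp only [R]
    congr! 1
    ext k; rcases k with k | k <;> rfl
  let W : ℕ → ℕ → Prop := fun j n => ∃ y, ∀ i ≤ n, R i j y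
  have hW : ∀ n, ∀ᶠ j in (Filter.hyperfilter ℕ : Filter ℕ), W j n := by
    intro n
    obtain ⟨x, hx⟩ := h n
    have : ∀ i ∈ Finset.range (n+1), ∀ᶠ j in (Filter.hyperfilter ℕ : Filter ℕ), R i j (rep x j) := by
      intro i hi
      rw [← los, hrep]
      exact hx i (by simp at hi; omega)
    have := (Filter.eventually_all_finset (Finset.range (n+1))).2 this
    filter_upwards [this] with j hj
    exact ⟨_, fun i hi => hj i (by simp; omega)⟩
  have hy : ∀ j, ∃ y : M0, W j (Nat.findGreatest (W j) j) → ∀ i ≤ Nat.findGreatest (W j) j, R i j y := by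
    intro j
    by_cases hw : W j (Nat.findGreatest (W j) j)
    · obtain ⟨y, hy⟩ := hw
      exact ⟨y, fun _ => hy⟩
    · exact ⟨Classical.arbitrary _, fun h => (hw h).elim⟩
  choose y hy using hy
  refine ⟨upmk y, fun n => ?_⟩
  rw [los]
  have hge : ∀ᶠ j in (Filter.hyperfilter ℕ : Filter ℕ), n ≤ j :=
    Nat.hyperfilter_le_atTop (Filter.eventually_ge_atTop n)
  filter_upwards [hge, hW n] with j h1 h2
  exact hy j (Nat.findGreatest_spec h1 h2) n (Nat.le_findGreatest h1 h2)

/-- the OM instance -/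
@[reducible] noncomputable def omUP [Countable L.Symbols] {M0 : Type} [L.Structure M0] [Nonempty M0] {lt : L.Relations 2}
    (hM : OMinimalStructure lt (UP M0)) : OM (UP M0) :=
  { glo hM with
    dp := gdp L (UP M0)
    mono := gdp.mono
    and := gdp.and
    not := gdp.not
    ex' := gdp.ex
    ren := gdp.ren
    eq0 := gdp.eq0
    lt0 := gdp.lt0 lt
    cst := gdp.cst
    extr := gdp.extr
    fin := gdp.fin
    fv := gdp.fv
    ctb := gdp.ctb
    conv := fun h => by
      let _ := glo hM
      obtain ⟨N, f, h1, h2⟩ := omin_conv hM h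
      exact ⟨N, f, h1, lo_conv h2⟩
    cut := fun h hd => by
      let _ := glo hM
      obtain ⟨N, f, h1, h2⟩ := omin_conv hM h
      exact lo_cut h1 h2 hd
    sat := up_sat }

end glue
end QOM

namespace QOM

section glue2
variable {L : FirstOrder.Language.{u, v}}

def gElem (L : FirstOrder.Language.{u, v}) {M : Type} [L.Structure M] (N : Set M) : Prop :=
  ∀ S : M → Prop, gdp L M N (fun v => S (v 0)) → (∃ x, S x) → ∃ x ∈ N, S x

theorem gElem.sub {M : Type} [L.Structure M] {N : Set M} (hN : gElem L N) :
    ∃ S : L.ElementarySubstructure M, (S : Set M) = N := by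
  let S0 : L.Substructure M :=
    { carrier := N
      fun_mem := by
        intro n f x hx
        obtain ⟨y, hy, hy'⟩ := hN (fun y => y = Structure.funMap f x)
          ⟨Term.equal (Term.var (Sum.inr 0)) (Term.func f (fun i => Term.var (Sum.inl ⟨x i, hx i⟩))), fun v => by
            simp [Formula.realize_equal]⟩ ⟨_, rfl⟩
        rw [← hy']; exact hy }
  refine ⟨⟨S0, S0.isElementary_of_exists ?_⟩, rfl⟩
  intro n φ x a ha
  let s : Empty ⊕ Fin (n+1) → N ⊕ ℕ := Sum.elim Empty.elim
    (Fin.snoc (α := fun _ => N ⊕ ℕ) (fun i => Sum.inl (x i)) (Sum.inr 0))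
  have key : ∀ y : ℕ → M, (φ.toFormula.relabel s).Realize (Sum.elim (fun a : N => (a : M)) y) ↔
      φ.Realize default (Fin.snoc ((↑) ∘ x) (y 0) : _ → M) := by
    intro y
    rw [Formula.realize_relabel, BoundedFormula.realize_toFormula]
    have e1 : ((Sum.elim (fun a : N => (a : M)) y) ∘ s) ∘ Sum.inl = (default : Empty → M) :=
      Subsingleton.elim _ _
    have e2 : ((Sum.elim (fun a : N => (a : M)) y) ∘ s) ∘ Sum.inr = (Fin.snoc ((↑) ∘ x) (y 0) : _ → M) := by
      ext i
      refine Fin.lastCases ?_ (fun i => ?_) i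
      · simp [s]
      · simp [s]
    rw [e1, e2]
  obtain ⟨b, hb, hb'⟩ := hN (fun y => φ.Realize default (Fin.snoc ((↑) ∘ x) y : _ → M))
    ⟨φ.toFormula.relabel s, fun v => (key v).symm⟩ ⟨a, ha⟩
  exact ⟨⟨b, hb⟩, hb'⟩

theorem gElem_range {M N : Type} [L.Structure M] [L.Structure N] (g : N ↪ₑ[L] M) : gElem L (Set.range g) := by
  rintro S ⟨φ, hφ⟩ ⟨x, hx⟩
  have : ∀ a : Set.range g, ∃ b, g b = a := fun a => a.2
  choose pre hpre using this
  let ψ : L.Formula (N ⊕ Unit) := φ.relabel (Sum.map pre (fun _ => ()))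
  have key : ∀ y, S y ↔ ψ.Realize (Sum.elim g (fun _ => y)) := by
    intro y
    refine (hφ (fun _ => y)).trans ?_
    rw [Formula.realize_relabel]
    congr! 1
    ext k; rcases k with k | k
    · exact (hpre k).symm
    · rfl
  have h1 : (ψ.iExs Unit).Realize (g ∘ id) := by
    rw [Formula.realize_iExs]
    exact ⟨fun _ => x, (key x).1 hx⟩
  rw [g.map_formula, Formula.realize_iExs] at h1
  obtain ⟨i, hi⟩ := h1
  refine ⟨g (i ()), ⟨_, rfl⟩, ?_⟩
  rw [key]
  rw [← g.map_formula] at hi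
  convert hi using 1
  ext k; rcases k with k | k <;> rfl

theorem equiv_range {M N : Type} [L.Structure M] [L.Structure N] (g : N ↪ₑ[L] M)
    (S : L.ElementarySubstructure M) (h : (S : Set M) = Set.range g) : Nonempty (N ≃[L] S) := by
  obtain ⟨S0, hS0⟩ := S
  have h0 : S0 = g.toEmbedding.toHom.range := by
    apply SetLike.coe_injective
    rw [Hom.range_coe]
    exact h
  subst h0
  exact ⟨g.toEmbedding.equivRange⟩

theorem iso_glue {M : Type} [L.Structure M] [Nonempty M] (S S' : L.ElementarySubstructure M) :
    Nonempty (S ≃[L] S') ↔ ∃ σ : M → M, Set.BijOn σ S S' ∧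
      ∀ P, gdp L M ∅ P → ∀ v : ℕ → M, (∀ i, v i ∈ (S : Set M)) → (P v ↔ P (fun i => σ (v i))) := by
  classical
  constructor
  · rintro ⟨e⟩
    let σ : M → M := fun x => if h : x ∈ S then (e ⟨x, h⟩ : M) else x
    have hσ : ∀ x : S, σ x = e x := fun x => by simp [σ]
    refine ⟨σ, ⟨?_, ?_, ?_⟩, ?_⟩
    · intro x hx
      rw [hσ ⟨x, hx⟩]; exact (e ⟨x, hx⟩).2
    · intro x hx y hy hxy
      rw [hσ ⟨x, hx⟩, hσ ⟨y, hy⟩] at hxy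
      have := e.injective (Subtype.ext hxy)
      exact congrArg Subtype.val this
    · intro y hy
      refine ⟨(e.symm ⟨y, hy⟩ : M), (e.symm ⟨y, hy⟩).2, ?_⟩
      rw [hσ]; simp
    · rintro P ⟨φ, hφ⟩ v hv
      rw [hφ, hφ]
      let v' : (∅ : Set M) ⊕ ℕ → S := Sum.elim (fun a => a.2.elim) (fun i => ⟨v i, hv i⟩)
      have e1 : (Sum.elim (fun a : (∅ : Set M) => (a : M)) v) = S.subtype ∘ v' := by
        ext k; rcases k with k | k
        · exact k.2.elim
        · rfl
      have e2 : (Sum.elim (fun a : (∅ : Set M) => (a : M)) (fun i => σ (v i))) = S'.subtype ∘ (e.toElementaryEmbedding ∘ v') := by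
        ext k; rcases k with k | k
        · exact k.2.elim
        · exact hσ ⟨v k, hv k⟩
      rw [e1, e2, S.subtype.map_formula, S'.subtype.map_formula, e.toElementaryEmbedding.map_formula]
  · rintro ⟨σ, hb, hP⟩
    let e : S ≃ S' := Set.BijOn.equiv σ hb
    have he : ∀ x : S, (e x : M) = σ x := fun x => rfl
    refine ⟨{ e with map_fun' := ?_, map_rel' := ?_ }⟩
    · intro n f x
      apply Subtype.ext
      let v : ℕ → M := fun k => if h : k < n then x ⟨k, h⟩ else (Structure.funMap f x : S)
      have hv : ∀ k, v k ∈ (S : Set M) := fun k => by simp only [v]; split_ifs <;> exact Subtype.prop _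
      have h1 : (fun i : Fin n => v i) = fun i => (x i : M) := funext fun i => by simp [v]
      have h2 : v n = (Structure.funMap f x : S) := by simp [v]
      have h3 : (fun i : Fin n => σ (v i)) = fun i => (e (x i) : M) := funext fun i => by rw [he]; simp [v]
      have := (hP (fun v => v n = Structure.funMap f (fun i : Fin n => v i))
        ⟨Term.equal (Term.var (Sum.inr n)) (Term.func f (fun i => Term.var (Sum.inr i))), fun v => by
            simp [Formula.realize_equal]⟩ v hv).1 (by rw [h1, h2]; rfl)
      rw [h3] at this
      simp only [h2] at this
      exact this
    · intro n r x
      obtain ⟨s0⟩ : Nonempty S := inferInstance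
      let v : ℕ → M := fun k => if h : k < n then x ⟨k, h⟩ else s0
      have hv : ∀ k, v k ∈ (S : Set M) := fun k => by simp only [v]; split_ifs <;> exact Subtype.prop _
      have h1 : (fun i : Fin n => v i) = fun i => (x i : M) := funext fun i => by simp [v]
      have h3 : (fun i : Fin n => σ (v i)) = fun i => (e (x i) : M) := funext fun i => by rw [he]; simp [v]
      have := (hP (fun v => Structure.RelMap r (fun i : Fin n => v i))
        ⟨r.formula (fun i => Term.var (Sum.inr i)), fun v => by
            simp [Formula.realize_rel]⟩ v hv)
      rw [h1, h3] at this
      exact this.symm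

theorem embed [Countable L.Symbols] {M0 N : Type} [L.Structure M0] [Nonempty M0] [L.Structure N] [Countable N]
    [Nonempty N] (h : ∀ φ : L.Sentence, N ⊨ φ → M0 ⊨ φ) : Nonempty (N ↪ₑ[L] UP M0) := by
  classical
  have hne : Nonempty {φ : L.Formula N // φ.Realize (id : N → N)} := ⟨⟨⊤, by simp⟩⟩
  obtain ⟨ψ, hψ⟩ := exists_surjective_nat {φ : L.Formula N // φ.Realize (id : N → N)}
  have key : ∀ φ : L.Formula N, φ.Realize (id : N → N) → ∃ x : N → M0, φ.Realize x := by
    intro φ hφ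
    let χ : L.Formula φ.freeVarFinset := φ.restrictFreeVar id
    have h1 : N ⊨ ((χ.relabel (Sum.inr : _ → Empty ⊕ φ.freeVarFinset)).iExs φ.freeVarFinset : L.Sentence) := by
      rw [Sentence.Realize, Formula.realize_iExs]
      refine ⟨fun a => a.1, ?_⟩
      rw [Formula.realize_relabel]
      exact (BoundedFormula.realize_restrictFreeVar (φ := φ) (f := id) (v := fun a => a.1) (xs := default) id (fun a => rfl)).2 hφ
    have h2 := h _ h1
    rw [Sentence.Realize, Formula.realize_iExs] at h2
    obtain ⟨i, hi⟩ := h2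
    rw [Formula.realize_relabel] at hi
    refine ⟨fun a => if h : a ∈ φ.freeVarFinset then i ⟨a, h⟩ else Classical.arbitrary _, ?_⟩
    exact (BoundedFormula.realize_restrictFreeVar _ (fun a => by simp)).1 hi
  have key2 : ∀ n, ∃ x : N → M0, ∀ i ≤ n, (ψ i).1.Realize x := by
    intro n
    have h3 : ∀ n, ∃ θ : L.Formula N, ∀ (K : Type) [L.Structure K] (x : N → K), θ.Realize x ↔ ∀ i ≤ n, (ψ i).1.Realize x := by
      intro n
      induction n with
      | zero => exact ⟨(ψ 0).1, fun K _ x => by simp⟩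
      | succ n ih =>
        obtain ⟨θ, hθ⟩ := ih
        refine ⟨θ ⊓ (ψ (n+1)).1, fun K _ x => ?_⟩
        rw [Formula.realize_inf, hθ]
        constructor
        · rintro ⟨h1, h2⟩ i hi
          rcases Nat.le_succ_iff.1 hi with h | h
          · exact h1 i h
          · rw [h]; exact h2
        · exact fun h => ⟨fun i hi => h i (by omega), h _ le_rfl⟩
    obtain ⟨θ, hθ⟩ := h3 n
    obtain ⟨x, hx⟩ := key θ ((hθ N id).2 fun i _ => (ψ i).2)
    exact ⟨x, (hθ M0 x).1 hx⟩
  choose x hx using key2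
  let g : N → UP M0 := fun a => upmk (fun j => x j a)
  have hg : ∀ φ : L.Formula N, φ.Realize (id : N → N) → φ.Realize g := by
    intro φ hφ
    obtain ⟨k, hk⟩ := hψ ⟨φ, hφ⟩
    refine (Ultraproduct.realize_formula_cast (u := Filter.hyperfilter ℕ) (M := fun _ => M0) φ (fun a j => x j a)).2 ?_
    have hge : ∀ᶠ j in (Filter.hyperfilter ℕ : Filter ℕ), k ≤ j :=
      Nat.hyperfilter_le_atTop (Filter.eventually_ge_atTop k)
    filter_upwards [hge] with j hj
    have := hx j k hj
    rw [hk] at this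
    exact this
  refine ⟨⟨g, fun n φ y => ?_⟩⟩
  have h1 := hg (φ.relabel y)
  have h2 := hg (φ.relabel y).not
  rw [Formula.realize_relabel, Formula.realize_relabel] at h1
  rw [Formula.realize_not, Formula.realize_not, Formula.realize_relabel, Formula.realize_relabel] at h2
  exact ⟨fun h => by_contra fun h' => h2 h' h, h1⟩

end glue2
end QOM

namespace QOM
variable {L : FirstOrder.Language.{u, v}}

theorem omin_transport {lt : L.Relations 2} {X : Type} {Y : Type w} [L.Structure X] [L.Structure Y] (e : Y ≃[L] X)
    (h : OMinimalStructure lt Y) : OMinimalStructure lt X := by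
  have hlt : ∀ a b : Y, ltInterp lt (e a) (e b) ↔ ltInterp lt a b := by
    intro a b
    have := e.map_rel lt ![a, b]
    rw [ltInterp, ltInterp, ← this]
    congr! 1
    ext i; fin_cases i <;> rfl
  have hlt' : ∀ a b : X, ltInterp lt a b ↔ ltInterp lt (e.symm a) (e.symm b) := by
    intro a b
    rw [← hlt]; simp
  refine ⟨⟨fun a => ?_, fun a b c => ?_, fun a b => ?_⟩, ?_⟩
  · rw [hlt']; exact h.1.1 _
  · rw [hlt', hlt', hlt']; exact h.1.2.1 _ _ _
  · rw [hlt', hlt' b a]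
    have := h.1.2.2 (e.symm a) (e.symm b)
    rwa [e.symm.injective.eq_iff] at this
  · rintro s ⟨k, φ, c, rfl⟩
    obtain ⟨N, f, h1, h2⟩ := h.2 {y | φ.Realize (Sum.elim (e.symm ∘ c) (fun _ => y))} ⟨k, φ, e.symm ∘ c, rfl⟩
    refine ⟨N, fun i => {x | e.symm x ∈ f i}, ?_, fun i => ?_⟩
    · ext x
      have h3 : e.symm x ∈ {y | φ.Realize (Sum.elim (e.symm ∘ c) (fun _ => y))} ↔ e.symm x ∈ ⋃ i, f i := by rw [h1]
      simp only [Set.mem_ofPred_eq, Set.mem_iUnion] at h3 ⊢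
      rw [← h3, ← StrongHomClass.realize_formula e.symm φ]
      congr! 1
      ext k; rcases k with k | k <;> rfl
    · rcases h2 i with ⟨y, hy⟩ | ⟨a, b, hab⟩
      · refine Or.inl ⟨e y, ?_⟩
        ext x
        simp only [hy, Set.mem_ofPred_eq, Set.mem_singleton_iff]
        constructor
        · intro h; rw [← h]; simp
        · intro h; rw [h]; simp
      · refine Or.inr ⟨a.map e, b.map e, ?_⟩
        ext x
        simp only [hab, OIntv, Set.mem_ofPred_eq]
        have : e (e.symm x) = x := by simp
        constructor
        · rintro ⟨h1, h2⟩
          constructor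
          · intro y hy
            obtain ⟨z, hz, rfl⟩ := Option.mem_map.1 hy
            rw [← this, hlt]; exact h1 z hz
          · intro y hy
            obtain ⟨z, hz, rfl⟩ := Option.mem_map.1 hy
            rw [← this, hlt]; exact h2 z hz
        · rintro ⟨h1, h2⟩
          constructor
          · intro y hy
            rw [← hlt, this]; exact h1 _ (Option.mem_map_of_mem _ hy)
          · intro y hy
            rw [← hlt, this]; exact h2 _ (Option.mem_map_of_mem _ hy)

theorem omin_zero {lt : L.Relations 2} {T : L.Theory} (hom : OMinimalTheory.{u, v, w} lt T)
    (X : Type) [L.Structure X] [Nonempty X] [X ⊨ T] : OMinimalStructure lt X := by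
  let N : Theory.ModelType.{u, v, w} T := (Theory.ModelType.of T X).ulift
  have h := hom N.Carrier N.is_model
  let e0 : X ≃ ULift.{w} X := Equiv.ulift.symm
  let _ : L.Structure (ULift.{w} X) := e0.inducedStructure
  have e : X ≃[L] ULift.{w} X := e0.inducedStructureEquiv
  exact omin_transport e.symm h

theorem exists_ctble [Countable L.Symbols] {T : L.Theory} (hT : T.IsSatisfiable) : Nonempty (CtbleModel T) := by
  obtain ⟨M⟩ := hT
  suffices h : ∃ N : Theory.ModelType.{u, v, max u v} T, Countable N.Carrier by
    obtain ⟨N, hN⟩ := h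
    have : Small.{0} N := Countable.toSmall N.Carrier
    refine ⟨⟨N.shrink, ?_⟩⟩
    exact (equivShrink N.Carrier).symm.injective.countable
  rcases finite_or_infinite M.Carrier with hf | hf
  · exact ⟨M, inferInstance⟩
  · obtain ⟨S, -, hS⟩ := exists_elementarySubstructure_card_eq L (M := M.Carrier) ∅ (aleph0.{0}) le_rfl (by simp)
      (by
        have : L.card ≤ aleph0 := by
          rw [card]; exact mk_le_aleph0_iff.2 inferInstance
        simpa using this) (by simp)
    refine ⟨Theory.ModelType.of T S, ?_⟩
    have : #S ≤ aleph0 := by simpa using hS.le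
    exact mk_le_aleph0_iff.1 this

/-- Mayer's theorem: an o-minimal complete theory in a countable language has either `2^ℵ₀`
countable models or exactly `3^k · 6^s` countable models for some naturals `k, s`. -/
theorem ominimal_countable_models [Countable L.Symbols]
    (lt : L.Relations 2) (T : L.Theory) (hT : T.IsComplete)
    (hom : OMinimalTheory lt T) :
    IOmega T = 2 ^ aleph0 ∨ ∃ k s : ℕ, IOmega T = ((3 ^ k * 6 ^ s : ℕ) : Cardinal) := by
  classical
  obtain ⟨⟨M0, hM0⟩⟩ := exists_ctble hT.1
  have hmod : UP M0.Carrier ⊨ T := ⟨fun φ hφ => by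
    refine (Ultraproduct.sentence_realize (u := Filter.hyperfilter ℕ) (M := fun _ => M0.Carrier) φ).2 ?_
    exact Filter.Eventually.of_forall fun _ => M0.is_model.realize_of_mem φ hφ⟩
  have hne : Nonempty (UP M0.Carrier) := ⟨upmk fun _ => Classical.arbitrary _⟩
  have hO := omin_zero hom (UP M0.Carrier)
  let _ : OM (UP M0.Carrier) := omUP hO
  have hsub : ∀ N : CM (UP M0.Carrier), ∃ S : L.ElementarySubstructure (UP M0.Carrier), (S : Set _) = N.1 :=
    fun N => gElem.sub (L := L) N.2.1
  choose sb hsb using hsub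
  let F : CM (UP M0.Carrier) → CtbleModel T := fun N =>
    ⟨Theory.ModelType.of T (sb N), by
      have : Countable (sb N : Set (UP M0.Carrier)) := by rw [hsb]; exact N.2.2.to_subtype
      exact this⟩
  have hF : ∀ N N', (isoS (UP M0.Carrier)).r N N' ↔ (isoSetoid T).r (F N) (F N') := by
    intro N N'
    refine Iff.trans ?_ (iso_glue (sb N) (sb N')).symm
    rw [hsb, hsb]
    rfl
  let Φ : Quotient (isoS (UP M0.Carrier)) → Quotient (isoSetoid T) :=
    Quotient.map F (fun a b h => (hF a b).1 h)
  have hΦ : Function.Bijective Φ := by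
    constructor
    · intro a b
      induction a using Quotient.inductionOn with | _ a =>
      induction b using Quotient.inductionOn with | _ b =>
      intro h
      exact Quotient.sound ((hF a b).2 (Quotient.exact h))
    · intro b
      induction b using Quotient.inductionOn with | _ b =>
      obtain ⟨B, hB⟩ := b
      obtain ⟨g⟩ := embed (L := L) (M0 := M0.Carrier) (N := B.Carrier)
        (fun φ hφ => (hT.realize_sentence_iff φ M0.Carrier).2 ((hT.realize_sentence_iff φ B.Carrier).1 hφ))
      let N : CM (UP M0.Carrier) := ⟨Set.range g, gElem_range g, Set.countable_range g⟩
      refine ⟨Quotient.mk _ N, ?_⟩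
      obtain ⟨e⟩ := equiv_range g (sb N) (hsb N)
      exact Quotient.sound ⟨e.symm⟩
  have hc : #(Quotient (isoSetoid T)) = Cardinal.lift #(Quotient (isoS (UP M0.Carrier))) := by
    have := Cardinal.lift_mk_eq'.2 ⟨Equiv.ofBijective Φ hΦ⟩
    rw [this]
    simp
  rw [IOmega, hc]
  rcases abstract_main (UP M0.Carrier) with h | ⟨k, s, h⟩
  · left; rw [h]; simp
  · right; refine ⟨k, s, ?_⟩
    rw [h]; simp only [Cardinal.lift_natCast]

end QOM
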